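/- arXiv:1910.14245 — 6 statements merged into one kernel-verified Lean document; each statement's English description precedes it below -/
import Mathlib

section
/- For all nonzero integers n, l, and all smooth functions f, g : (0,1) → ℂ with compact support in (0,1), one has ⟨Δ̂₁f, Δ̂₁g⟩ = ⟨Δ̂f, Δ̂g⟩ (equivalently, Δ̂² = Δ̂₁*Δ̂₁ as quadratic forms on weighted L²((0,1); r dr)). -/
open MeasureTheory

/-- The operator `Δ̂ f = f'' + f'/r − (n²/r² + l²) f`. -/
noncomputable def hatD (n l : ℤ) (f : ℝ → ℂ) (r : ℝ) : ℂ :=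
  deriv (deriv f) r + deriv f r / (r : ℂ)
    - ((n : ℂ) ^ 2 / (r : ℂ) ^ 2 + (l : ℂ) ^ 2) * f r

/-- The operator `Δ̂₁ f = Δ̂ f − (2rl²/(n²+r²l²)) f'`. -/
noncomputable def hatD1 (n l : ℤ) (f : ℝ → ℂ) (r : ℝ) : ℂ :=
  hatD n l f r
    - (2 * (r : ℂ) * (l : ℂ) ^ 2 / ((n : ℂ) ^ 2 + (r : ℂ) ^ 2 * (l : ℂ) ^ 2)) * deriv f r

/-- Weighted inner product `⟨f,g⟩ = ∫₀¹ f(r) conj(g(r)) r dr`. -/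
noncomputable def wip (f g : ℝ → ℂ) : ℂ :=
  ∫ r in Set.Ioo (0:ℝ) 1, f r * (starRingEnd ℂ) (g r) * (r : ℂ)

/-- `Δ̂² = Δ̂₁* Δ̂₁` as quadratic forms: for smooth `f, g` compactly supported in `(0,1)`,
`⟨Δ̂₁ f, Δ̂₁ g⟩ = ⟨Δ̂ f, Δ̂ g⟩`. -/
theorem hatD_sq_eq_hatD1_star_hatD1 (n l : ℤ) (hn : n ≠ 0) (hl : l ≠ 0)
    (f g : ℝ → ℂ) (hf : ContDiff ℝ (⊤ : ℕ∞) f) (hg : ContDiff ℝ (⊤ : ℕ∞) g)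
    (hfs : tsupport f ⊆ Set.Ioo 0 1) (hgs : tsupport g ⊆ Set.Ioo 0 1) :
    wip (hatD1 n l f) (hatD1 n l g) = wip (hatD n l f) (hatD n l g) := by
  have hD : ∀ r : ℝ, (n : ℂ) ^ 2 + (r : ℂ) ^ 2 * (l : ℂ) ^ 2 ≠ 0 := by
    intro r h
    have h1 : (n : ℝ) ^ 2 + r ^ 2 * (l : ℝ) ^ 2 = 0 := by exact_mod_cast h
    have h2 : (n : ℝ) ≠ 0 := by exact_mod_cast hn
    have h3 : 0 < (n : ℝ) ^ 2 := by positivity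
    have h4 : 0 ≤ r ^ 2 * (l : ℝ) ^ 2 := by positivity
    linarith
  have hf1 : ContDiff ℝ (⊤ : ℕ∞) (deriv f) := (contDiff_infty_iff_deriv.1 hf).2
  have hg1 : ContDiff ℝ (⊤ : ℕ∞) (deriv g) := (contDiff_infty_iff_deriv.1 hg).2
  have hc : ContDiff ℝ (⊤ : ℕ∞) (fun r : ℝ => (r : ℂ)) := Complex.ofRealCLM.contDiff
  have hG : ContDiff ℝ (⊤ : ℕ∞) (fun r => (starRingEnd ℂ) (g r)) :=
    Complex.conjCLE.contDiff.comp hg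
  have hG1 : ContDiff ℝ (⊤ : ℕ∞) (fun r => (starRingEnd ℂ) (deriv g r)) :=
    Complex.conjCLE.contDiff.comp hg1
  have dd : ∀ h : ℝ → ℂ, ContDiff ℝ (⊤ : ℕ∞) h → ∀ r, HasDerivAt h (deriv h r) r := by
    intro h hh r
    exact (hh.differentiable (by simp)).differentiableAt.hasDerivAt
  have ddc : ∀ h : ℝ → ℂ, ContDiff ℝ (⊤ : ℕ∞) h → ∀ r,
      HasDerivAt (fun r => (starRingEnd ℂ) (h r)) ((starRingEnd ℂ) (deriv h r)) r := by
    intro h hh r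
    exact (dd h hh r).star
  have dc : ∀ r : ℝ, HasDerivAt (fun r : ℝ => (r : ℂ)) 1 r := fun r =>
    Complex.ofRealCLM.hasDerivAt
  obtain ⟨H, hH⟩ : ∃ H : ℝ → ℂ, H = fun r : ℝ =>
    2 * (l : ℂ) ^ 2 * (f r * (starRingEnd ℂ) (g r))
    - (2 * (l : ℂ) ^ 2 * (r : ℂ) ^ 2 / ((n : ℂ) ^ 2 + (r : ℂ) ^ 2 * (l : ℂ) ^ 2)) *
      (deriv f r * (starRingEnd ℂ) (deriv g r)) := ⟨_, rfl⟩
  have hHs : ContDiff ℝ (⊤ : ℕ∞) H := by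
    rw [hH]
    refine (contDiff_const.mul (hf.mul hG)).sub (ContDiff.mul ?_ (hf1.mul hG1))
    simp only [div_eq_mul_inv]
    exact (contDiff_const.mul (hc.pow 2)).mul
      (ContDiff.inv (contDiff_const.add ((hc.pow 2).mul contDiff_const)) hD)
  have f0 : ∀ r, r ∉ Set.Ioo (0:ℝ) 1 → f r = 0 ∧ deriv f r = 0 := by
    intro r hr
    refine ⟨image_eq_zero_of_notMem_tsupport fun h => hr (hfs h), ?_⟩
    exact image_eq_zero_of_notMem_tsupport fun h => hr (hfs (tsupport_deriv_subset h))
  have hz : ∀ r, r ∉ Set.Ioo (0:ℝ) 1 → H r = 0 := by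
    intro r hr
    rw [hH]
    simp [f0 r hr]
  have hcont : Continuous (deriv H) := hHs.continuous_deriv (by simp)
  have hint : ∫ r in Set.Ioo (0:ℝ) 1, deriv H r = 0 := by
    rw [← integral_Ioc_eq_integral_Ioo, ← intervalIntegral.integral_of_le zero_le_one,
      intervalIntegral.integral_deriv_eq_sub (fun x _ => (dd H hHs x).differentiableAt)
      (hcont.intervalIntegrable _ _), hz 1 (by simp), hz 0 (by simp), sub_zero]
  have hii : Integrable (deriv H) (volume.restrict (Set.Ioo (0:ℝ) 1)) :=
    (hcont.integrableOn_Icc (a := 0) (b := 1)).mono_set Set.Ioo_subset_Icc_self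
  have key : ∀ r ∈ Set.Ioo (0:ℝ) 1,
      hatD1 n l f r * (starRingEnd ℂ) (hatD1 n l g r) * (r : ℂ) =
      hatD n l f r * (starRingEnd ℂ) (hatD n l g r) * (r : ℂ) + deriv H r := by
    intro r hr
    have hr0 : (r : ℂ) ≠ 0 := by exact_mod_cast hr.1.ne'
    have e := (((dd f hf r).mul (ddc g hg r)).const_mul (2 * (l : ℂ) ^ 2)).sub
      (((((dc r).pow 2).const_mul (2 * (l : ℂ) ^ 2)).div
        ((((dc r).pow 2).mul_const ((l : ℂ) ^ 2)).const_add ((n : ℂ) ^ 2)) (hD r)).mul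
        ((dd _ hf1 r).mul (ddc _ hg1 r)))
    have e3 : deriv H r = _ := (congrArg (fun F => deriv F r) hH).trans e.deriv
    rw [e3]
    have := hD r
    simp only [hatD1, hatD, map_sub, map_add, map_mul, map_div₀, map_pow, Complex.conj_ofReal,
      map_intCast, map_ofNat, Pi.mul_apply, Pi.pow_apply, Pi.div_apply]
    generalize (starRingEnd ℂ) (deriv (deriv g) r) = G2
    generalize (starRingEnd ℂ) (deriv g r) = G1
    generalize (starRingEnd ℂ) (g r) = G0
    field_simp
    ring
  unfold wip
  rw [setIntegral_congr_fun measurableSet_Ioo key]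
  by_cases hB : Integrable (fun r : ℝ => hatD n l f r * (starRingEnd ℂ) (hatD n l g r) * (r : ℂ))
      (volume.restrict (Set.Ioo (0:ℝ) 1))
  · rw [integral_add hB hii, hint, add_zero]
  · rw [integral_undef hB, integral_undef]
    intro h
    apply hB
    refine (h.sub hii).congr (Filter.Eventually.of_forall fun r => ?_)
    simp
end

section
/- For all nonzero integers n, l, every real λ > 1, and every smooth function W : [0,1] → ℂ with W(0) = W(1) = 0, one has ∫₀¹ ( r|W'(r)|²/(n²+r²l²) + |W(r)|²/r ) dr ≥ ∫₀¹ 4n²(|n|+1)·r·|W(r)|² / ( (n²+r²l²)²·(λ−r²) ) dr. -/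
open MeasureTheory

lemma aux_cont (f : ℝ → ℝ) (s : Set ℝ) (c C : ℝ) (hf : ContinuousOn f s)
    (hb : ∀ r ∈ s, |f r| ≤ C * (r - c) ^ 2) :
    ContinuousOn (fun r => f r / (r - c)) s := by
  intro x hx
  by_cases hxc : x = c
  · subst hxc
    unfold ContinuousWithinAt
    simp only [sub_self, div_zero]
    have h1 : Filter.Tendsto (fun r : ℝ => C * |r - x|) (nhdsWithin x s) (nhds 0) := by
      have : Continuous (fun r : ℝ => C * |r - x|) := by fun_prop
      have h := this.tendsto x
      simp only [sub_self, abs_zero, mul_zero] at h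
      exact h.mono_left nhdsWithin_le_nhds
    apply squeeze_zero_norm' _ h1
    filter_upwards [self_mem_nhdsWithin] with r hr
    rw [Real.norm_eq_abs, abs_div]
    by_cases h : r = x
    · subst h; simp
    · have hp : 0 < |r - x| := abs_pos.mpr (sub_ne_zero.mpr h)
      rw [div_le_iff₀ hp]
      have := hb r hr
      rw [← sq_abs (r - x)] at this
      linarith
  · exact (hf x hx).div (by fun_prop) (sub_ne_zero.mpr hxc)

lemma aux_poly (m L s : ℝ) (hm : 1 ≤ m) (hL : 0 ≤ L) (h0 : 0 ≤ s) (h1 : s ≤ 1) :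
    -4 * s * (m^2 + s * L) - 2 * s * L * (m - (m+2)*s) * (1 - s)
      + (m - (m+2)*s)^2 * (m^2 + s * L) + 4 * m^2 * (m+1) * s * (1 - s)
      ≤ (m^2 + s * L)^2 * (1-s)^2 := by
  have h : 0 ≤ (1-s) * (L * s * (m * ((m * (1 - s) + 2 + 2 * s))) + L^2 * s^2 * (1-s)) := by
    have : 0 ≤ 1 - s := by linarith
    positivity
  nlinarith [h]

lemma aux_point (m L r lam : ℝ) (hm : 1 ≤ m) (hL : 0 ≤ L) (h0 : 0 < r) (h1 : r < 1)
    (hlam : 1 < lam) :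
    -(4 * r / (1 - r^2)^2) / (m^2 + r^2 * L)
      - (m - 2 * r^2/(1-r^2)) * (2 * r * L) / (m^2 + r^2 * L)^2
      + (m - 2 * r^2/(1-r^2))^2 / (r * (m^2 + r^2 * L))
      + 4 * m^2 * (m + 1) * r / ((m^2 + r^2 * L)^2 * (lam - r^2)) ≤ 1 / r := by
  have hs : 0 < 1 - r^2 := by nlinarith
  have hD : 0 < m^2 + r^2 * L := by positivity
  have hle : 4 * m^2 * (m + 1) * r / ((m^2 + r^2 * L)^2 * (lam - r^2))
      ≤ 4 * m^2 * (m + 1) * r / ((m^2 + r^2 * L)^2 * (1 - r^2)) := by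
    gcongr
  refine le_trans (add_le_add_right hle _) ?_
  have hp := aux_poly m L (r^2) hm hL (by positivity) (by linarith)
  have key : 1 / r - (-(4 * r / (1 - r^2)^2) / (m^2 + r^2 * L)
      - (m - 2 * r^2/(1-r^2)) * (2 * r * L) / (m^2 + r^2 * L)^2
      + (m - 2 * r^2/(1-r^2))^2 / (r * (m^2 + r^2 * L))
      + 4 * m^2 * (m + 1) * r / ((m^2 + r^2 * L)^2 * (1 - r^2)))
      = ((m^2 + r^2 * L)^2 * (1-r^2)^2 - (-4 * r^2 * (m^2 + r^2 * L)
        - 2 * r^2 * L * (m - (m+2)*r^2) * (1 - r^2)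
      + (m - (m+2)*r^2)^2 * (m^2 + r^2 * L) + 4 * m^2 * (m+1) * r^2 * (1 - r^2)))
       / (r * (m^2 + r^2 * L)^2 * (1-r^2)^2) := by
    field_simp
    ring
  have : 0 ≤ ((m^2 + r^2 * L)^2 * (1-r^2)^2 - (-4 * r^2 * (m^2 + r^2 * L)
        - 2 * r^2 * L * (m - (m+2)*r^2) * (1 - r^2)
      + (m - (m+2)*r^2)^2 * (m^2 + r^2 * L) + 4 * m^2 * (m+1) * r^2 * (1 - r^2)))
       / (r * (m^2 + r^2 * L)^2 * (1-r^2)^2) :=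
    div_nonneg (by linarith) (by positivity)
  linarith

lemma aux_main (m L lam : ℝ) (hm : 1 ≤ m) (hL : 0 ≤ L) (hlam : 1 < lam)
    (W : ℝ → ℂ) (hW : ContDiffOn ℝ (⊤ : ℕ∞) W (Set.Icc 0 1))
    (hW0 : W 0 = 0) (hW1 : W 1 = 0) :
    (∫ r in Set.Ioo (0:ℝ) 1,
          4 * m ^ 2 * (m + 1) * r * ‖W r‖ ^ 2
            / ((m ^ 2 + r ^ 2 * L) ^ 2 * (lam - r ^ 2))) ≤
    (∫ r in Set.Ioo (0:ℝ) 1,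
        (r * ‖deriv W r‖ ^ 2 / (m ^ 2 + r ^ 2 * L) + ‖W r‖ ^ 2 / r)) := by
  have hD : ∀ r : ℝ, 0 < m^2 + r^2 * L := fun r => by positivity
  have hWc : ContinuousOn W (Set.Icc 0 1) := hW.continuousOn
  have hdc : ContinuousOn (derivWithin W (Set.Icc 0 1)) (Set.Icc 0 1) :=
    hW.continuousOn_derivWithin (uniqueDiffOn_Icc zero_lt_one) (by simp)
  have hdiff : DifferentiableOn ℝ W (Set.Icc 0 1) := hW.differentiableOn (by simp)
  obtain ⟨C, hC⟩ := isCompact_Icc.exists_bound_of_continuousOn hdc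
  have hLip : ∀ x ∈ Set.Icc (0:ℝ) 1, ∀ y ∈ Set.Icc (0:ℝ) 1, ‖W y - W x‖ ≤ C * ‖y - x‖ :=
    fun x hx y hy => (convex_Icc 0 1).norm_image_sub_le_of_norm_derivWithin_le hdiff hC hx hy
  have hqc : ContinuousOn (fun r => ‖W r‖^2) (Set.Icc 0 1) := hWc.norm.pow 2
  have hb : ∀ c ∈ Set.Icc (0:ℝ) 1, W c = 0 → ContinuousOn (fun r => ‖W r‖^2 / (r - c)) (Set.Icc 0 1) := by
    intro c hc hWcz
    apply aux_cont _ _ c (C^2) hqc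
    intro r hr
    have := hLip c hc r hr
    rw [hWcz, sub_zero] at this
    have h2 := pow_le_pow_left₀ (norm_nonneg _) this 2
    rw [mul_pow, Real.norm_eq_abs (r - c), sq_abs] at h2
    rwa [abs_of_nonneg (by positivity)]
  have hq0 := hb 0 (by simp) hW0
  have hq1 := hb 1 (by simp) hW1
  simp only [sub_zero] at hq0
  have hderiv : ∀ r ∈ Set.Ioo (0:ℝ) 1, derivWithin W (Set.Icc 0 1) r = deriv W r :=
    fun r hr => derivWithin_of_mem_nhds (Icc_mem_nhds hr.1 hr.2)
  -- integrability
  have hint1 : IntegrableOn (fun r => r * ‖deriv W r‖ ^ 2 / (m ^ 2 + r ^ 2 * L) + ‖W r‖ ^ 2 / r)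
      (Set.Ioo 0 1) := by
    have : ContinuousOn (fun r => r * ‖derivWithin W (Set.Icc 0 1) r‖ ^ 2 / (m ^ 2 + r ^ 2 * L)
        + ‖W r‖ ^ 2 / r) (Set.Icc 0 1) := by
      refine ContinuousOn.add (ContinuousOn.div ?_ (by fun_prop) (fun r _ => (hD r).ne')) hq0
      exact continuousOn_id.mul (hdc.norm.pow 2)
    refine IntegrableOn.congr_fun
      ((this.integrableOn_compact isCompact_Icc).mono_set Set.Ioo_subset_Icc_self) ?_ measurableSet_Ioo
    intro r hr
    simp only [hderiv r hr]
  have hint2 : IntegrableOn (fun r => 4 * m ^ 2 * (m + 1) * r * ‖W r‖ ^ 2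
            / ((m ^ 2 + r ^ 2 * L) ^ 2 * (lam - r ^ 2))) (Set.Ioo 0 1) := by
    have : ContinuousOn (fun r => 4 * m ^ 2 * (m + 1) * r * ‖W r‖ ^ 2
            / ((m ^ 2 + r ^ 2 * L) ^ 2 * (lam - r ^ 2))) (Set.Icc 0 1) := by
      refine ContinuousOn.div (ContinuousOn.mul (by fun_prop) hqc) (by fun_prop) ?_
      intro r hr
      have : 0 < lam - r^2 := by nlinarith [hr.1, hr.2]
      have := hD r
      positivity
    exact (this.integrableOn_compact isCompact_Icc).mono_set Set.Ioo_subset_Icc_self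
  rw [← sub_nonneg, ← integral_sub hint1 hint2]
  have hint := hint1.sub hint2
  rw [← integral_Ioc_eq_integral_Ioo, ← intervalIntegral.integral_of_le zero_le_one]
  let G : ℝ → ℝ := fun r => (m - 2 * r^2/(1-r^2)) / (m^2 + r^2 * L) * ‖W r‖^2
  have hGc : ContinuousOn G (Set.Icc 0 1) := by
    have : ContinuousOn (fun r => m / (m^2 + r^2 * L) * ‖W r‖^2
        + 2 * r^2 / (1 + r) / (m^2 + r^2 * L) * (‖W r‖^2 / (r - 1))) (Set.Icc 0 1) := by
      refine ContinuousOn.add (ContinuousOn.mul ?_ hqc) (ContinuousOn.mul ?_ hq1)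
      · exact ContinuousOn.div (by fun_prop) (by fun_prop) (fun r _ => (hD r).ne')
      · refine ContinuousOn.div (ContinuousOn.div (by fun_prop) (by fun_prop) ?_)
          (by fun_prop) (fun r _ => (hD r).ne')
        intro r hr
        have := hr.1
        positivity
    refine this.congr ?_
    intro r hr
    by_cases h : r = 1
    · subst h; simp [G, hW1]
    · have h1 : r - 1 ≠ 0 := sub_ne_zero.mpr h
      have h2 : 1 + r ≠ 0 := by have := hr.1; positivity
      have h3 : 1 - r^2 = -((r - 1) * (1 + r)) := by ring
      have h4 := (hD r).ne'
      simp only [G, h3]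
      field_simp
      ring
  have hGd : ∀ r ∈ Set.Ioo (0:ℝ) 1, HasDerivAt G
      (((-(4 * r / (1 - r^2)^2)) * (m^2 + r^2 * L) - (m - 2 * r^2/(1-r^2)) * (2 * r * L))
        / (m^2 + r^2 * L)^2 * ‖W r‖^2
        + (m - 2 * r^2/(1-r^2)) / (m^2 + r^2 * L) * (2 * inner ℝ (W r) (deriv W r))) r := by
    intro r hr
    have hs : 1 - r^2 ≠ 0 := by
      have : 0 < 1 - r^2 := by nlinarith [hr.1, hr.2]
      exact this.ne'
    have hWd : HasDerivAt W (deriv W r) r :=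
      ((hdiff r ⟨hr.1.le, hr.2.le⟩).differentiableAt (Icc_mem_nhds hr.1 hr.2)).hasDerivAt
    have e1 : HasDerivAt (fun r : ℝ => r^2) (2 * r) r := by simpa using hasDerivAt_pow 2 r
    have e2 : HasDerivAt (fun r : ℝ => m - 2 * r^2/(1-r^2)) (-(4 * r / (1 - r^2)^2)) r := by
      have := ((e1.const_mul 2).div (e1.const_sub 1) hs).const_sub m
      refine this.congr_deriv ?_
      field_simp
      ring
    have e3 : HasDerivAt (fun r : ℝ => m^2 + r^2 * L) (2 * r * L) r :=
      (e1.mul_const L).const_add (m^2)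
    exact (e2.div e3 (hD r).ne').mul hWd.norm_sq
  have hfin := intervalIntegral.sub_le_integral_of_hasDeriv_right_of_le zero_le_one hGc
    (fun r hr => (hGd r hr).hasDerivWithinAt) ((integrableOn_Icc_iff_integrableOn_Ioo).mpr hint) ?_
  · simpa [G, hW0, hW1] using hfin
  · intro r hr
    simp only [Pi.sub_apply]
    have hp := aux_point m L r lam hm hL hr.1 hr.2 hlam
    have h0 := hr.1
    have hDr := hD r
    set X := m - 2 * r^2/(1-r^2) with hX
    set D := m^2 + r^2 * L with hDdef
    have hi : X * (2 * inner ℝ (W r) (deriv W r)) ≤ r * ‖deriv W r‖^2 + X^2 / r * ‖W r‖^2 := by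
      have hcs := abs_real_inner_le_norm (W r) (deriv W r)
      have : X * inner ℝ (W r) (deriv W r) ≤ |X| * (‖W r‖ * ‖deriv W r‖) := by
        refine (le_abs_self _).trans ?_
        rw [abs_mul]
        gcongr
      have h2 : 0 ≤ (r * ‖deriv W r‖ - |X| * ‖W r‖)^2 / r := by positivity
      have h3 : (r * ‖deriv W r‖ - |X| * ‖W r‖)^2 / r = r * ‖deriv W r‖^2 + X^2 / r * ‖W r‖^2
          - 2 * (|X| * (‖W r‖ * ‖deriv W r‖)) := by
        rw [← sq_abs X]
        field_simp
        ring
      linarith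
    have hi2 := div_le_div_of_nonneg_right hi hDr.le
    have hp2 := mul_le_mul_of_nonneg_right hp (sq_nonneg ‖W r‖)
    have c1 : (-(4 * r / (1 - r^2)^2) * D - X * (2 * r * L)) / D^2
        = -(4 * r / (1 - r^2)^2) / D - X * (2 * r * L) / D^2 := by
      rw [sub_div]; congr 1; rw [sq D, mul_div_mul_right _ _ hDr.ne']
    have c2 : (r * ‖deriv W r‖^2 + X^2 / r * ‖W r‖^2) / D
        = r * ‖deriv W r‖^2 / D + X^2 / (r * D) * ‖W r‖^2 := by
      field_simp
    have c3 : X / D * (2 * inner ℝ (W r) (deriv W r)) = X * (2 * inner ℝ (W r) (deriv W r)) / D := by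
      ring
    have c4 : 4 * m ^ 2 * (m + 1) * r * ‖W r‖ ^ 2 / (D ^ 2 * (lam - r ^ 2))
       = 4 * m ^ 2 * (m + 1) * r / (D ^ 2 * (lam - r ^ 2)) * ‖W r‖ ^ 2 := by ring
    have c5 : ‖W r‖^2 / r = 1 / r * ‖W r‖^2 := by ring
    rw [c1, c3, c4, c5]
    rw [c2] at hi2
    linarith


open MeasureTheory

/-- The key coercive inequality (Lemma 4.5): for `λ > 1` and `W` smooth with
`W(0) = W(1) = 0`,
`∫₀¹ (r|W'|²/(n²+r²l²) + |W|²/r) dr ≥ ∫₀¹ 4n²(|n|+1) r |W|²/((n²+r²l²)²(λ−r²)) dr`. -/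
theorem coercive_inequality_lambda_gt_one
    (n l : ℤ) (hn : n ≠ 0) (hl : l ≠ 0) (lam : ℝ) (hlam : 1 < lam)
    (W : ℝ → ℂ) (hW : ContDiffOn ℝ (⊤ : ℕ∞) W (Set.Icc 0 1))
    (hW0 : W 0 = 0) (hW1 : W 1 = 0) :
    (∫ r in Set.Ioo (0:ℝ) 1,
        (r * ‖deriv W r‖ ^ 2 / ((n : ℝ) ^ 2 + r ^ 2 * (l : ℝ) ^ 2) + ‖W r‖ ^ 2 / r))
      ≥ ∫ r in Set.Ioo (0:ℝ) 1,
          4 * (n : ℝ) ^ 2 * (|(n : ℝ)| + 1) * r * ‖W r‖ ^ 2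
            / (((n : ℝ) ^ 2 + r ^ 2 * (l : ℝ) ^ 2) ^ 2 * (lam - r ^ 2)) := by
  have hm : 1 ≤ |(n : ℝ)| := by exact_mod_cast Int.one_le_abs hn
  have h := aux_main |(n : ℝ)| ((l : ℝ)^2) lam hm (sq_nonneg _) hlam W hW hW0 hW1
  simp only [sq_abs] at h
  exact h
end

section
/- There is a universal constant C > 0 with the following property. Let n, l be nonzero integers, λ, δ ∈ (0,1], r₀ = λ^{1/2}, and assume r₀/δ ≥ max(|n|, 2) and |l|δ ≤ 1. Set I = [r₀−δ, r₀+δ] ∩ (0,1], ρ(r) = 1 if |r−r₀| > δ and ρ(r) = 0 if |r−r₀| ≤ δ, and χ₀(r) = ρ(r)/(λ−r²). Then for every smooth W : [0,1] → ℂ with W(0) = W(1) = 0 and W₁ = Δ̂₁W on (0,1): −Re⟨W/(n²+r²l²), W₁⟩ − Re⟨χ₀·W/(n²+r²l²), 4n²W/(n²+r²l²)⟩ ≥ E/3 − C·‖W‖²_{L²(I)} / ( r₀·δ·(|n|+r₀|l|) ), where ‖W‖²_{L²(I)} = ∫_I |W(r)|² r dr. -/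
open MeasureTheory

noncomputable def kD (k L s : ℝ) : ℝ := k ^ 2 + L ^ 2 * s ^ 2
noncomputable def kwA (k L s : ℝ) : ℝ :=
  -(√(kD k L s))⁻¹ + 2 * s ^ 2 / (kD k L s * (1 + 1/70000 - s ^ 2))
noncomputable def klg (y : ℝ) : ℝ := Real.log (1/10000) - Real.log y
noncomputable def kbe (k L : ℝ) : ℝ := 21 * k ^ 2 / (kD k L 1) ^ 2
noncomputable def kPhi (y : ℝ) : ℝ :=
  198 * (3/10000 - y * (klg y ^ 2 + 2 * klg y + 3))

theorem kD_ge {k : ℝ} (hk : 1 ≤ k) (L s : ℝ) : k ^ 2 ≤ kD k L s := by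
  unfold kD; nlinarith [mul_nonneg (sq_nonneg L) (sq_nonneg s)]

theorem kD_ge_one {k : ℝ} (hk : 1 ≤ k) (L s : ℝ) : 1 ≤ kD k L s := by
  have := kD_ge hk L s; nlinarith

theorem hasDerivAt_kD (k L s : ℝ) : HasDerivAt (kD k L) (2 * L ^ 2 * s) s := by
  have h := (((hasDerivAt_id s).pow 2).const_mul (L ^ 2)).const_add (k ^ 2)
  refine HasDerivAt.congr_deriv (f := kD k L) h ?_
  simp; ring

theorem kwA_ineq {k L s : ℝ} (hk : 1 ≤ k) (hs1 : s ^ 2 ≤ 1) :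
    ∃ w', HasDerivAt (kwA k L) w' s ∧
      8 * k ^ 2 * s ^ 2 / ((kD k L s) ^ 2 * (1 + 1/70000 - s ^ 2))
        ≤ s * w' - kD k L s * kwA k L s ^ 2 + 1 := by
  have hD := kD_ge hk L s
  have hD1 := kD_ge_one hk L s
  have hφ : 0 < 1 + 1/70000 - s ^ 2 := by linarith
  have hq : 1 ≤ √(kD k L s) := Real.one_le_sqrt.2 hD1
  have hqk : k ≤ √(kD k L s) := Real.le_sqrt_of_sq_le hD
  have hqq : √(kD k L s) ^ 2 = kD k L s := Real.sq_sqrt (by linarith)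
  have d1 := ((hasDerivAt_kD k L s).sqrt (by linarith)).inv (by positivity)
  have d2 : HasDerivAt (fun s : ℝ => 1 + 1/70000 - s ^ 2) (-(2 * s)) s := by
    have h := ((hasDerivAt_id s).pow 2).const_sub (1 + 1/70000)
    refine HasDerivAt.congr_deriv (f := fun s : ℝ => 1 + 1/70000 - s ^ 2) h ?_
    simp
  have d3 : HasDerivAt (fun s : ℝ => 2 * s ^ 2) (4 * s) s := by
    have h := ((hasDerivAt_id s).pow 2).const_mul 2
    refine HasDerivAt.congr_deriv (f := fun s : ℝ => 2 * s ^ 2) h ?_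
    simp; ring
  have d4 := d3.div ((hasDerivAt_kD k L s).mul d2) (by simp only [Pi.mul_apply]; positivity)
  have d5 := d1.neg.add d4
  refine ⟨_, d5, ?_⟩
  simp only [Pi.mul_apply]
  have hkk : kD k L s = k ^ 2 + L ^ 2 * s ^ 2 := rfl
  unfold kwA
  set φ := 1 + 1/70000 - s ^ 2 with hφd
  set q := √(kD k L s) with hqd
  have hs2 : L ^ 2 * s ^ 2 = q ^ 2 - k ^ 2 := by rw [hqq, hkk]; ring
  rw [← hqq]
  have key : s * (-(-(2 * L ^ 2 * s / (2 * q)) / q ^ 2) +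
        (4 * s * (q ^ 2 * φ) - 2 * s ^ 2 * (2 * L ^ 2 * s * φ + q ^ 2 * (-(2 * s)))) /
          (q ^ 2 * φ) ^ 2) -
      q ^ 2 * (-q⁻¹ + 2 * s ^ 2 / (q ^ 2 * φ)) ^ 2 + 1
      = L ^ 2 * s ^ 2 / q ^ 3 + 4 * s ^ 2 * (q ^ 2 - L ^ 2 * s ^ 2) / (q ^ 4 * φ) + 4 * s ^ 2 / (q * φ) := by
    field_simp
    ring
  rw [key, hs2]
  have e : 4 * s ^ 2 * k ^ 2 / (q ^ 4 * φ) ≤ 4 * s ^ 2 / (q * φ) := by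
    rw [div_le_div_iff₀ (by positivity) (by positivity)]
    have : k ^ 2 * q ≤ q ^ 4 := by
      have : k ^ 2 ≤ q ^ 2 := by gcongr
      have : q ^ 2 * q ≤ q ^ 2 * q ^ 2 := by gcongr; nlinarith
      nlinarith
    have := mul_le_mul_of_nonneg_left this (show 0 ≤ 4 * s ^ 2 * φ by positivity)
    linarith
  have e2 : 0 ≤ (q ^ 2 - k ^ 2) / q ^ 3 := by
    apply div_nonneg _ (by positivity)
    rw [hqq]; linarith
  have e3 : 8 * k ^ 2 * s ^ 2 / ((q ^ 2) ^ 2 * φ) = 4 * s ^ 2 * k ^ 2 / (q ^ 4 * φ) + 4 * s ^ 2 * (q ^ 2 - (q ^ 2 - k ^ 2)) / (q ^ 4 * φ) := by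
    field_simp; ring
  rw [e3]; linarith

theorem hasDerivAt_klg {y : ℝ} (hy : 0 < y) : HasDerivAt klg (-(1/y)) y := by
  have := (Real.hasDerivAt_log hy.ne').const_sub (Real.log (1/10000))
  refine HasDerivAt.congr_deriv (f := klg) this ?_
  simp

theorem hasDerivAt_kPhi {y : ℝ} (hy : 0 < y) : HasDerivAt kPhi (-(198 * (klg y ^ 2 + 1))) y := by
  have h := hasDerivAt_klg hy
  have h1 := (((h.pow 2).add (h.const_mul 2)).add_const 3)
  have h2 := (((hasDerivAt_id y).mul h1).const_sub (3/10000)).const_mul 198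
  refine HasDerivAt.congr_deriv (f := kPhi) h2 ?_
  simp
  field_simp
  ring

theorem klg_nonneg {y : ℝ} (hy : 0 < y) (hy1 : y ≤ 1/10000) : 0 ≤ klg y := by
  unfold klg; linarith [Real.log_le_log hy hy1]

theorem klg_exp {y : ℝ} (hy : 0 < y) : y * Real.exp (klg y) = 1/10000 := by
  unfold klg
  rw [Real.exp_sub, Real.exp_log (by norm_num), Real.exp_log hy]
  field_simp

theorem kPhi_bd {y : ℝ} (hy : 0 < y) (hy1 : y ≤ 1/10000) : 0 ≤ kPhi y ∧ kPhi y ≤ 594/10000 := by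
  have h0 := klg_nonneg hy hy1
  have h1 := klg_exp hy
  have h2 := Real.quadratic_le_exp_of_nonneg h0
  have h3 : 1 + klg y ≤ Real.exp (klg y) := by linarith [Real.add_one_le_exp (klg y)]
  unfold kPhi
  constructor
  · nlinarith [mul_le_mul_of_nonneg_left h2 hy.le, Real.add_one_le_exp (klg y)]
  · have : 0 ≤ y * (klg y ^ 2 + 2 * klg y + 3) := by positivity
    linarith

/-- the bound on the square of the logarithm -/
theorem klg_sq {y : ℝ} (hy : 0 < y) (hy1 : y ≤ 1/10000) : klg y ^ 2 ≤ 2 / y := by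
  have h0 := klg_nonneg hy hy1
  have h1 := klg_exp hy
  have h2 := Real.quadratic_le_exp_of_nonneg h0
  rw [le_div_iff₀ hy]
  nlinarith [mul_le_mul_of_nonneg_left h2 hy.le]

/-- core inequality near the critical layer -/
theorem core_near {k L s y g : ℝ} (hk : 1 ≤ k) (hy : 0 < y) (hy1 : y ≤ 1/10000)
    (hs : 1/2 ≤ s) (hs2 : s ≤ 3/2) (hDs : kD k L s ≤ 2 * s * kD k L 1)
    (hg : g ^ 2 ≤ 2 * (kbe k L * klg y) ^ 2 + 2 * (kbe k L * kPhi y) ^ 2) :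
    kD k L s / s * g ^ 2 + 8 * kbe k L ≤ 198 * kbe k L * (klg y ^ 2 + 1) := by
  have hD1 := kD_ge_one hk L 1
  have hD := kD_ge hk L 1
  have hb : kbe k L * kD k L 1 ≤ 21 := by
    unfold kbe
    rw [div_mul_eq_mul_div, div_le_iff₀ (by positivity)]
    nlinarith
  have hb0 : 0 ≤ kbe k L := by unfold kbe; positivity
  have h1 : kD k L s / s ≤ 2 * kD k L 1 := by
    rw [div_le_iff₀ (by linarith)]; linarith
  obtain ⟨p0, p1⟩ := kPhi_bd hy hy1
  have hΦ : kPhi y ^ 2 ≤ (594/10000) ^ 2 := by gcongr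
  have h2 : kD k L s / s * g ^ 2 ≤ 2 * kD k L 1 * (2 * (kbe k L * klg y) ^ 2 + 2 * (kbe k L * kPhi y) ^ 2) := by
    gcongr
  have h3 : 2 * kD k L 1 * (2 * (kbe k L * klg y) ^ 2 + 2 * (kbe k L * kPhi y) ^ 2)
     = 4 * (kbe k L * kD k L 1) * (kbe k L * (klg y ^ 2 + kPhi y ^ 2)) := by ring
  have h4 : 4 * (kbe k L * kD k L 1) * (kbe k L * (klg y ^ 2 + kPhi y ^ 2)) ≤ 4 * 21 * (kbe k L * (klg y ^ 2 + (594/10000) ^ 2)) := by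
    gcongr
  nlinarith [mul_nonneg hb0 (sq_nonneg (klg y))]

theorem V_left {k L y : ℝ} (hk : 1 ≤ k) (hy : 0 < y) (hy1 : y ≤ 1/10000) :
    42 * k ^ 2 * (1 - y) / ((kD k L (1 - y)) ^ 2 * (1 - (1 - y) ^ 2)) ≤ kbe k L / y + 8 * kbe k L := by
  have hD1 := kD_ge_one hk L 1
  have hD := kD_ge_one hk L (1 - y)
  have hc : kD k L 1 * (1 - y) ^ 2 ≤ kD k L (1 - y) := by
    unfold kD; nlinarith [sq_nonneg k, sq_nonneg L, mul_nonneg (sq_nonneg k) (show 0 ≤ 1 - (1 - y) ^ 2 by nlinarith)]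
  have hc2 : (kD k L 1 * (1 - y) ^ 2) ^ 2 ≤ kD k L (1 - y) ^ 2 := by gcongr
  have hp : 0 < 1 - (1 - y) ^ 2 := by nlinarith
  have hyy : 0 < 1 - y := by linarith
  have e : 42 * k ^ 2 * (1 - y) / ((kD k L (1 - y)) ^ 2 * (1 - (1 - y) ^ 2)) ≤
     42 * k ^ 2 * (1 - y) / ((kD k L 1 * (1 - y) ^ 2) ^ 2 * (1 - (1 - y) ^ 2)) := by
    gcongr
  refine e.trans ?_
  have e2 : 42 * k ^ 2 * (1 - y) / ((kD k L 1 * (1 - y) ^ 2) ^ 2 * (1 - (1 - y) ^ 2))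
      = kbe k L / y * (2 / ((1 - y) ^ 3 * (2 - y))) := by
    unfold kbe
    have : (1 - (1 - y) ^ 2) = y * (2 - y) := by ring
    rw [this]
    have : (2 - y) ≠ 0 := by linarith
    field_simp
    ring
  have e3 : 2 / ((1 - y) ^ 3 * (2 - y)) ≤ 1 + 8 * y := by
    have : 0 < 2 - y := by linarith
    rw [div_le_iff₀ (by positivity)]
    have : 1 - 3 * y ≤ (1 - y) ^ 3 := by nlinarith [sq_nonneg y]
    have : (1 - 3 * y) * (2 - y) ≤ (1 - y) ^ 3 * (2 - y) := by gcongr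
    nlinarith
  have hb0 : 0 ≤ kbe k L := by unfold kbe; positivity
  rw [e2]
  calc _ ≤ kbe k L / y * (1 + 8 * y) := by gcongr
    _ = _ := by field_simp

theorem V_right {k L y : ℝ} (hk : 1 ≤ k) (hy : 0 < y) (hy1 : y ≤ 1/10000) :
    42 * k ^ 2 * (1 + y) / ((kD k L (1 + y)) ^ 2 * (1 - (1 + y) ^ 2)) ≤ -(kbe k L / y) + 8 * kbe k L := by
  have hD1 := kD_ge_one hk L 1
  have hD := kD_ge_one hk L (1 + y)
  have hc : kD k L (1 + y) ≤ kD k L 1 * (1 + y) ^ 2 := by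
    unfold kD; nlinarith [sq_nonneg k, sq_nonneg L, mul_nonneg (sq_nonneg k) (show 0 ≤ (1 + y) ^ 2 - 1 by nlinarith)]
  have hc2 : kD k L (1 + y) ^ 2 ≤ (kD k L 1 * (1 + y) ^ 2) ^ 2 := by gcongr
  have hp : 0 < (1 + y) ^ 2 - 1 := by nlinarith
  have e : 42 * k ^ 2 * (1 + y) / ((kD k L 1 * (1 + y) ^ 2) ^ 2 * ((1 + y) ^ 2 - 1)) ≤
     42 * k ^ 2 * (1 + y) / ((kD k L (1 + y)) ^ 2 * ((1 + y) ^ 2 - 1)) := by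
    gcongr
  have e0 : 42 * k ^ 2 * (1 + y) / ((kD k L (1 + y)) ^ 2 * (1 - (1 + y) ^ 2)) = 
     - (42 * k ^ 2 * (1 + y) / ((kD k L (1 + y)) ^ 2 * ((1 + y) ^ 2 - 1))) := by
    rw [← div_neg]; congr 1; ring
  have e2 : 42 * k ^ 2 * (1 + y) / ((kD k L 1 * (1 + y) ^ 2) ^ 2 * ((1 + y) ^ 2 - 1))
      = kbe k L / y * (2 / ((1 + y) ^ 3 * (2 + y))) := by
    unfold kbe
    have : ((1 + y) ^ 2 - 1) = y * (2 + y) := by ring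
    rw [this]
    field_simp
    ring
  have e3 : 1 - 8 * y ≤ 2 / ((1 + y) ^ 3 * (2 + y)) := by
    rw [le_div_iff₀ (by positivity)]
    have : (1 + y) ^ 3 ≤ 1 + 4 * y := by nlinarith [sq_nonneg y]
    have : (1 + y) ^ 3 * (2 + y) ≤ (1 + 4 * y) * (2 + y) := by gcongr
    have := mul_le_mul_of_nonneg_left this (show 0 ≤ 1 - 8 * y by linarith)
    nlinarith [pow_pos hy 2, pow_pos hy 3]
  have hb0 : 0 ≤ kbe k L := by unfold kbe; positivity
  rw [e0]
  have : kbe k L / y * (1 - 8 * y) ≤ kbe k L / y * (2 / ((1 + y) ^ 3 * (2 + y))) := by gcongr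
  have e5 : kbe k L / y * (1 - 8 * y) = kbe k L / y - 8 * kbe k L := by field_simp
  linarith


noncomputable def kgL (k L s : ℝ) : ℝ :=
  if s < 1 - 1/10000 then 0 else kbe k L * (klg (1 - s) + kPhi (1 - s))
noncomputable def kgR (k L s : ℝ) : ℝ :=
  if s < 1 + 1/10000 then kbe k L * (klg (s - 1) - kPhi (s - 1)) else 0

theorem glue_cont {f g : ℝ → ℝ} {a : ℝ} {s : Set ℝ} (hf : ContinuousOn f (s ∩ Set.Iic a))
    (hg : ContinuousOn g (s ∩ Set.Ici a)) (hfg : f a = g a) :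
    ContinuousOn (fun x => if x < a then f x else g x) s := by
  have h1 : ContinuousOn (fun x => if x < a then f x else g x) (s ∩ Set.Iic a) := by
    apply hf.congr
    rintro x ⟨_, hx⟩
    rcases lt_or_eq_of_le (show x ≤ a from hx) with h | h
    · simp [h]
    · simp [h, hfg]
  have h2 : ContinuousOn (fun x => if x < a then f x else g x) (s ∩ Set.Ici a) := by
    apply hg.congr
    rintro x ⟨_, hx⟩
    simp [not_lt.2 (show a ≤ x from hx)]
  intro x hx
  have h3 : s = (s ∩ Set.Iic a) ∪ (s ∩ Set.Ici a) := by
    rw [← Set.inter_union_distrib_left, Set.Iic_union_Ici, Set.inter_univ]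
  rw [h3]
  rcases lt_trichotomy x a with h | h | h
  · refine ContinuousWithinAt.union (h1 x ⟨hx, h.le⟩) ?_
    apply continuousWithinAt_of_notMem_closure
    intro hc
    have := closure_mono Set.inter_subset_right hc
    rw [isClosed_Ici.closure_eq] at this
    exact absurd h (not_lt.2 this)
  · exact ContinuousWithinAt.union (h1 x ⟨hx, h.le⟩) (h2 x ⟨hx, h.ge⟩)
  · refine ContinuousWithinAt.union ?_ (h2 x ⟨hx, h.le⟩)
    apply continuousWithinAt_of_notMem_closure
    intro hc
    have := closure_mono Set.inter_subset_right hc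
    rw [isClosed_Iic.closure_eq] at this
    exact absurd h (not_lt.2 this)

theorem glue_der_lt {f g : ℝ → ℝ} {a x d : ℝ} (hx : x < a)
    (hf : HasDerivWithinAt f d (Set.Ioi x) x) :
    HasDerivWithinAt (fun x => if x < a then f x else g x) d (Set.Ioi x) x := by
  apply hf.congr_of_eventuallyEq
  · filter_upwards [mem_nhdsWithin_of_mem_nhds (Iio_mem_nhds hx)] with y hy
    simp [Set.mem_Iio.1 hy]
  · simp [hx]

theorem glue_der_ge {f g : ℝ → ℝ} {a x d : ℝ} (hx : a ≤ x)
    (hg : HasDerivWithinAt g d (Set.Ioi x) x) :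
    HasDerivWithinAt (fun x => if x < a then f x else g x) d (Set.Ioi x) x := by
  apply hg.congr
  · intro y hy
    simp [not_lt.2 (hx.trans (le_of_lt hy))]
  · simp [not_lt.2 hx]

theorem kgL_ineq {k L s : ℝ} (hk : 1 ≤ k) (hs0 : 0 < s) (hs1 : s < 1) :
    ∃ g', HasDerivWithinAt (kgL k L) g' (Set.Ioi s) s ∧
      0 ≤ s * g' - kD k L s * kgL k L s ^ 2 + 1 ∧ 
      (1 - 1/10000 ≤ s → 42 * k ^ 2 * s ^ 2 / ((kD k L s) ^ 2 * (1 - s ^ 2)) ≤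
        s * g' - kD k L s * kgL k L s ^ 2 + 1) := by
  by_cases h : s < 1 - 1/10000
  · refine ⟨0, glue_der_lt h (hasDerivWithinAt_const _ _ _), ?_, fun h' => absurd h (not_lt.2 h')⟩
    simp only [kgL, h, if_true]; norm_num
  · push Not at h
    obtain ⟨y, rfl⟩ : ∃ y, s = 1 - y := ⟨1 - s, by ring⟩
    have hy : 0 < y := by linarith
    have hy1 : y ≤ 1/10000 := by linarith
    have hc : HasDerivAt (fun s : ℝ => 1 - s) (-1) (1 - y) := by
      simpa using (hasDerivAt_id (1 - y)).const_sub 1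
    have e : 1 - (1 - y) = y := by ring
    have h1 := HasDerivAt.comp (1 - y) (h₂ := klg) (h := fun s : ℝ => 1 - s) (by rw [e]; exact hasDerivAt_klg hy) hc
    have h2 := HasDerivAt.comp (1 - y) (h₂ := kPhi) (h := fun s : ℝ => 1 - s) (by rw [e]; exact hasDerivAt_kPhi hy) hc
    have h3 := (h1.add h2).const_mul (kbe k L)
    have hb0 : 0 ≤ kbe k L := by
      have := kD_ge_one hk L 1
      unfold kbe; positivity
    have hG : kgL k L (1 - y) = kbe k L * klg y + kbe k L * kPhi y := by
      simp only [kgL, not_lt.2 h, if_false, e]; ring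
    have key := core_near (s := 1 - y) (L := L) (g := kgL k L (1 - y)) hk hy hy1 (by linarith) (by linarith)
      (by
        have := kD_ge_one hk L 1
        have : kD k L (1 - y) ≤ kD k L 1 := by
          unfold kD; nlinarith [mul_nonneg (sq_nonneg L) (show 0 ≤ 1 - (1 - y) ^ 2 by nlinarith)]
        nlinarith) 
      (by rw [hG]; nlinarith [sq_nonneg (kbe k L * klg y - kbe k L * kPhi y)])
    have hV := V_left (L := L) hk hy hy1
    have hm : kbe k L / y + 8 * kbe k L ≤ kbe k L * (-(1/y) * -1 + -(198 * (klg y ^ 2 + 1)) * -1) - kD k L (1 - y) / (1 - y) * kgL k L (1 - y) ^ 2 := by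
      have : kbe k L * (-(1/y) * -1 + -(198 * (klg y ^ 2 + 1)) * -1) = kbe k L / y + 198 * kbe k L * (klg y ^ 2 + 1) := by ring
      rw [this]; linarith
    have hpos : 0 < 1 - y := by linarith
    have hm2 := mul_le_mul_of_nonneg_left hm hpos.le
    have e5 : (1 - y) * (kbe k L * (-(1/y) * -1 + -(198 * (klg y ^ 2 + 1)) * -1) - kD k L (1 - y) / (1 - y) * kgL k L (1 - y) ^ 2) = (1 - y) * (kbe k L * (-(1/y) * -1 + -(198 * (klg y ^ 2 + 1)) * -1)) - kD k L (1 - y) * kgL k L (1 - y) ^ 2 := by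
      have : (1 - y) ≠ 0 := hpos.ne'
      field_simp
    rw [e5] at hm2
    refine ⟨_, glue_der_ge h h3.hasDerivWithinAt, ?_, fun _ => ?_⟩
    · have : 0 ≤ (1 - y) * (kbe k L / y + 8 * kbe k L) := by positivity
      linarith
    · have hV2 := mul_le_mul_of_nonneg_left hV hpos.le
      have : 42 * k ^ 2 * (1 - y) ^ 2 / ((kD k L (1 - y)) ^ 2 * (1 - (1 - y) ^ 2)) = (1 - y) * (42 * k ^ 2 * (1 - y) / ((kD k L (1 - y)) ^ 2 * (1 - (1 - y) ^ 2))) := by ring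
      rw [this]; linarith

theorem kgR_ineq {k L s : ℝ} (hk : 1 ≤ k) (hs1 : 1 < s) :
    ∃ g', HasDerivWithinAt (kgR k L) g' (Set.Ioi s) s ∧
      42 * k ^ 2 * s ^ 2 / ((kD k L s) ^ 2 * (1 - s ^ 2)) ≤
        s * g' - kD k L s * kgR k L s ^ 2 + 1 := by
  by_cases h : s < 1 + 1/10000
  swap
  · refine ⟨0, glue_der_ge (not_lt.1 h) (hasDerivWithinAt_const _ _ _), ?_⟩
    simp only [kgR, h, if_false]
    have : 42 * k ^ 2 * s ^ 2 / ((kD k L s) ^ 2 * (1 - s ^ 2)) ≤ 0 := by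
      apply div_nonpos_of_nonneg_of_nonpos (by positivity)
      apply mul_nonpos_of_nonneg_of_nonpos (by positivity); nlinarith
    norm_num; linarith
  · obtain ⟨y, rfl⟩ : ∃ y, s = 1 + y := ⟨s - 1, by ring⟩
    have hy : 0 < y := by linarith
    have hy1 : y ≤ 1/10000 := by linarith
    have hc : HasDerivAt (fun s : ℝ => s - 1) 1 (1 + y) := by
      simpa using (hasDerivAt_id (1 + y)).sub_const 1
    have e : (1 + y) - 1 = y := by ring
    have h1 := HasDerivAt.comp (1 + y) (h₂ := klg) (h := fun s : ℝ => s - 1) (by rw [e]; exact hasDerivAt_klg hy) hc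
    have h2 := HasDerivAt.comp (1 + y) (h₂ := kPhi) (h := fun s : ℝ => s - 1) (by rw [e]; exact hasDerivAt_kPhi hy) hc
    have h3 := (h1.sub h2).const_mul (kbe k L)
    have hG : kgR k L (1 + y) = kbe k L * klg y - kbe k L * kPhi y := by
      simp only [kgR, h, if_true, e]; ring
    have key := core_near (s := 1 + y) (L := L) (g := kgR k L (1 + y)) hk hy hy1 (by linarith) (by linarith)
      (by
        have := kD_ge_one hk L 1
        have : kD k L (1 + y) ≤ kD k L 1 * (1 + y) ^ 2 := by
          unfold kD; nlinarith [mul_nonneg (sq_nonneg k) (show 0 ≤ (1 + y) ^ 2 - 1 by nlinarith)]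
        nlinarith [mul_nonneg (show 0 ≤ kD k L 1 by linarith) (show 0 ≤ 1 - y ^ 2 by nlinarith)]) 
      (by rw [hG]; nlinarith [sq_nonneg (kbe k L * klg y + kbe k L * kPhi y)])
    have hV := V_right (L := L) hk hy hy1
    have hm : -(kbe k L / y) + 8 * kbe k L ≤ kbe k L * (-(1/y) * 1 - -(198 * (klg y ^ 2 + 1)) * 1) - kD k L (1 + y) / (1 + y) * kgR k L (1 + y) ^ 2 := by
      have : kbe k L * (-(1/y) * 1 - -(198 * (klg y ^ 2 + 1)) * 1) = -(kbe k L / y) + 198 * kbe k L * (klg y ^ 2 + 1) := by ring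
      rw [this]; linarith
    have hpos : 0 < 1 + y := by linarith
    have hm2 := mul_le_mul_of_nonneg_left (hV.trans hm) hpos.le
    have e5 : (1 + y) * (kbe k L * (-(1/y) * 1 - -(198 * (klg y ^ 2 + 1)) * 1) - kD k L (1 + y) / (1 + y) * kgR k L (1 + y) ^ 2) = (1 + y) * (kbe k L * (-(1/y) * 1 - -(198 * (klg y ^ 2 + 1)) * 1)) - kD k L (1 + y) * kgR k L (1 + y) ^ 2 := by
      have : (1 + y) ≠ 0 := hpos.ne'
      field_simp
    rw [e5] at hm2
    refine ⟨_, glue_der_lt h h3.hasDerivWithinAt, ?_⟩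
    have : 42 * k ^ 2 * (1 + y) ^ 2 / ((kD k L (1 + y)) ^ 2 * (1 - (1 + y) ^ 2)) = (1 + y) * (42 * k ^ 2 * (1 + y) / ((kD k L (1 + y)) ^ 2 * (1 - (1 + y) ^ 2))) := by ring
    rw [this]; linarith

theorem klg_h : klg (1/10000) = 0 := by unfold klg; simp
theorem kPhi_h : kPhi (1/10000) = 0 := by unfold kPhi; rw [klg_h]; norm_num

theorem kgL_cont (k L : ℝ) : ContinuousOn (kgL k L) (Set.Iio 1) := by
  apply glue_cont continuousOn_const
  · rintro s ⟨hs, _⟩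
    have hs' : 0 < 1 - s := by have : s < 1 := hs; linarith
    apply ContinuousAt.continuousWithinAt
    have c1 : ContinuousAt (fun s : ℝ => 1 - s) s := by fun_prop
    have c2 := ContinuousAt.comp (f := fun s : ℝ => 1 - s) (x := s) (hasDerivAt_klg hs').continuousAt c1
    have c3 := ContinuousAt.comp (f := fun s : ℝ => 1 - s) (x := s) (hasDerivAt_kPhi hs').continuousAt c1
    exact continuousAt_const.mul (c2.add c3)
  · have : (1 - (1 - 1/10000) : ℝ) = 1/10000 := by norm_num
    rw [this, klg_h, kPhi_h]; simp

theorem kgR_cont (k L : ℝ) : ContinuousOn (kgR k L) (Set.Ioi 1) := by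
  apply glue_cont _ continuousOn_const
  · have : (1 + 1/10000 - 1 : ℝ) = 1/10000 := by norm_num
    rw [this, klg_h, kPhi_h]; simp
  · rintro s ⟨hs, _⟩
    have hs' : 0 < s - 1 := by have : 1 < s := hs; linarith
    apply ContinuousAt.continuousWithinAt
    have c1 : ContinuousAt (fun s : ℝ => s - 1) s := by fun_prop
    have c2 := ContinuousAt.comp (f := fun s : ℝ => s - 1) (x := s) (hasDerivAt_klg hs').continuousAt c1
    have c3 := ContinuousAt.comp (f := fun s : ℝ => s - 1) (x := s) (hasDerivAt_kPhi hs').continuousAt c1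
    exact continuousAt_const.mul (c2.sub c3)


theorem kbe_le {k L : ℝ} (hk : 1 ≤ k) : 0 ≤ kbe k L ∧ kbe k L ≤ 21 / kD k L 1 := by
  have hD1 := kD_ge_one hk L 1
  have hD := kD_ge hk L 1
  unfold kbe
  refine ⟨by positivity, ?_⟩
  rw [div_le_div_iff₀ (by positivity) (by positivity)]
  nlinarith [mul_le_mul_of_nonneg_left hD (show 0 ≤ 21 * kD k L 1 by linarith)]

theorem gl_gr {k L d : ℝ} (hk : 1 ≤ k) (hd : 0 < d) (hd2 : d ≤ 1/2) :
    kgL k L (1 - d) - kgR k L (1 + d) ≤ 3 / kD k L 1 ∧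
    kD k L 1 * kgL k L (1 - d) ^ 2 ≤ 2300 / (d * kD k L 1) ∧ 
    kD k L 1 * kgR k L (1 + d) ^ 2 ≤ 2300 / (d * kD k L 1) := by
  have hD1 := kD_ge_one hk L 1
  by_cases h : d ≤ 1/10000
  swap
  · push Not at h
    have e1 : kgL k L (1 - d) = 0 := by
      unfold kgL; rw [if_pos (by linarith)]
    have e2 : kgR k L (1 + d) = 0 := by
      unfold kgR; rw [if_neg (by linarith)]
    rw [e1, e2]
    refine ⟨?_, ?_, ?_⟩
    · rw [sub_zero]; positivity
    · rw [zero_pow two_ne_zero, mul_zero]; positivity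
    · rw [zero_pow two_ne_zero, mul_zero]; positivity
  · have e1 : kgL k L (1 - d) = kbe k L * (klg d + kPhi d) := by
      unfold kgL; rw [if_neg (by linarith)]; congr <;> ring
    have e2 : kgR k L (1 + d) = kbe k L * (klg d - kPhi d) := by
      unfold kgR
      split_ifs with h'
      · congr <;> ring
      · have : d = 1/10000 := by linarith
        rw [this, klg_h, kPhi_h]; simp
    obtain ⟨b0, b1⟩ := kbe_le (L := L) hk
    obtain ⟨p0, p1⟩ := kPhi_bd hd h
    have l0 := klg_nonneg hd h
    have l2 := klg_sq hd h
    have hΦ : kPhi d ^ 2 ≤ (594/10000) ^ 2 := by gcongr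
    have hone : 1 ≤ 1 / (2 * d) := by rw [le_div_iff₀ (by positivity)]; linarith
    have hone' : 1 / (2 * d) = (1 / d) / 2 := by field_simp
    have h2d : 2 / d = 2 * (1 / d) := by ring
    have hbb : kD k L 1 * kbe k L ^ 2 ≤ 441 / kD k L 1 := by
      have : kbe k L ^ 2 ≤ (21 / kD k L 1) ^ 2 := by gcongr
      calc _ ≤ kD k L 1 * (21 / kD k L 1) ^ 2 := by gcongr
        _ = _ := by field_simp; norm_num
    have fin : ∀ z : ℝ, z ^ 2 ≤ 5 / d → kD k L 1 * (kbe k L * z) ^ 2 ≤ 2300 / (d * kD k L 1) := by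
      intro z hz
      calc kD k L 1 * (kbe k L * z) ^ 2 = (kD k L 1 * kbe k L ^ 2) * z ^ 2 := by ring
        _ ≤ 441 / kD k L 1 * (5 / d) := by gcongr
        _ = 2205 / (d * kD k L 1) := by field_simp; norm_num
        _ ≤ _ := by gcongr; norm_num
    have h5 : 5 / d = 5 * (1 / d) := by ring
    refine ⟨?_, ?_, ?_⟩
    · rw [e1, e2]
      calc kbe k L * (klg d + kPhi d) - kbe k L * (klg d - kPhi d) = kbe k L * (2 * kPhi d) := by ring
        _ ≤ 21 / kD k L 1 * (2 * (594/10000)) := by gcongr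
        _ = (21 * (2 * (594/10000))) / kD k L 1 := by ring
        _ ≤ _ := by gcongr; norm_num
    · rw [e1]
      apply fin
      nlinarith [sq_nonneg (klg d - kPhi d)]
    · rw [e2]
      apply fin
      nlinarith [sq_nonneg (klg d + kPhi d)]

theorem wA_bd {k L d : ℝ} (hk : 1 ≤ k) (hd : 0 < d) (hd2 : d ≤ 1/2) :
    kwA k L (1 - d) ≤ 1000000 / kD k L 1 ∧ kD k L 1 * kwA k L (1 - d) ^ 2 ≤ 3000000000000 := by
  have hD1 := kD_ge_one hk L 1
  have hDd := kD_ge_one hk L (1 - d)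
  have hq : kD k L 1 / 4 ≤ kD k L (1 - d) := by
    unfold kD
    nlinarith [mul_nonneg (sq_nonneg L) (show 0 ≤ 4 * (1 - d) ^ 2 - 1 by nlinarith), sq_nonneg k]
  have h1 : (1/70000 : ℝ) ≤ 1 + 1/70000 - (1 - d) ^ 2 := by nlinarith
  have hu : 2 * (1 - d) ^ 2 / (kD k L (1 - d) * (1 + 1/70000 - (1 - d) ^ 2)) ≤ 2 * 1 / (kD k L 1 / 4 * (1/70000)) := by
    gcongr
    nlinarith
  have hu' : (2 * 1 / (kD k L 1 / 4 * (1/70000)) : ℝ) = 560000 / kD k L 1 := by field_simp; norm_num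
  have hu0 : 0 ≤ 2 * (1 - d) ^ 2 / (kD k L (1 - d) * (1 + 1/70000 - (1 - d) ^ 2)) := by
    apply div_nonneg (by positivity)
    apply mul_nonneg <;> linarith
  rw [hu'] at hu
  set u := 2 * (1 - d) ^ 2 / (kD k L (1 - d) * (1 + 1/70000 - (1 - d) ^ 2))
  have hq0 : 0 < √(kD k L (1 - d)) := Real.sqrt_pos.2 (by linarith)
  have hqq : √(kD k L (1 - d)) ^ 2 = kD k L (1 - d) := Real.sq_sqrt (by linarith)
  have hdef : kwA k L (1 - d) = -(√(kD k L (1 - d)))⁻¹ + u := rfl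
  have hv0 : 0 < (√(kD k L (1 - d)))⁻¹ := inv_pos.2 hq0
  have hv2 : (√(kD k L (1 - d)))⁻¹ ^ 2 ≤ 4 / kD k L 1 := by
    rw [inv_pow, hqq, inv_eq_one_div, div_le_div_iff₀ (by linarith) (by linarith)]
    linarith
  set v := (√(kD k L (1 - d)))⁻¹
  rw [hdef]
  constructor
  · have : 560000 / kD k L 1 ≤ 1000000 / kD k L 1 := by gcongr; norm_num
    linarith
  · have h2 : (-v + u) ^ 2 ≤ 4 / kD k L 1 + (560000 / kD k L 1) ^ 2 := by
      have : u ^ 2 ≤ (560000 / kD k L 1) ^ 2 := by gcongr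
      nlinarith [mul_nonneg hv0.le hu0]
    calc _ ≤ kD k L 1 * (4 / kD k L 1 + (560000 / kD k L 1) ^ 2) := by gcongr
      _ = 4 + 560000 ^ 2 / kD k L 1 := by field_simp
      _ ≤ 4 + 560000 ^ 2 / 1 := by gcongr
      _ ≤ _ := by norm_num

theorem alg_w {t : ℝ} (a b : ℝ) (ht0 : 0 ≤ t) (ht1 : t ≤ 1) :
    (a + (b - a) * t) ^ 2 ≤ a ^ 2 + b ^ 2 := by
  have : a + (b - a) * t = (1 - t) * a + t * b := by ring
  rw [this]
  nlinarith [mul_nonneg (mul_nonneg ht0 (sub_nonneg.2 ht1)) (sq_nonneg (a - b)), mul_nonneg ht0 (sq_nonneg a), mul_nonneg (sub_nonneg.2 ht1) (sq_nonneg b)]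

theorem alg_a (x y : ℝ) : (6/7 * x + 1/7 * y) ^ 2 ≤ x ^ 2 + y ^ 2 := by
  nlinarith [sq_nonneg (x - y), sq_nonneg x, sq_nonneg y]

theorem alg_b (x : ℝ) : (1/7 * x) ^ 2 ≤ x ^ 2 := by
  nlinarith [sq_nonneg x]

theorem mid_ineq {k L d s t : ℝ} (hk : 1 ≤ k) (hL : 0 ≤ L) (hd : 0 < d) (hd2 : d ≤ 1/2)
    (hdm : d * (k + L) ≤ 2) (hs : |s - 1| ≤ d) (ht0 : 0 ≤ t) (ht1 : t ≤ 1) (a b : ℝ)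
    (ha : a = 6/7 * kwA k L (1 - d) + 1/7 * kgL k L (1 - d)) (hb : b = 1/7 * kgR k L (1 + d)) :
    0 ≤ s * ((b - a) / (2 * d)) - kD k L s * (a + (b - a) * t) ^ 2 + 1
      + 1000000000000000 * s ^ 2 / (d * (k + L)) := by
  obtain ⟨hs1, hs2⟩ := abs_le.1 hs
  have hs94 : s ^ 2 ≤ 9/4 := by
    have h1 : s ≤ 3/2 := by linarith
    have h2 : 0 ≤ s := by linarith
    calc s ^ 2 ≤ (3/2) ^ 2 := by gcongr
      _ = _ := by norm_num
  have hs14 : 1/4 ≤ s ^ 2 := by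
    have h1 : 1/2 ≤ s := by linarith
    calc (1/4 : ℝ) = (1/2) ^ 2 := by norm_num
      _ ≤ _ := by gcongr
  have hDD : kD k L s ≤ 9/4 * kD k L 1 := by
    have h1 := mul_le_mul_of_nonneg_left hs94 (sq_nonneg L)
    have h2 := sq_nonneg k
    unfold kD
    linarith
  have hD1 := kD_ge_one hk L 1
  have hDs := kD_ge_one hk L s
  obtain ⟨g1, g2, g3⟩ := gl_gr (L := L) hk hd hd2
  obtain ⟨w1, w2⟩ := wA_bd (L := L) hk hd hd2
  have hm : 0 < k + L := by linarith
  have hX : 1 / kD k L 1 ≤ 2 / (k + L) := by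
    rw [div_le_div_iff₀ (by linarith) hm]
    unfold kD; nlinarith [sq_nonneg (k - L)]
  have hXd : 1 / (d * kD k L 1) ≤ 2 * (1 / (d * (k + L))) := by
    calc 1 / (d * kD k L 1) = 1 / d * (1 / kD k L 1) := by field_simp
      _ ≤ 1 / d * (2 / (k + L)) := by gcongr
      _ = _ := by field_simp
  have hX1 : 1 ≤ 2 * (1 / (d * (k + L))) := by
    rw [mul_one_div, le_div_iff₀ (by positivity)]; linarith
  have h23 : 2300 / (d * kD k L 1) = 2300 * (1 / (d * kD k L 1)) := by ring
  have hC : 1000000000000000 * s ^ 2 / (d * (k + L)) = 1000000000000000 * s ^ 2 * (1 / (d * (k + L))) := by ring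
  rw [hC]
  rw [h23] at g2 g3
  have hbq : -(1000003 * (1 / (d * (k + L)))) ≤ (b - a) / (2 * d) := by
    have e : a - b ≤ 1000003 / kD k L 1 := by
      have : (1000003 : ℝ) / kD k L 1 = 1000000 / kD k L 1 + 3 / kD k L 1 := by ring
      have p : 0 ≤ 1000000 / kD k L 1 := by positivity
      have p : 0 ≤ 3 / kD k L 1 := by positivity
      rw [this, ha, hb]
      linarith
    have e2 : (a - b) / (2 * d) ≤ 1000003 / kD k L 1 / (2 * d) := by gcongr
    have e3 : 1000003 / kD k L 1 / (2 * d) = 1000003 / 2 * (1 / (d * kD k L 1)) := by field_simp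
    have e4 : (b - a) / (2 * d) = - ((a - b) / (2 * d)) := by ring
    rw [e4]
    linarith
  set X := 1 / (d * (k + L)) with hXdef
  have hX0 : 0 < X := by positivity
  have hω := alg_w a b ht0 ht1
  have ha2 : a ^ 2 ≤ kwA k L (1 - d) ^ 2 + kgL k L (1 - d) ^ 2 := by
    rw [ha]; exact alg_a _ _
  have hb2 : b ^ 2 ≤ kgR k L (1 + d) ^ 2 := by
    rw [hb]; exact alg_b _
  have hq : kD k L s * (a + (b - a) * t) ^ 2 ≤ 20000000000000 * X := by
    calc kD k L s * (a + (b - a) * t) ^ 2 ≤ 9/4 * kD k L 1 * (kwA k L (1 - d) ^ 2 + kgL k L (1 - d) ^ 2 + kgR k L (1 + d) ^ 2) := by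
          gcongr; linarith
      _ = 9/4 * (kD k L 1 * kwA k L (1 - d) ^ 2 + kD k L 1 * kgL k L (1 - d) ^ 2 + kD k L 1 * kgR k L (1 + d) ^ 2) := by ring
      _ ≤ _ := by linarith only [w2, g2, g3, hXd, hX1, hX0]
  have hs4 : 1/4 * X ≤ s ^ 2 * X := by 
    exact mul_le_mul_of_nonneg_right hs14 hX0.le
  have hsw : -(1000003 * X) * (3/2) ≤ s * ((b - a) / (2 * d)) := by
    have h1 := mul_le_mul_of_nonneg_left hbq (show 0 ≤ s by linarith)
    have h2 := mul_le_mul_of_nonneg_left (show s ≤ 3/2 by linarith) (show 0 ≤ 1000003 * X by positivity)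
    linarith only [h1, h2]
  linarith only [hsw, hs4, hq, hX0]

theorem exists_omega {k L d : ℝ} (hk : 1 ≤ k) (hL : 0 ≤ L) (hd : 0 < d) (hd2 : d ≤ 1/2)
    (hdm : d * (k + L) ≤ 2) :
    ∃ ω : ℝ → ℝ, ContinuousOn ω (Set.Ici 0) ∧ ∀ s, 0 < s → ∃ w',
      HasDerivWithinAt ω w' (Set.Ioi s) s ∧
      (if d < |s - 1| then 6 * k ^ 2 * s ^ 2 / ((kD k L s) ^ 2 * (1 - s ^ 2)) else 0) ≤
        s * w' - kD k L s * ω s ^ 2 + 1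
          + (if |s - 1| ≤ d then 1000000000000000 * s ^ 2 / (d * (k + L)) else 0) := by
  obtain ⟨a, ha⟩ : ∃ a, a = 6/7 * kwA k L (1 - d) + 1/7 * kgL k L (1 - d) := ⟨_, rfl⟩
  obtain ⟨b, hb⟩ : ∃ b, b = 1/7 * kgR k L (1 + d) := ⟨_, rfl⟩
  refine ⟨fun s => if s < 1 - d then 6/7 * kwA k L s + 1/7 * kgL k L s else
    if s < 1 + d then a + (b - a) * ((s - (1 - d)) / (2 * d)) else 1/7 * kgR k L s, ?_, ?_⟩
  · apply glue_cont
    · rintro s ⟨hs0, hs⟩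
      have hs0 : 0 ≤ s := hs0
      have hs : s ≤ 1 - d := hs
      apply ContinuousAt.continuousWithinAt
      obtain ⟨w', h1, _⟩ := kwA_ineq (L := L) (s := s) hk (by nlinarith)
      have h2 := (kgL_cont k L).continuousAt (Iio_mem_nhds (show s < 1 by linarith))
      exact (continuousAt_const.mul h1.continuousAt).add (continuousAt_const.mul h2)
    · apply glue_cont
      · fun_prop
      · rintro s ⟨_, hs⟩
        have hs : 1 + d ≤ s := hs
        apply ContinuousAt.continuousWithinAt
        exact continuousAt_const.mul ((kgR_cont k L).continuousAt (Ioi_mem_nhds (show 1 < s by linarith)))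
      · rw [← hb]; field_simp; ring
    · rw [if_pos (by linarith), ← ha]; simp
  · intro s hs
    by_cases h1 : s < 1 - d
    · obtain ⟨w', hw, iw⟩ := kwA_ineq (L := L) (s := s) hk (by nlinarith)
      obtain ⟨g', hg, ig0, ig⟩ := kgL_ineq (L := L) (s := s) hk hs (by linarith)
      refine ⟨_, glue_der_lt h1 ((hw.hasDerivWithinAt.const_mul (6/7)).add (hg.const_mul (1/7))), ?_⟩
      have ab : |s - 1| = 1 - s := by rw [abs_sub_comm, abs_of_pos (by linarith)]
      rw [if_pos (by rw [ab]; linarith), if_neg (by rw [ab]; linarith)]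
      simp only [h1, if_true]
      have hD := kD_ge_one hk L s
      have conv : kD k L s * (6/7 * kwA k L s + 1/7 * kgL k L s) ^ 2 ≤ 6/7 * (kD k L s * kwA k L s ^ 2) + 1/7 * (kD k L s * kgL k L s ^ 2) := by
        nlinarith [mul_nonneg (show 0 ≤ kD k L s by linarith) (sq_nonneg (kwA k L s - kgL k L s))]
      have hss : 0 < 1 - s ^ 2 := by nlinarith
      have hφ : 0 < 1 + 1/70000 - s ^ 2 := by linarith
      by_cases hn : 1 - 1/10000 ≤ s
      · have ig := ig hn
        have e : 42 * k ^ 2 * s ^ 2 / ((kD k L s) ^ 2 * (1 - s ^ 2)) = 7 * (6 * k ^ 2 * s ^ 2 / ((kD k L s) ^ 2 * (1 - s ^ 2))) := by ring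
        have e1 : 0 ≤ 8 * k ^ 2 * s ^ 2 / ((kD k L s) ^ 2 * (1 + 1/70000 - s ^ 2)) := by positivity
        rw [e] at ig
        linarith
      · push Not at hn
        have e : 6 * k ^ 2 * s ^ 2 / ((kD k L s) ^ 2 * (1 - s ^ 2)) ≤ 6/7 * (8 * k ^ 2 * s ^ 2 / ((kD k L s) ^ 2 * (1 + 1/70000 - s ^ 2))) := by
          rw [mul_div_assoc', div_le_div_iff₀ (by positivity) (by positivity)]
          have : 7 * (1 + 1/70000 - s ^ 2) ≤ 8 * (1 - s ^ 2) := by nlinarith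
          have := mul_le_mul_of_nonneg_left this (show 0 ≤ 6/7 * k ^ 2 * s ^ 2 * kD k L s ^ 2 by positivity)
          linarith
        linarith
    · push Not at h1
      by_cases h2 : s < 1 + d
      · have hlin : HasDerivAt (fun s : ℝ => a + (b - a) * ((s - (1 - d)) / (2 * d))) ((b - a) / (2 * d)) s := by
          have := ((((hasDerivAt_id s).sub_const (1 - d)).div_const (2 * d)).const_mul (b - a)).const_add a
          refine this.congr_deriv ?_
          ring
        refine ⟨_, glue_der_ge h1 (glue_der_lt h2 hlin.hasDerivWithinAt), ?_⟩
        have ab : |s - 1| ≤ d := abs_le.2 ⟨by linarith, by linarith⟩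
        rw [if_neg (not_lt.2 ab), if_pos ab]
        simp only [h2, not_lt.2 h1, if_true, if_false]
        exact mid_ineq hk hL hd hd2 hdm ab (by apply div_nonneg <;> linarith) (by rw [div_le_one (by linarith)]; linarith) a b ha hb
      · push Not at h2
        obtain ⟨g', hg, ig⟩ := kgR_ineq (L := L) (s := s) hk (by linarith)
        refine ⟨_, glue_der_ge h1 (glue_der_ge h2 (hg.const_mul (1/7))), ?_⟩
        simp only [not_lt.2 h2, not_lt.2 h1, if_false]
        have hD := kD_ge_one hk L s
        have e : 42 * k ^ 2 * s ^ 2 / ((kD k L s) ^ 2 * (1 - s ^ 2)) = 7 * (6 * k ^ 2 * s ^ 2 / ((kD k L s) ^ 2 * (1 - s ^ 2))) := by ring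
        rw [e] at ig
        have conv : kD k L s * (1/7 * kgR k L s) ^ 2 ≤ 1/7 * (kD k L s * kgR k L s ^ 2) := by
          nlinarith [mul_nonneg (show 0 ≤ kD k L s by linarith) (sq_nonneg (kgR k L s))]
        have ab : |s - 1| = s - 1 := abs_of_pos (by linarith)
        rw [ab]
        rcases eq_or_lt_of_le h2 with h3 | h3
        · rw [if_neg (by linarith), if_pos (by linarith)]
          have hmm : 0 < k + L := by linarith
          have : -(6 * k ^ 2 * s ^ 2 / ((kD k L s) ^ 2 * (1 - s ^ 2))) ≤ 1000000000000000 * s ^ 2 / (d * (k + L)) := by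
            rw [← div_neg]
            have e : -((kD k L s) ^ 2 * (1 - s ^ 2)) = kD k L s ^ 2 * (d * (2 + d)) := by rw [← h3]; ring
            rw [e, div_le_div_iff₀ (by positivity) (by positivity)]
            have q1 := kD_ge hk L s
            have q2 : k + L ≤ 2 * kD k L s := by
              have : 1 ≤ s := by linarith
              have : L ^ 2 ≤ L ^ 2 * s ^ 2 := by nlinarith [mul_nonneg (sq_nonneg L) (show 0 ≤ s ^ 2 - 1 by nlinarith)]
              unfold kD; nlinarith [sq_nonneg (L - 1), sq_nonneg (k - 1)]
            have q3 : k ^ 2 * (k + L) ≤ kD k L s * (2 * kD k L s) := by gcongr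
            have q4 := mul_le_mul_of_nonneg_left q3 (show 0 ≤ 6 * s ^ 2 * d by positivity)
            have q5 : 0 ≤ s ^ 2 * d * kD k L s ^ 2 := by positivity
            have q6 : 0 ≤ s ^ 2 * d * kD k L s ^ 2 * d := by positivity
            nlinarith
          linarith
        · rw [if_pos (by linarith), if_neg (by linarith)]
          linarith

theorem W_bound {W : ℝ → ℂ} (hW : ContDiffOn ℝ (⊤ : ℕ∞) W (Set.Icc 0 1)) (h0 : W 0 = 0) :
    ∃ B : ℝ, 0 ≤ B ∧ ∀ r ∈ Set.Icc (0:ℝ) 1, ‖W r‖ ≤ B * r := by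
  have hc : ContinuousOn (derivWithin W (Set.Icc 0 1)) (Set.Icc 0 1) :=
    (hW.derivWithin (m := 0) (uniqueDiffOn_Icc zero_lt_one) (by simp)).continuousOn
  obtain ⟨B, hB⟩ := isCompact_Icc.exists_bound_of_continuousOn hc
  refine ⟨B, (norm_nonneg _).trans (hB 0 (by simp)), fun r hr => ?_⟩
  have := (convex_Icc (0:ℝ) 1).norm_image_sub_le_of_norm_derivWithin_le (𝕜 := ℝ)
    (hW.differentiableOn (by simp)) hB (show (0:ℝ) ∈ Set.Icc (0:ℝ) 1 by simp) hr
  simpa [h0, abs_of_nonneg hr.1] using this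

theorem W_deriv {W : ℝ → ℂ} (hW : ContDiffOn ℝ (⊤ : ℕ∞) W (Set.Icc 0 1)) {r : ℝ}
    (hr : r ∈ Set.Ioo (0:ℝ) 1) :
    HasDerivAt W (deriv W r) r ∧ HasDerivAt (deriv W) (deriv (deriv W) r) r ∧
    derivWithin W (Set.Icc 0 1) =ᶠ[nhds r] deriv W := by
  have hO : ContDiffOn ℝ (⊤ : ℕ∞) W (Set.Ioo 0 1) := hW.mono Set.Ioo_subset_Icc_self
  have hn := isOpen_Ioo.mem_nhds hr
  refine ⟨((hO.differentiableOn (by simp)).differentiableAt hn).hasDerivAt, ?_, ?_⟩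
  · have := hO.deriv_of_isOpen (m := 1) isOpen_Ioo (by norm_cast)
    exact ((this.differentiableOn (by simp)).differentiableAt hn).hasDerivAt
  · filter_upwards [hn] with x hx
    exact derivWithin_of_mem_nhds (Icc_mem_nhds hx.1 hx.2)

theorem int_E1 {W : ℝ → ℂ} (hW : ContDiffOn ℝ (⊤ : ℕ∞) W (Set.Icc 0 1)) {n l : ℝ} (hn : n ≠ 0) :
    IntegrableOn (fun r : ℝ => r * ‖deriv W r‖ ^ 2 / (n ^ 2 + r ^ 2 * l ^ 2)) (Set.Ioo 0 1) := by
  have hc : ContinuousOn (derivWithin W (Set.Icc 0 1)) (Set.Icc 0 1) :=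
    (hW.derivWithin (m := 0) (uniqueDiffOn_Icc zero_lt_one) (by simp)).continuousOn
  have h1 : ContinuousOn (fun r : ℝ => r * ‖derivWithin W (Set.Icc 0 1) r‖ ^ 2 / (n ^ 2 + r ^ 2 * l ^ 2)) (Set.Icc 0 1) := by
    apply ContinuousOn.div
    · exact continuousOn_id.mul (hc.norm.pow 2)
    · fun_prop
    · intro r _; positivity
  have h2 := (h1.integrableOn_Icc (μ := volume)).mono_set Set.Ioo_subset_Icc_self
  refine h2.congr_fun (fun r hr => ?_) measurableSet_Ioo
  simp only
  rw [(W_deriv hW hr).2.2.eq_of_nhds]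

theorem int_E2 {W : ℝ → ℂ} (hW : ContDiffOn ℝ (⊤ : ℕ∞) W (Set.Icc 0 1)) (h0 : W 0 = 0) :
    IntegrableOn (fun r : ℝ => ‖W r‖ ^ 2 / r) (Set.Ioo 0 1) := by
  obtain ⟨B, hB0, hB⟩ := W_bound hW h0
  have hm : AEStronglyMeasurable (fun r : ℝ => ‖W r‖ ^ 2 / r) (volume.restrict (Set.Ioo 0 1)) := by
    apply ContinuousOn.aestronglyMeasurable _ measurableSet_Ioo
    apply ContinuousOn.div
    · exact (hW.continuousOn.mono Set.Ioo_subset_Icc_self).norm.pow 2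
    · fun_prop
    · intro r hr; exact hr.1.ne'
  refine Integrable.of_bound hm (B ^ 2) ?_
  filter_upwards [self_mem_ae_restrict measurableSet_Ioo] with r hr
  have h1 := hB r (Set.Ioo_subset_Icc_self hr)
  have hr0 := hr.1
  rw [Real.norm_of_nonneg (by positivity), div_le_iff₀ hr0]
  calc ‖W r‖ ^ 2 ≤ (B * r) ^ 2 := by gcongr
    _ = B ^ 2 * r * r := by ring
    _ ≤ B ^ 2 * r * 1 := by gcongr; exact hr.2.le
    _ = _ := by ring

theorem int_V {W : ℝ → ℂ} (hW : ContDiffOn ℝ (⊤ : ℕ∞) W (Set.Icc 0 1)) {n l : ℝ} (hn : n ≠ 0)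
    {r₀ δ : ℝ} (hr₀ : 0 < r₀) (hδ : 0 < δ) :
    IntegrableOn (fun r : ℝ => (if δ < |r - r₀| then 1 / (r₀ ^ 2 - r ^ 2) else 0) *
      (4 * n ^ 2 * ‖W r‖ ^ 2 * r / (n ^ 2 + r ^ 2 * l ^ 2) ^ 2)) (Set.Ioo 0 1) := by
  have h1 : ContinuousOn (fun r : ℝ => 4 * n ^ 2 * ‖W r‖ ^ 2 * r / (n ^ 2 + r ^ 2 * l ^ 2) ^ 2) (Set.Icc 0 1) := by
    apply ContinuousOn.div
    · exact (continuousOn_const.mul (hW.continuousOn.norm.pow 2)).mul continuousOn_id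
    · fun_prop
    · intro r _; positivity
  have h2 := (h1.integrableOn_Icc (μ := volume)).mono_set Set.Ioo_subset_Icc_self
  refine Integrable.bdd_mul (c := 1 / (δ * r₀)) h2 ?_ ?_
  · apply Measurable.aestronglyMeasurable
    refine Measurable.ite ?_ (by fun_prop) measurable_const
    exact measurableSet_lt measurable_const (by fun_prop)
  · filter_upwards [self_mem_ae_restrict measurableSet_Ioo] with r hr
    have hr0 := hr.1
    split_ifs with h
    · rw [norm_div, norm_one, Real.norm_eq_abs]
      have e : |r₀ ^ 2 - r ^ 2| = |r - r₀| * (r + r₀) := by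
        rw [← abs_of_pos (show 0 < r + r₀ by linarith), ← abs_mul, ← abs_neg]; congr 1
        ring
      rw [e]
      gcongr
      linarith
    · simp; positivity

theorem first_term {n l : ℤ} (hn : n ≠ 0) {W W₁ : ℝ → ℂ}
    (hW : ContDiffOn ℝ (⊤ : ℕ∞) W (Set.Icc 0 1)) (h0 : W 0 = 0) (h1 : W 1 = 0)
    (hW₁ : ∀ r ∈ Set.Ioo (0:ℝ) 1, W₁ r = hatD1 n l W r) :
    wip (fun r : ℝ => W r / ((n : ℂ) ^ 2 + (r : ℂ) ^ 2 * (l : ℂ) ^ 2)) W₁ =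
      ((-(∫ r in Set.Ioo (0:ℝ) 1, (r * ‖deriv W r‖ ^ 2 / ((n : ℝ) ^ 2 + r ^ 2 * (l : ℝ) ^ 2)
                          + ‖W r‖ ^ 2 / r)) : ℝ) : ℂ) := by
  have hn' : (n : ℝ) ≠ 0 := by exact_mod_cast hn
  have hDne : ∀ r : ℝ, (n : ℝ) ^ 2 + r ^ 2 * (l : ℝ) ^ 2 ≠ 0 := fun r => by positivity
  let p : ℝ → ℝ := fun r => r / ((n : ℝ) ^ 2 + r ^ 2 * (l : ℝ) ^ 2)
  let V := derivWithin W (Set.Icc 0 1)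
  have hV : ContDiffOn ℝ 1 V (Set.Icc 0 1) :=
    hW.derivWithin (uniqueDiffOn_Icc zero_lt_one) (by norm_cast)
  have hp : ContDiff ℝ 1 p := by
    apply ContDiff.div (by fun_prop) (by fun_prop) hDne
  let q : ℝ → ℂ := fun r => W r * (starRingEnd ℂ) (p r • V r)
  have hq : ContDiffOn ℝ 1 q (Set.Icc 0 1) := by
    apply ContDiffOn.mul (hW.of_le (by norm_cast))
    exact Complex.conjCLE.contDiff.comp_contDiffOn (hp.contDiffOn.smul hV)
  have hint := intervalIntegral.integral_derivWithin_Icc_of_contDiffOn_Icc hq zero_le_one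
  have hq0 : q 1 - q 0 = 0 := by simp [q, h0, h1]
  rw [hq0, intervalIntegral.integral_of_le zero_le_one, integral_Ioc_eq_integral_Ioo] at hint
  have hqi : IntegrableOn (derivWithin q (Set.Icc 0 1)) (Set.Ioo 0 1) :=
    ((hq.derivWithin (m := 0) (uniqueDiffOn_Icc zero_lt_one) (by simp)).continuousOn.integrableOn_Icc
      (μ := volume)).mono_set Set.Ioo_subset_Icc_self
  have hE : Integrable (fun r : ℝ => ((r * ‖deriv W r‖ ^ 2 / ((n : ℝ) ^ 2 + r ^ 2 * (l : ℝ) ^ 2)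
      + ‖W r‖ ^ 2 / r : ℝ) : ℂ)) (volume.restrict (Set.Ioo 0 1)) :=
    ((int_E1 hW (l := (l : ℝ)) hn').add (int_E2 hW h0)).ofReal (𝕜 := ℂ)
  have key : wip (fun r : ℝ => W r / ((n : ℂ) ^ 2 + (r : ℂ) ^ 2 * (l : ℂ) ^ 2)) W₁ =
      ∫ r in Set.Ioo (0:ℝ) 1, (derivWithin q (Set.Icc 0 1) r -
        ((r * ‖deriv W r‖ ^ 2 / ((n : ℝ) ^ 2 + r ^ 2 * (l : ℝ) ^ 2) + ‖W r‖ ^ 2 / r : ℝ) : ℂ)) := by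
    unfold wip
    apply setIntegral_congr_fun measurableSet_Ioo
    intro r hr
    obtain ⟨d1, d2, ev⟩ := W_deriv hW hr
    have hr0 : r ≠ 0 := hr.1.ne'
    have dV : HasDerivAt V (deriv (deriv W) r) r := d2.congr_of_eventuallyEq ev
    have dp : HasDerivAt p (((n : ℝ) ^ 2 - r ^ 2 * (l : ℝ) ^ 2) / ((n : ℝ) ^ 2 + r ^ 2 * (l : ℝ) ^ 2) ^ 2) r := by
      have e := (hasDerivAt_id r).div ((((hasDerivAt_id r).pow 2).mul_const ((l : ℝ) ^ 2)).const_add ((n : ℝ) ^ 2)) (hDne r)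
      refine HasDerivAt.congr_deriv (f := p) e ?_
      simp
      ring
    have dP := (dp.smul dV)
    have dP2 := (Complex.conjCLE.toContinuousLinearMap.hasFDerivAt.comp_hasDerivAt r dP)
    have dq := d1.mul dP2
    have dq' : derivWithin q (Set.Icc 0 1) r = deriv W r * (starRingEnd ℂ) (p r • V r) +
        W r * (starRingEnd ℂ) (p r • deriv (deriv W) r +
        (((n:ℝ)^2 - r^2*(l:ℝ)^2)/((n:ℝ)^2+r^2*(l:ℝ)^2)^2) • V r) := by
      rw [derivWithin_of_mem_nhds (Icc_mem_nhds hr.1 hr.2)]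
      exact HasDerivAt.deriv (f := q) dq
    have hVr : V r = deriv W r := ev.eq_of_nhds
    simp only
    rw [dq', hW₁ r hr]
    have hDc : (n : ℂ) ^ 2 + (r : ℂ) ^ 2 * (l : ℂ) ^ 2 ≠ 0 := by
      have := hDne r
      intro h
      apply this
      exact_mod_cast h
    have hrc : (r : ℂ) ≠ 0 := by exact_mod_cast hr0
    have nW : ((‖W r‖ ^ 2 : ℝ) : ℂ) = W r * (starRingEnd ℂ) (W r) := by
      rw [Complex.mul_conj, Complex.normSq_eq_norm_sq]
    have nV : ((‖deriv W r‖ ^ 2 : ℝ) : ℂ) = deriv W r * (starRingEnd ℂ) (deriv W r) := by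
      rw [Complex.mul_conj, Complex.normSq_eq_norm_sq]
    rw [Complex.ofReal_add, Complex.ofReal_div, Complex.ofReal_mul, Complex.ofReal_div, nW, nV]
    simp only [hatD1, hatD, hVr, p]
    have c2 : (starRingEnd ℂ) 2 = 2 := Complex.conj_ofNat 2
    simp [c2]
    field_simp
    ring
  rw [key, integral_sub hqi hE, hint, integral_complex_ofReal]
  simp


theorem ptwise_alg {w v s D r x y ip A : ℝ} (hr : 0 < r) (hD : 0 < D) (hip : |ip| ≤ x * y)
    (hx : 0 ≤ x) (hA : A ≤ s - D * w ^ 2 + 1 + v) :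
    -(2/3) * (s / r * x ^ 2 + w * (2 * ip)) ≤
      2/3 * (r * y ^ 2 / D + x ^ 2 / r) + 2/3 * v * x ^ 2 / r - 2/3 * A * x ^ 2 / r := by
  have h1 : -(w * (2 * ip)) ≤ r * y ^ 2 / D + D * w ^ 2 * x ^ 2 / r := by
    have h2 : -(w * (2 * ip)) ≤ 2 * (|w| * (x * y)) := by
      have : -(w * ip) ≤ |w| * |ip| := by rw [← abs_mul]; exact neg_le_abs _
      have h3 : |w| * |ip| ≤ |w| * (x * y) := by gcongr
      linarith
    refine h2.trans ?_
    have e : r * y ^ 2 / D + D * w ^ 2 * x ^ 2 / r - 2 * (|w| * (x * y)) =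
        (r * y - D * |w| * x) ^ 2 / (r * D) := by
      rw [← sq_abs w]
      field_simp
      ring
    have : 0 ≤ (r * y - D * |w| * x) ^ 2 / (r * D) := by positivity
    linarith
  have h4 : A * x ^ 2 / r ≤ (s - D * w ^ 2 + 1 + v) * x ^ 2 / r := by gcongr
  have e : (s - D * w ^ 2 + 1 + v) * x ^ 2 / r = s / r * x ^ 2 - D * w ^ 2 * x ^ 2 / r + x ^ 2 / r + v * x ^ 2 / r := by
    ring
  rw [e] at h4
  have e2 : 2/3 * v * x ^ 2 / r = 2/3 * (v * x ^ 2 / r) := by ring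
  have e3 : 2/3 * A * x ^ 2 / r = 2/3 * (A * x ^ 2 / r) := by ring
  rw [e2, e3]
  linarith

theorem second_est {n l : ℤ} (hn : n ≠ 0) {r₀ δ : ℝ} (hr₀ : 0 < r₀) (hδ : 0 < δ)
    (hmax : max |(n : ℝ)| 2 ≤ r₀ / δ) (hl : |(l : ℝ)| * δ ≤ 1) {W : ℝ → ℂ}
    (hW : ContDiffOn ℝ (⊤ : ℕ∞) W (Set.Icc 0 1)) (h0 : W 0 = 0) (h1 : W 1 = 0) :
    ∫ r in Set.Ioo (0:ℝ) 1, (if δ < |r - r₀| then 1 / (r₀ ^ 2 - r ^ 2) else 0) *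
      (4 * (n:ℝ) ^ 2 * ‖W r‖ ^ 2 * r / ((n:ℝ) ^ 2 + r ^ 2 * (l:ℝ) ^ 2) ^ 2) ≤
    2/3 * (∫ r in Set.Ioo (0:ℝ) 1, (r * ‖deriv W r‖ ^ 2 / ((n : ℝ) ^ 2 + r ^ 2 * (l : ℝ) ^ 2)
                          + ‖W r‖ ^ 2 / r)) +
      (2/3 * 1000000000000000) * (∫ r in Set.Icc (r₀ - δ) (r₀ + δ) ∩ Set.Ioc (0:ℝ) 1, ‖W r‖ ^ 2 * r)
                        / (r₀ * δ * (|(n : ℝ)| + r₀ * |(l : ℝ)|)) := by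
  have hn' : (n : ℝ) ≠ 0 := by exact_mod_cast hn
  have hk : 1 ≤ |(n : ℝ)| := by
    have := Int.one_le_abs hn
    exact_mod_cast this
  have hL : 0 ≤ r₀ * |(l : ℝ)| := by positivity
  have hd : 0 < δ / r₀ := by positivity
  have hmn : |(n : ℝ)| * δ ≤ r₀ := (le_div_iff₀ hδ).1 ((le_max_left _ _).trans hmax)
  have hm2 : 2 * δ ≤ r₀ := (le_div_iff₀ hδ).1 ((le_max_right _ _).trans hmax)
  have hd2 : δ / r₀ ≤ 1 / 2 := by rw [div_le_div_iff₀ hr₀ two_pos]; linarith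
  have hdm : δ / r₀ * (|(n : ℝ)| + r₀ * |(l : ℝ)|) ≤ 2 := by
    have e : δ / r₀ * (|(n : ℝ)| + r₀ * |(l : ℝ)|) = |(n : ℝ)| * δ / r₀ + |(l : ℝ)| * δ := by
      field_simp
    have : |(n : ℝ)| * δ / r₀ ≤ 1 := (div_le_one hr₀).2 hmn
    rw [e]; linarith
  obtain ⟨ω, hωc, hω⟩ := exists_omega hk hL hd hd2 hdm
  choose! w' hw' using hω
  set m := |(n : ℝ)| + r₀ * |(l : ℝ)| with hm
  have hmpos : 0 < m := by positivity
  set P : ℝ → ℝ := fun r => (if δ < |r - r₀| then 1 / (r₀ ^ 2 - r ^ 2) else 0) *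
      (4 * (n:ℝ) ^ 2 * ‖W r‖ ^ 2 * r / ((n:ℝ) ^ 2 + r ^ 2 * (l:ℝ) ^ 2) ^ 2) with hP
  set Eg : ℝ → ℝ := fun r => r * ‖deriv W r‖ ^ 2 / ((n : ℝ) ^ 2 + r ^ 2 * (l : ℝ) ^ 2)
                          + ‖W r‖ ^ 2 / r with hEg
  set J : ℝ → ℝ := (Set.Icc (r₀ - δ) (r₀ + δ)).indicator (fun r => ‖W r‖ ^ 2 * r) with hJ
  set K : ℝ := (2/3 * 1000000000000000) / (r₀ * δ * m) with hK
  have iP : IntegrableOn P (Set.Ioo 0 1) := int_V hW hn' hr₀ hδ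
  have iE : IntegrableOn Eg (Set.Ioo 0 1) := (int_E1 hW hn').add (int_E2 hW h0)
  have cJ : ContinuousOn (fun r => ‖W r‖ ^ 2 * r) (Set.Icc 0 1) :=
    (hW.continuousOn.norm.pow 2).mul continuousOn_id
  have iJ : IntegrableOn J (Set.Ioo 0 1) :=
    ((cJ.integrableOn_Icc (μ := volume)).mono_set Set.Ioo_subset_Icc_self).indicator measurableSet_Icc
  have iEJ : Integrable (fun r => 2/3 * Eg r + K * J r) (volume.restrict (Set.Ioo 0 1)) :=
    (iE.const_mul _).add (iJ.const_mul _)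
  have main := intervalIntegral.sub_le_integral_of_hasDeriv_right_of_le (a := 0) (b := 1)
    (g := fun r => -(2/3) * (ω (r / r₀) * ‖W r‖ ^ 2))
    (g' := fun r => -(2/3) * (w' (r / r₀) / r₀ * ‖W r‖ ^ 2 + ω (r / r₀) * (2 * inner ℝ (W r) (deriv W r))))
    (φ := fun r => 2/3 * Eg r + K * J r - P r) zero_le_one ?_ ?_ ?_ ?_
  · rw [intervalIntegral.integral_of_le zero_le_one, integral_Ioc_eq_integral_Ioo,
      integral_sub iEJ iP,
      integral_add (iE.const_mul _) (iJ.const_mul _), integral_const_mul, integral_const_mul] at main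
    have hJi : ∫ r in Set.Ioo (0:ℝ) 1, J r = ∫ r in Set.Icc (r₀ - δ) (r₀ + δ) ∩ Set.Ioc (0:ℝ) 1, ‖W r‖ ^ 2 * r := by
      rw [← integral_Ioc_eq_integral_Ioo, hJ, setIntegral_indicator measurableSet_Icc, Set.inter_comm]
    rw [hJi, h0, h1] at main
    simp only [norm_zero] at main
    have e : ∀ X : ℝ, (2/3 * 1000000000000000) * X / (r₀ * δ * m) = K * X := fun X => by
      rw [hK]; ring
    rw [e]
    linarith
  · refine continuousOn_const.mul (ContinuousOn.mul ?_ (hW.continuousOn.norm.pow 2))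
    refine hωc.comp (by fun_prop) ?_
    intro r hr
    exact div_nonneg hr.1 hr₀.le
  · intro r hr
    have hs : 0 < r / r₀ := div_pos hr.1 hr₀
    have dω := (hw' _ hs).1
    have dd : HasDerivWithinAt (fun r => r / r₀) (1 / r₀) (Set.Ioi r) r :=
      ((hasDerivAt_id r).div_const r₀).hasDerivWithinAt
    have dc := dω.comp r dd (fun x hx => by
      simp only [Set.mem_Ioi] at hx ⊢
      gcongr)
    have dn := (W_deriv hW hr).1.norm_sq.hasDerivWithinAt (s := Set.Ioi r)
    refine ((dc.mul dn).const_mul (-(2/3))).congr_deriv ?_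
    simp only [Function.comp]
    ring
  · rw [integrableOn_Icc_iff_integrableOn_Ioo]
    exact ((iE.const_mul _).add (iJ.const_mul _)).sub iP
  · intro r hr
    have hr0 : 0 < r := hr.1
    have hs : 0 < r / r₀ := div_pos hr.1 hr₀
    have hin := (hw' _ hs).2
    have habs : |r / r₀ - 1| = |r - r₀| / r₀ := by
      rw [← abs_of_pos hr₀, ← abs_div, abs_of_pos hr₀]; congr 1; field_simp
    have c1 : (δ / r₀ < |r / r₀ - 1|) ↔ δ < |r - r₀| := by
      rw [habs, div_lt_div_iff_of_pos_right hr₀]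
    have c2 : (|r / r₀ - 1| ≤ δ / r₀) ↔ ¬ δ < |r - r₀| := by
      rw [← c1, not_lt]
    have hkD : kD |(n : ℝ)| (r₀ * |(l : ℝ)|) (r / r₀) = (n:ℝ) ^ 2 + r ^ 2 * (l:ℝ) ^ 2 := by
      unfold kD
      rw [mul_pow, sq_abs, sq_abs]
      field_simp
    have hDpos : 0 < (n:ℝ) ^ 2 + r ^ 2 * (l:ℝ) ^ 2 := by positivity
    rw [hkD] at hin
    simp only [c1, c2] at hin
    have hip : |inner ℝ (W r) (deriv W r)| ≤ ‖W r‖ * ‖deriv W r‖ := abs_real_inner_le_norm _ _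
    have key := ptwise_alg hr0 hDpos hip (norm_nonneg _) hin
    have e1 : r / r₀ * w' (r / r₀) / r = w' (r / r₀) / r₀ := by field_simp
    rw [e1] at key
    refine key.trans (le_of_eq ?_)
    have memI : r ∈ Set.Icc (r₀ - δ) (r₀ + δ) ↔ ¬ δ < |r - r₀| := by
      rw [not_lt, abs_le, Set.mem_Icc]
      constructor <;> rintro ⟨a, b⟩ <;> constructor <;> linarith
    simp only [hEg, hJ, hP, Set.indicator_apply, memI]
    by_cases h : δ < |r - r₀|
    · have hne : r₀ ^ 2 - r ^ 2 ≠ 0 := by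
        intro h'
        have h2 : (r₀ - r) * (r₀ + r) = 0 := by linarith
        rcases mul_eq_zero.1 h2 with h3 | h3
        · have : r - r₀ = 0 := by linarith
          rw [this, abs_zero] at h; linarith
        · linarith
      have e2 : 1 - (r / r₀) ^ 2 = (r₀ ^ 2 - r ^ 2) / r₀ ^ 2 := by field_simp
      simp only [h, not_true_eq_false, if_true, if_false]
      rw [e2, sq_abs]
      field_simp
      ring
    · simp only [h, not_false_eq_true, if_true, if_false]
      rw [hK]
      field_simp
      ring

theorem second_term {n l : ℤ} (χ₀ : ℝ → ℝ) (W : ℝ → ℂ) :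
    wip (fun r : ℝ => (χ₀ r : ℂ) * W r / ((n : ℂ) ^ 2 + (r : ℂ) ^ 2 * (l : ℂ) ^ 2))
        (fun r : ℝ => 4 * (n : ℂ) ^ 2 * W r / ((n : ℂ) ^ 2 + (r : ℂ) ^ 2 * (l : ℂ) ^ 2)) =
      ((∫ r in Set.Ioo (0:ℝ) 1, χ₀ r *
      (4 * (n:ℝ) ^ 2 * ‖W r‖ ^ 2 * r / ((n:ℝ) ^ 2 + r ^ 2 * (l:ℝ) ^ 2) ^ 2) : ℝ) : ℂ) := by
  rw [← integral_complex_ofReal]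
  unfold wip
  apply setIntegral_congr_fun measurableSet_Ioo
  intro r hr
  have nW : ((‖W r‖ : ℝ) : ℂ) ^ 2 = W r * (starRingEnd ℂ) (W r) := by
    rw [Complex.mul_conj, Complex.normSq_eq_norm_sq]; push_cast; rfl
  have c4 : (starRingEnd ℂ) 4 = 4 := Complex.conj_ofNat 4
  simp only
  push_cast
  rw [nW]
  simp only [map_div₀, map_mul, map_add, map_pow, c4, Complex.conj_ofReal, map_intCast]
  generalize (n : ℂ) ^ 2 + (r : ℂ) ^ 2 * (l : ℂ) ^ 2 = D
  ring


/-- Key coercive estimate (Lemma 4.8). -/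
theorem key_coercive_estimate :
    ∃ C : ℝ, 0 < C ∧
      ∀ (n l : ℤ), n ≠ 0 → l ≠ 0 →
        ∀ lam δ : ℝ, lam ∈ Set.Ioc (0:ℝ) 1 → δ ∈ Set.Ioc (0:ℝ) 1 →
          ∀ r₀ : ℝ, r₀ = lam ^ ((1:ℝ)/2) →
            max |(n : ℝ)| 2 ≤ r₀ / δ → |(l : ℝ)| * δ ≤ 1 →
            ∀ χ₀ : ℝ → ℝ,
              (∀ r : ℝ, χ₀ r = if δ < |r - r₀| then 1 / (lam - r ^ 2) else 0) →
              ∀ W W₁ : ℝ → ℂ,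
                ContDiffOn ℝ (⊤ : ℕ∞) W (Set.Icc 0 1) →
                W 0 = 0 → W 1 = 0 →
                (∀ r ∈ Set.Ioo (0:ℝ) 1, W₁ r = hatD1 n l W r) →
                -(wip (fun r : ℝ =>
                      W r / ((n : ℂ) ^ 2 + (r : ℂ) ^ 2 * (l : ℂ) ^ 2)) W₁).re
                  - (wip
                      (fun r : ℝ =>
                        (χ₀ r : ℂ) * W r / ((n : ℂ) ^ 2 + (r : ℂ) ^ 2 * (l : ℂ) ^ 2))
                      (fun r : ℝ =>
                        4 * (n : ℂ) ^ 2 * W r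
                          / ((n : ℂ) ^ 2 + (r : ℂ) ^ 2 * (l : ℂ) ^ 2))).re
                  ≥ (∫ r in Set.Ioo (0:ℝ) 1,
                        (r * ‖deriv W r‖ ^ 2 / ((n : ℝ) ^ 2 + r ^ 2 * (l : ℝ) ^ 2)
                          + ‖W r‖ ^ 2 / r)) / 3
                    - C * (∫ r in Set.Icc (r₀ - δ) (r₀ + δ) ∩ Set.Ioc (0:ℝ) 1,
                          ‖W r‖ ^ 2 * r)
                        / (r₀ * δ * (|(n : ℝ)| + r₀ * |(l : ℝ)|)) := by
  refine ⟨2/3 * 1000000000000000, by norm_num, ?_⟩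
  intro n l hn hl lam δ hlam hδ r₀ hr₀ hmax hlδ χ₀ hχ W W₁ hW h0 h1 hW₁
  have hr₀p : 0 < r₀ := by rw [hr₀]; exact Real.rpow_pos_of_pos hlam.1 _
  have hsq : lam = r₀ ^ 2 := by
    rw [hr₀, ← Real.sqrt_eq_rpow, Real.sq_sqrt hlam.1.le]
  have est := second_est hn hr₀p hδ.1 hmax hlδ hW h0 h1
  rw [first_term hn hW h0 h1 hW₁, second_term, Complex.ofReal_re, Complex.ofReal_re]
  simp only [hχ, hsq]
  linarith
end

section
/- There is a universal constant C > 0 such that for all real n, l, ν with |n| ≥ 1 and 0 < ν < min(|l|,1), and all λ ∈ ℂ, setting A = |l(λ−1)/ν|^{1/2} + |l/ν|^{1/3} + |l| + |n|, one has: (|νnl|^{3/8} + |νλl²|^{1/4})·A ≥ C^{−1}·|l/ν|^{1/12}·|l|^{3/4}, and ν·|l|^{7/4}·|n|·A^{1/2} ≤ C·ν^{3/8}·(|νnl|^{3/8} + |νλl²|^{1/4})·(|n|+|l|)^{11/4}. -/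
theorem pw_aux {x : ℝ} (hx : 0 ≤ x) (k j : ℕ) (r : ℝ) (h : (k:ℝ) * r = j) :
    (x ^ k) ^ r = x ^ j := by
  rw [← Real.rpow_natCast, ← Real.rpow_mul hx, h, Real.rpow_natCast]

theorem root_aux (k : ℕ) (hk : k ≠ 0) {x : ℝ} (hx : 0 ≤ x) : ∃ a : ℝ, 0 ≤ a ∧ x = a ^ k :=
  ⟨x ^ ((k:ℝ)⁻¹), Real.rpow_nonneg hx _, (Real.rpow_inv_natCast_pow hx hk).symm⟩

theorem poly_one {a b c d q : ℝ} (ha : 0 < a) (hb : 0 < b) (hba : b ≤ a) (hc : 1 ≤ c)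
    (hd : 0 ≤ d) (hq : 0 ≤ q) (h : 1 ≤ d ^ 4 + q ^ 4) :
    4⁻¹ * (a ^ 2 / b ^ 2) * a ^ 18 ≤
      (b ^ 9 * c ^ 9 * a ^ 9 + b ^ 6 * d * a ^ 12) *
        (a ^ 12 * q ^ 2 / b ^ 12 + a ^ 8 / b ^ 8 + a ^ 24 + c ^ 24) := by
  have hc0 : 0 < c := by linarith
  by_cases hd2 : 1 / 2 ≤ d
  · calc 4⁻¹ * (a ^ 2 / b ^ 2) * a ^ 18 ≤ 2⁻¹ * (a ^ 2 / b ^ 2) * a ^ 18 := by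
          gcongr; norm_num
      _ = (0 + b ^ 6 * (1/2) * a ^ 12) * (0 + a ^ 8 / b ^ 8 + 0 + 0) := by
          field_simp; ring
      _ ≤ _ := by gcongr <;> positivity
  · push Not at hd2
    have h1 : d ^ 4 ≤ (1/2) ^ 4 := by gcongr
    have h2 : 1 / 2 ≤ q ^ 2 := by
      by_contra hh
      push Not at hh
      nlinarith [sq_nonneg q]
    calc 4⁻¹ * (a ^ 2 / b ^ 2) * a ^ 18 = 4⁻¹ * (b * a ^ 20 / b ^ 3) := by
          field_simp
      _ ≤ 2⁻¹ * (a * a ^ 20 / b ^ 3) := by gcongr; norm_num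
      _ = (b ^ 9 * 1 ^ 9 * a ^ 9 + 0) * (a ^ 12 * (1/2) / b ^ 12 + 0 + 0 + 0) := by
          field_simp; ring
      _ ≤ _ := by gcongr <;> positivity

theorem poly_two {a b c d s : ℝ} (ha : 0 < a) (hb : 0 < b) (hb1 : b ≤ 1) (hc : 1 ≤ c)
    (hd : 0 ≤ d) (has : a ≤ s) (hcs : c ≤ s) :
    b ^ 24 * a ^ 42 * c ^ 24 * (a ^ 6 * (d + 1) / b ^ 6 + a ^ 4 / b ^ 4 + s ^ 12) ≤
      4 * b ^ 9 * (b ^ 9 * c ^ 9 * a ^ 9 + b ^ 6 * d * a ^ 12) * s ^ 66 := by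
  have hc0 : 0 < c := by linarith
  have hs : 1 ≤ s := by linarith
  have hs0 : 0 < s := by linarith
  have e1 : b ^ 15 * d * a ^ 12 * (b ^ 3 * a ^ 36 * c ^ 24) ≤ b ^ 15 * d * a ^ 12 * s ^ 66 := by
    gcongr
    calc b ^ 3 * a ^ 36 * c ^ 24 ≤ 1 ^ 3 * s ^ 36 * s ^ 24 := by gcongr
      _ = s ^ 60 := by ring
      _ ≤ s ^ 66 := by gcongr <;> norm_num [hs]
  have e2 : b ^ 18 * c ^ 9 * a ^ 9 * (a ^ 39 * c ^ 15) ≤ b ^ 18 * c ^ 9 * a ^ 9 * s ^ 66 := by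
    gcongr
    calc a ^ 39 * c ^ 15 ≤ s ^ 39 * s ^ 15 := by gcongr
      _ = s ^ 54 := by ring
      _ ≤ s ^ 66 := by gcongr <;> norm_num [hs]
  have e3 : b ^ 18 * c ^ 9 * a ^ 9 * (b ^ 2 * a ^ 37 * c ^ 15) ≤
      b ^ 18 * c ^ 9 * a ^ 9 * s ^ 66 := by
    gcongr
    calc b ^ 2 * a ^ 37 * c ^ 15 ≤ 1 ^ 2 * s ^ 37 * s ^ 15 := by gcongr
      _ = s ^ 52 := by ring
      _ ≤ s ^ 66 := by gcongr <;> norm_num [hs]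
  have e4 : b ^ 18 * c ^ 9 * a ^ 9 * (b ^ 6 * a ^ 33 * c ^ 15 * s ^ 12) ≤
      b ^ 18 * c ^ 9 * a ^ 9 * s ^ 66 := by
    gcongr
    calc b ^ 6 * a ^ 33 * c ^ 15 * s ^ 12 ≤ 1 ^ 6 * s ^ 33 * s ^ 15 * s ^ 12 := by gcongr
      _ = s ^ 60 := by ring
      _ ≤ s ^ 66 := by gcongr <;> norm_num [hs]
  have e5 : 0 ≤ b ^ 15 * d * a ^ 12 * s ^ 66 := by positivity
  have e6 : 0 ≤ b ^ 18 * c ^ 9 * a ^ 9 * s ^ 66 := by positivity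
  have e0 : b ^ 24 * a ^ 42 * c ^ 24 * (a ^ 6 * (d + 1) / b ^ 6 + a ^ 4 / b ^ 4 + s ^ 12) =
      b ^ 15 * d * a ^ 12 * (b ^ 3 * a ^ 36 * c ^ 24) +
      b ^ 18 * c ^ 9 * a ^ 9 * (a ^ 39 * c ^ 15) +
      b ^ 18 * c ^ 9 * a ^ 9 * (b ^ 2 * a ^ 37 * c ^ 15) +
      b ^ 18 * c ^ 9 * a ^ 9 * (b ^ 6 * a ^ 33 * c ^ 15 * s ^ 12) := by
    field_simp
  rw [e0]
  linarith

/-- Elementary inequalities involving `A = |l(λ−1)/ν|^{1/2} + |l/ν|^{1/3} + |l| + |n|`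
(Lemma 6.3). -/
theorem elementary_A_inequalities :
    ∃ C : ℝ, 0 < C ∧
      ∀ n l ν : ℝ, 1 ≤ |n| → 0 < ν → ν < min |l| 1 → ∀ lam : ℂ,
        ∀ A : ℝ,
          A = ‖(l : ℂ) * (lam - 1) / (ν : ℂ)‖ ^ ((1:ℝ)/2)
                + |l / ν| ^ ((1:ℝ)/3) + |l| + |n| →
          C⁻¹ * |l / ν| ^ ((1:ℝ)/12) * |l| ^ ((3:ℝ)/4)
              ≤ (|ν * n * l| ^ ((3:ℝ)/8)
                  + ‖(ν : ℂ) * lam * (l : ℂ) ^ 2‖ ^ ((1:ℝ)/4)) * A ∧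
          ν * |l| ^ ((7:ℝ)/4) * |n| * A ^ ((1:ℝ)/2)
              ≤ C * ν ^ ((3:ℝ)/8)
                  * (|ν * n * l| ^ ((3:ℝ)/8)
                      + ‖(ν : ℂ) * lam * (l : ℂ) ^ 2‖ ^ ((1:ℝ)/4))
                  * (|n| + |l|) ^ ((11:ℝ)/4) := by
  refine ⟨4, by norm_num, ?_⟩
  intro n l ν hn hν hνl lam A hA
  obtain ⟨hνl, hν1⟩ := lt_min_iff.1 hνl
  obtain ⟨a, ha, hLa⟩ := root_aux 24 (by norm_num) (abs_nonneg l)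
  obtain ⟨b, hb, hνb⟩ := root_aux 24 (by norm_num) hν.le
  obtain ⟨c, hc, hNc⟩ := root_aux 24 (by norm_num) (abs_nonneg n)
  obtain ⟨s, hs, hSs⟩ := root_aux 24 (by norm_num) (add_nonneg (abs_nonneg n) (abs_nonneg l))
  obtain ⟨d, hd, hmd⟩ := root_aux 4 (by norm_num) (norm_nonneg lam)
  obtain ⟨q, hq, hpq⟩ := root_aux 4 (by norm_num) (norm_nonneg (lam - 1))
  have tri1 : 1 ≤ d ^ 4 + q ^ 4 := by
    rw [← hmd, ← hpq]
    have := norm_sub_le lam (lam - 1)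
    simpa using this
  have tri2 : q ^ 4 ≤ d ^ 4 + 1 := by
    rw [← hmd, ← hpq]
    simpa using norm_sub_le lam 1
  have hq1 : q ≤ d + 1 := by
    refine le_of_pow_le_pow_left₀ (n := 4) (by norm_num) (by positivity) ?_
    refine tri2.trans ?_
    have : 0 ≤ 4 * d ^ 3 + 6 * d ^ 2 + 4 * d := by positivity
    nlinarith
  have hb0 : 0 < b := by
    rcases hb.eq_or_lt with h | h
    · rw [hνb, ← h] at hν; norm_num at hν
    · exact h
  have hba : b ≤ a := by
    refine le_of_pow_le_pow_left₀ (n := 24) (by norm_num) ha ?_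
    rw [← hLa, ← hνb]; exact hνl.le
  have ha0 : 0 < a := by linarith
  have hb1 : b ≤ 1 := by
    refine le_of_pow_le_pow_left₀ (n := 24) (by norm_num) (by norm_num) ?_
    rw [← hνb]; linarith
  have hc1 : 1 ≤ c := by
    refine le_of_pow_le_pow_left₀ (n := 24) (by norm_num) hc ?_
    rw [← hNc]; linarith
  have has : a ≤ s := by
    refine le_of_pow_le_pow_left₀ (n := 24) (by norm_num) hs ?_
    rw [← hSs, ← hLa]; linarith [abs_nonneg n]
  have hcs : c ≤ s := by
    refine le_of_pow_le_pow_left₀ (n := 24) (by norm_num) hs ?_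
    rw [← hSs, ← hNc]; linarith [abs_nonneg l]
  have n1 : ‖(l : ℂ) * (lam - 1) / (ν : ℂ)‖ = (a ^ 6 * q / b ^ 6) ^ 4 := by
    rw [norm_div, norm_mul, Complex.norm_real, Complex.norm_real, Real.norm_eq_abs,
      Real.norm_eq_abs, abs_of_pos hν, hLa, hpq, hνb]
    ring
  have n2 : |l / ν| = (a / b) ^ 24 := by
    rw [abs_div, abs_of_pos hν, hLa, hνb]; ring
  have n3 : |ν * n * l| = (b * c * a) ^ 24 := by
    rw [abs_mul, abs_mul, abs_of_pos hν, hLa, hνb, hNc]; ring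
  have n4 : ‖(ν : ℂ) * lam * (l : ℂ) ^ 2‖ = (b ^ 6 * d * a ^ 12) ^ 4 := by
    rw [norm_mul, norm_mul, norm_pow, Complex.norm_real, Complex.norm_real, Real.norm_eq_abs,
      Real.norm_eq_abs, abs_of_pos hν, hLa, hmd, hνb]
    ring
  have p1 : 0 ≤ a ^ 6 * q / b ^ 6 := by positivity
  have p2 : 0 ≤ a / b := by positivity
  have p3 : 0 ≤ b * c * a := by positivity
  have p4 : 0 ≤ b ^ 6 * d * a ^ 12 := by positivity
  rw [n1, n2, pw_aux p1 4 2 _ (by norm_num), pw_aux p2 24 8 _ (by norm_num)] at hA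
  have hA2 : A ^ ((1:ℝ)/2) ≤ a ^ 6 * (d + 1) / b ^ 6 + a ^ 4 / b ^ 4 + s ^ 12 := by
    have hX : A ≤ (a ^ 6 * (d + 1) / b ^ 6 + a ^ 4 / b ^ 4 + s ^ 12) ^ 2 := by
      have k1 : (a ^ 6 * q / b ^ 6) ^ 2 ≤ (a ^ 6 * (d + 1) / b ^ 6) ^ 2 := by gcongr
      have k2 : (a / b) ^ 8 = (a ^ 4 / b ^ 4) ^ 2 := by ring
      have k3 : |l| + |n| = (s ^ 12) ^ 2 := by rw [add_comm, hSs]; ring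
      have k4 : 0 ≤ a ^ 6 * (d + 1) / b ^ 6 := by positivity
      have k5 : 0 ≤ a ^ 4 / b ^ 4 := by positivity
      have k6 : 0 ≤ s ^ 12 := by positivity
      rw [hA, k2, add_assoc, k3]
      nlinarith [mul_nonneg k4 k5, mul_nonneg k4 k6, mul_nonneg k5 k6]
    have hA0 : 0 ≤ A := by rw [hA]; positivity
    calc A ^ ((1:ℝ)/2) ≤ ((a ^ 6 * (d + 1) / b ^ 6 + a ^ 4 / b ^ 4 + s ^ 12) ^ 2) ^ ((1:ℝ)/2) :=
          Real.rpow_le_rpow hA0 hX (by norm_num)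
      _ = _ := by rw [pw_aux (by positivity) 2 1 _ (by norm_num), pow_one]
  rw [n2, n3, n4, hSs, hνb, pw_aux p2 24 2 _ (by norm_num), pw_aux p3 24 9 _ (by norm_num),
    pw_aux p4 4 1 _ (by norm_num), pw_aux hs 24 66 _ (by norm_num),
    pw_aux hb 24 9 _ (by norm_num), hLa, hNc, pw_aux ha 24 18 _ (by norm_num),
    pw_aux ha 24 42 _ (by norm_num)]
  constructor
  · have := poly_one ha0 hb0 hba hc1 hd hq tri1
    rw [hA, hLa, hNc]
    convert this using 1 <;> ring
  · have := poly_two ha0 hb0 hb1 hc1 hd has hcs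
    calc b ^ 24 * a ^ 42 * c ^ 24 * A ^ ((1:ℝ)/2)
        ≤ b ^ 24 * a ^ 42 * c ^ 24 *
          (a ^ 6 * (d + 1) / b ^ 6 + a ^ 4 / b ^ 4 + s ^ 12) := by gcongr
      _ ≤ _ := this
      _ = _ := by ring
end

section
/- There exist constants c₇ ∈ (0,1] and C > 0, independent of ν, l, λ, such that for every nonzero integer l, every ν > 0, every λ ∈ ℂ with l·Im λ ≤ c₇·|νl|^{1/2}, every F : (0,1) → ℂ, and every smooth J₁ : [0,1] → ℂ with J₁(0) = J₁(1) = 0 solving −ν·Δ̂₍₁₎J₁ + i·l·(λ−r²)·J₁ = F on (0,1), one has (|νl|^{1/2} + |νλl²|^{1/3})·‖J₁‖_{L²} + ν^{1/6}·|l|^{5/6}·‖rJ₁‖_{L¹} ≤ C·‖F‖_{L²}. In particular, if F ≡ 0 then J₁ ≡ 0. -/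
open MeasureTheory

/-- The operator `Δ̂₍₁₎ f = f'' + f'/r − ((1+r²l²)/r²) f`. -/
noncomputable def hatDone (l : ℤ) (f : ℝ → ℂ) (r : ℝ) : ℂ :=
  deriv (deriv f) r + deriv f r / (r : ℂ)
    - ((1 + (r : ℂ) ^ 2 * (l : ℂ) ^ 2) / (r : ℂ) ^ 2) * f r

lemma alg_num {d y ρ x z : ℝ} (hd0 : 0 ≤ d) (hy0 : 0 ≤ y) (hρ0 : 0 ≤ ρ) (hx0 : 0 ≤ x)
    (hz0 : 0 ≤ z) (hz1 : z ≤ 1) (hx1 : x < 1 / 40000) (e1 : d ^ 2 ≤ x + 1 / 40000 * z)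
    (e2 : ρ ^ 2 ≤ 1 + x * z ^ 2) (e3 : y ^ 2 ≤ x * y + 2 * (d * ρ))
    (e4 : 1 / 4 ≤ d * y / 2 + 2 * y ^ 2 * z ^ 4) : False := by
  have hz2 : z ^ 2 ≤ 1 := pow_le_one₀ hz0 hz1
  have hz4 : z ^ 4 ≤ 1 := pow_le_one₀ hz0 hz1
  have d1 : d ≤ 1 / 100 := by
    refine le_of_pow_le_pow_left₀ (n := 2) (by norm_num) (by norm_num) ?_
    linarith
  have hxz : x * z ^ 2 ≤ 1 / 40000 * 1 := by gcongr
  have r1 : ρ ≤ 11 / 10 := by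
    refine le_of_pow_le_pow_left₀ (n := 2) (by norm_num) (by norm_num) ?_
    linarith
  have dr : d * ρ ≤ 1 / 100 * (11 / 10) := by gcongr
  have y1 : y ≤ 1 / 5 := by
    by_contra h
    push Not at h
    have h1 : x * y ≤ 1 / 40000 * y := by gcongr
    nlinarith
  have h1 : y ^ 2 * z ^ 4 ≤ (1 / 5) ^ 2 * 1 := by gcongr
  have h2 : d * y ≤ 1 / 100 * (1 / 5) := by gcongr
  linarith

lemma alg_Z {Z X G : ℝ} (hX : 0 ≤ X) (h : Z ^ 2 ≤ X * Z + 2 * G)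
    (hG : G ≤ 2 * 40000 ^ 2 * X ^ 2) : Z ≤ 120000 * X := by
  by_contra hc
  push Not at hc
  have h1 : 0 < Z := by linarith
  nlinarith [mul_nonneg hX h1.le, mul_pos (sub_pos.2 hc) h1, mul_nonneg hX (sub_pos.2 hc).le]

set_option maxHeartbeats 1000000 in
lemma alg_caseB {n k t j X D R Y a β : ℝ} (hn : 0 < n) (hk : 0 < k) (ht : 0 < t)
    (hj : 0 < j) (hX : 0 ≤ X) (hD : 0 ≤ D) (hR : 0 ≤ R) (hY : 0 ≤ Y)
    (ha : a = t ^ 6) (hkt : n ≤ k * t ^ 2)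
    (hβ : β ≤ 1 / 40000 * (n ^ 3 * k ^ 3))
    (E1 : n ^ 6 * D ^ 2 ≤ X * j + β * j ^ 2)
    (E2b : k ^ 6 * (R ^ 2 - a * j ^ 2) ≤ X * j)
    (E3 : k ^ 6 * Y ^ 2 ≤ X * Y + 2 * n ^ 6 * (D * R))
    (U2 : j ^ 2 / 4 ≤ D * Y / (2 * t ^ 3) + 2 * Y ^ 2 / a ^ 2) :
    n ^ 2 * k ^ 4 * t ^ 2 * j ≤ 40000 * X := by
  by_contra hcon
  push Not at hcon
  obtain ⟨d, hd⟩ : ∃ d, d = D * n ^ 2 / (k ^ 2 * t * j) := ⟨_, rfl⟩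
  obtain ⟨y, hy⟩ : ∃ y, y = Y * k ^ 2 / (n ^ 2 * t ^ 2 * j) := ⟨_, rfl⟩
  obtain ⟨ρ, hρ⟩ : ∃ ρ, ρ = R / (t ^ 3 * j) := ⟨_, rfl⟩
  obtain ⟨x, hx⟩ : ∃ x, x = X / (n ^ 2 * k ^ 4 * t ^ 2 * j) := ⟨_, rfl⟩
  obtain ⟨z, hz⟩ : ∃ z, z = n / (k * t ^ 2) := ⟨_, rfl⟩
  have hd0 : 0 ≤ d := by rw [hd]; positivity
  have hy0 : 0 ≤ y := by rw [hy]; positivity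
  have hρ0 : 0 ≤ ρ := by rw [hρ]; positivity
  have hx0 : 0 ≤ x := by rw [hx]; positivity
  have hz0 : 0 ≤ z := by rw [hz]; positivity
  have hz1 : z ≤ 1 := by rw [hz]; exact (div_le_one (by positivity)).2 hkt
  have hD' : D = d * k ^ 2 * t * j / n ^ 2 := by rw [hd]; field_simp
  have hY' : Y = y * n ^ 2 * t ^ 2 * j / k ^ 2 := by rw [hy]; field_simp
  have hR' : R = ρ * t ^ 3 * j := by rw [hρ]; field_simp
  have hX' : X = x * (n ^ 2 * k ^ 4 * t ^ 2 * j) := by rw [hx]; field_simp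
  have hn' : n = z * (k * t ^ 2) := by rw [hz]; field_simp
  have hx1 : x < 1 / 40000 := by
    rw [hx, div_lt_iff₀ (by positivity)]; linarith
  have e1 : d ^ 2 ≤ x + 1 / 40000 * z := by
    have h : n ^ 6 * D ^ 2 ≤ X * j + 1 / 40000 * (n ^ 3 * k ^ 3) * j ^ 2 :=
      E1.trans (by gcongr)
    have h1 : (n ^ 2 * k ^ 4 * t ^ 2 * j ^ 2) * d ^ 2 ≤
        (n ^ 2 * k ^ 4 * t ^ 2 * j ^ 2) * (x + 1 / 40000 * z) := by
      calc _ = n ^ 6 * D ^ 2 := by rw [hD']; field_simp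
        _ ≤ _ := h
        _ = _ := by rw [hX', hz]; field_simp
    exact le_of_mul_le_mul_left h1 (by positivity)
  have e2 : ρ ^ 2 ≤ 1 + x * z ^ 2 := by
    have h1 : (k ^ 6 * t ^ 6 * j ^ 2) * (ρ ^ 2 - 1) ≤ (k ^ 6 * t ^ 6 * j ^ 2) * (x * z ^ 2) := by
      calc _ = k ^ 6 * (R ^ 2 - a * j ^ 2) := by rw [hR', ha]; ring
        _ ≤ _ := E2b
        _ = _ := by rw [hX', hz]; field_simp
    linarith [le_of_mul_le_mul_left h1 (by positivity)]
  have e3 : y ^ 2 ≤ x * y + 2 * (d * ρ) := by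
    have h1 : (k ^ 2 * n ^ 4 * t ^ 4 * j ^ 2) * y ^ 2 ≤
        (k ^ 2 * n ^ 4 * t ^ 4 * j ^ 2) * (x * y + 2 * (d * ρ)) := by
      calc _ = k ^ 6 * Y ^ 2 := by rw [hY']; field_simp
        _ ≤ _ := E3
        _ = _ := by rw [hX', hY', hD', hR']; field_simp
    exact le_of_mul_le_mul_left h1 (by positivity)
  have e4 : 1 / 4 ≤ d * y / 2 + 2 * y ^ 2 * z ^ 4 := by
    have h1 : j ^ 2 * (1 / 4) ≤ j ^ 2 * (d * y / 2 + 2 * y ^ 2 * z ^ 4) := by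
      calc _ = j ^ 2 / 4 := by ring
        _ ≤ _ := U2
        _ = _ := by rw [hY', hD', ha, hz]; field_simp
    exact le_of_mul_le_mul_left h1 (by positivity)
  exact alg_num hd0 hy0 hρ0 hx0 hz0 hz1 hx1 e1 e2 e3 e4

lemma alg_caseA {n k j X D R a β : ℝ} (hn : 0 < n) (hk : 0 < k)
    (hj : 0 < j) (hX : 0 ≤ X) 
    (ha : a * k ^ 3 ≤ n ^ 3)
    (hβ : β ≤ 1 / 40000 * (n ^ 3 * k ^ 3))
    (E1 : n ^ 6 * D ^ 2 ≤ X * j + β * j ^ 2)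
    (E2b : k ^ 6 * (R ^ 2 - a * j ^ 2) ≤ X * j)
    (U1 : j ^ 2 ≤ D * R) :
    n ^ 3 * k ^ 3 * j ≤ 4 * X := by
  by_contra hcon
  push Not at hcon
  obtain ⟨w, hw⟩ : ∃ w, w = n ^ 3 * k ^ 3 * j := ⟨_, rfl⟩
  have hw0 : 0 < w := by rw [hw]; positivity
  have h1 : n ^ 6 * D ^ 2 ≤ j * (X + 1 / 40000 * w) := by
    have : β * j ^ 2 ≤ 1 / 40000 * (n ^ 3 * k ^ 3) * j ^ 2 := by gcongr
    rw [hw]; linarith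
  have h2 : k ^ 6 * R ^ 2 ≤ j * (X + w) := by
    have : a * k ^ 3 * (k ^ 3 * j ^ 2) ≤ n ^ 3 * (k ^ 3 * j ^ 2) := by gcongr
    rw [hw]; linarith
  have h3 : (n ^ 6 * D ^ 2) * (k ^ 6 * R ^ 2) ≤ (j * (X + 1 / 40000 * w)) * (j * (X + w)) := by
    gcongr
  have h4 : j ^ 2 * w ^ 2 ≤ j ^ 2 * ((X + 1 / 40000 * w) * (X + w)) := by
    calc j ^ 2 * w ^ 2 = n ^ 6 * k ^ 6 * (j ^ 2) ^ 2 := by rw [hw]; ring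
      _ ≤ n ^ 6 * k ^ 6 * (D * R) ^ 2 := by gcongr
      _ = _ := by ring
      _ ≤ _ := h3
      _ = _ := by ring
  have h5 := le_of_mul_le_mul_left h4 (by positivity)
  rw [← hw] at hcon
  nlinarith

set_option maxHeartbeats 1000000 in
lemma alg_main {n k j X D R Y N a β : ℝ} (hn : 0 < n) (hk : 0 < k)
    (hj : 0 ≤ j) (hX : 0 ≤ X) (hD : 0 ≤ D) (hR : 0 ≤ R) (hY : 0 ≤ Y) (hN : 0 ≤ N)
    (hβ : β ≤ 1 / 40000 * (n ^ 3 * k ^ 3))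
    (E1 : n ^ 6 * D ^ 2 ≤ X * j + β * j ^ 2)
    (E2b : k ^ 6 * (R ^ 2 - a * j ^ 2) ≤ X * j)
    (E3 : k ^ 6 * Y ^ 2 ≤ X * Y + 2 * n ^ 6 * (D * R))
    (U1 : j ^ 2 ≤ D * R)
    (U2 : ∀ q, 0 < q → a = q ^ 2 → j ^ 2 / 4 ≤ D * Y / (2 * q) + 2 * Y ^ 2 / a ^ 2)
    (L1 : ∀ y κ a', 0 < y → 0 < κ → 0 ≤ a' → (∀ s, 0 ≤ s → s ≤ 1 → s ≤ a' + |s - a|) →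
      N ^ 2 ≤ (y ^ 2 * j ^ 2 + Y ^ 2) * ((a' + κ / 2) * (2 / y) + 1 / (4 * κ)))
    (L0 : N ≤ j) :
    n ^ 3 * k ^ 3 * j ≤ 40000 * X ∧ n ^ 6 * k ^ 12 * |a| * j ^ 3 ≤ (40000 * X) ^ 3 ∧
    n ^ 6 * k ^ 6 * |β| * j ^ 3 ≤ (40000 * X) ^ 3 ∧ n * k ^ 5 * N ≤ 280000 * X := by
  rcases hj.eq_or_lt with h0 | hj
  · have : N = 0 := by linarith
    rw [← h0, this]; refine ⟨?_, ?_, ?_, ?_⟩ <;> simp <;> positivity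
  -- the scale
  obtain ⟨t, ht, hkt, hat, hT⟩ : ∃ t, 0 < t ∧ n ≤ k * t ^ 2 ∧ a ≤ t ^ 6 ∧
      n ^ 2 * k ^ 4 * t ^ 2 * j ≤ 40000 * X := by
    by_cases hc : a * k ^ 3 ≤ n ^ 3
    · have hA := alg_caseA hn hk hj hX hc hβ E1 E2b U1
      have hs : (Real.sqrt (n / k)) ^ 2 = n / k := Real.sq_sqrt (by positivity)
      refine ⟨Real.sqrt (n / k), Real.sqrt_pos.2 (by positivity), ?_, ?_, ?_⟩
      · rw [hs]; field_simp; rfl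
      · rw [show (Real.sqrt (n / k)) ^ 6 = ((Real.sqrt (n / k)) ^ 2) ^ 3 by ring, hs, div_pow,
          le_div_iff₀ (by positivity)]; exact hc
      · rw [hs]
        calc _ = n ^ 3 * k ^ 3 * j := by field_simp
          _ ≤ _ := by linarith
    · push Not at hc
      have ha : 0 < a := by
        by_contra h; push Not at h
        have : a * k ^ 3 ≤ 0 := mul_nonpos_of_nonpos_of_nonneg h (by positivity)
        have : 0 < n ^ 3 := by positivity
        linarith
      obtain ⟨t, ht⟩ : ∃ t, t = a ^ ((1:ℝ) / 6) := ⟨_, rfl⟩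
      have ht0 : 0 < t := by rw [ht]; positivity
      have hat : a = t ^ 6 := by
        rw [ht, ← Real.rpow_natCast, ← Real.rpow_mul ha.le]; norm_num
      have hkt : n ≤ k * t ^ 2 := by
        have : n ^ 3 ≤ (k * t ^ 2) ^ 3 := by rw [hat] at hc; nlinarith
        exact le_of_pow_le_pow_left₀ (by norm_num) (by positivity) this
      exact ⟨t, ht0, hkt, hat.le, alg_caseB hn hk ht0 hj hX hD hR hY hat hkt hβ E1 E2b E3
        (U2 (t ^ 3) (by positivity) (by rw [hat]; ring))⟩
  have hq : n ^ 3 * k ^ 3 * j ≤ 40000 * X := by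
    refine le_trans ?_ hT
    have : n ^ 2 * k ^ 3 * j * n ≤ n ^ 2 * k ^ 3 * j * (k * t ^ 2) := by gcongr
    linarith
  have hq2 : n ^ 6 * k ^ 6 * j ^ 2 ≤ (40000 * X) ^ 2 := by
    calc _ = (n ^ 3 * k ^ 3 * j) ^ 2 := by ring
      _ ≤ _ := by gcongr
  have hT3 : n ^ 6 * k ^ 12 * t ^ 6 * j ^ 3 ≤ (40000 * X) ^ 3 := by
    calc _ = (n ^ 2 * k ^ 4 * t ^ 2 * j) ^ 3 := by ring
      _ ≤ _ := by gcongr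
  have hX3 : 0 ≤ X ^ 3 := by positivity
  refine ⟨hq, ?_, ?_, ?_⟩
  · rcases le_or_gt 0 a with ha | ha
    · rw [abs_of_nonneg ha]
      refine le_trans ?_ hT3
      gcongr
    · rw [abs_of_neg ha]
      have h1 : j * (k ^ 6 * (-a) * j) ≤ j * X := by nlinarith [pow_pos hk 6, sq_nonneg R, mul_nonneg (pow_pos hk 6).le (sq_nonneg R)]
      have h2 := le_of_mul_le_mul_left h1 hj
      calc _ = (n ^ 6 * k ^ 6 * j ^ 2) * (k ^ 6 * (-a) * j) := by ring
        _ ≤ (40000 * X) ^ 2 * X := by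
            apply mul_le_mul hq2 h2 _ (by positivity)
            have : 0 < -a := by linarith
            positivity
        _ ≤ _ := by nlinarith
  · rcases le_or_gt 0 β with hb | hb
    · rw [abs_of_nonneg hb]
      have h2 : β * j ≤ X := by
        have : β * j ≤ 1 / 40000 * (n ^ 3 * k ^ 3) * j := by gcongr
        linarith
      calc _ = (n ^ 6 * k ^ 6 * j ^ 2) * (β * j) := by ring
        _ ≤ (40000 * X) ^ 2 * X := by gcongr
        _ ≤ _ := by nlinarith
    · rw [abs_of_neg hb]
      have h1 : j * (-β * j) ≤ j * X := by
        have : 0 ≤ n ^ 6 * D ^ 2 := by positivity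
        nlinarith
      have h2 := le_of_mul_le_mul_left h1 hj
      calc _ = (n ^ 6 * k ^ 6 * j ^ 2) * (-β * j) := by ring
        _ ≤ (40000 * X) ^ 2 * X := by
            apply mul_le_mul hq2 h2 _ (by positivity)
            have : 0 < -β := by linarith
            positivity
        _ ≤ _ := by nlinarith
  · rcases le_or_gt k n with hkn | hkn
    · have : n * k ^ 5 * N ≤ n ^ 3 * k ^ 3 * j := by
        calc n * k ^ 5 * N = n * k ^ 3 * (k ^ 2) * N := by ring
          _ ≤ n * k ^ 3 * (n ^ 2) * j := by gcongr
          _ = _ := by ring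
      linarith
    -- bound on Y
    have hD2 : n ^ 6 * D ^ 2 ≤ 2 * X * j := by
      have : β * j ^ 2 ≤ 1 / 40000 * (n ^ 3 * k ^ 3) * j ^ 2 := by gcongr
      nlinarith
    have hR2 : k ^ 12 * R ^ 2 ≤ k ^ 12 * t ^ 6 * j ^ 2 + k ^ 6 * X * j := by
      have h1 : k ^ 6 * (k ^ 6 * (R ^ 2 - a * j ^ 2)) ≤ k ^ 6 * (X * j) := by gcongr
      have h2 : k ^ 12 * a * j ^ 2 ≤ k ^ 12 * t ^ 6 * j ^ 2 := by gcongr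
      linarith
    have hDR : (n ^ 6 * k ^ 6 * (D * R)) ^ 2 ≤ (2 * 40000 ^ 2 * X ^ 2) ^ 2 := by
      calc _ = n ^ 6 * ((n ^ 6 * D ^ 2) * (k ^ 12 * R ^ 2)) := by ring
        _ ≤ n ^ 6 * ((2 * X * j) * (k ^ 12 * t ^ 6 * j ^ 2 + k ^ 6 * X * j)) := by gcongr
        _ = 2 * X * (n ^ 6 * k ^ 12 * t ^ 6 * j ^ 3 + (n ^ 6 * k ^ 6 * j ^ 2) * X) := by ring
        _ ≤ 2 * X * ((40000 * X) ^ 3 + (40000 * X) ^ 2 * X) := by gcongr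
        _ ≤ _ := by nlinarith [pow_nonneg hX 4]
    have hDR' := le_of_pow_le_pow_left₀ (n := 2) (by norm_num) (by positivity) hDR
    have hZ : k ^ 6 * Y ≤ 120000 * X := by
      refine alg_Z hX ?_ hDR'
      have h1 : k ^ 6 * (k ^ 6 * Y ^ 2) ≤ k ^ 6 * (X * Y + 2 * n ^ 6 * (D * R)) := by gcongr
      linarith
    have hL := L1 (n ^ 2 * t ^ 2 / k ^ 2) (n ^ 2 / k ^ 2) (t ^ 2) (by positivity) (by positivity)
      (by positivity) (by
        intro s hs0 hs1
        rcases le_or_gt 1 t with h1 | h1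
        · have : 1 ≤ t ^ 2 := one_le_pow₀ h1
          linarith [abs_nonneg (s - a)]
        · have : t ^ 6 ≤ t ^ 2 := pow_le_pow_of_le_one ht.le h1.le (by norm_num)
          linarith [le_abs_self (s - a)])
    have f1 : k ^ 12 * ((n ^ 2 * t ^ 2 / k ^ 2) ^ 2 * j ^ 2 + Y ^ 2) ≤ 10 * (40000 * X) ^ 2 := by
      calc _ = (n ^ 2 * k ^ 4 * t ^ 2 * j) ^ 2 + (k ^ 6 * Y) ^ 2 := by field_simp
        _ ≤ (40000 * X) ^ 2 + (120000 * X) ^ 2 := by gcongr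
        _ = _ := by ring
    have f2 : (t ^ 2 + n ^ 2 / k ^ 2 / 2) * (2 / (n ^ 2 * t ^ 2 / k ^ 2)) + 1 / (4 * (n ^ 2 / k ^ 2))
        ≤ 4 * (k ^ 2 / n ^ 2) := by
      have h1 : n ^ 2 ≤ k ^ 2 * t ^ 2 := by nlinarith [mul_pos hk (pow_pos ht 2)]
      have h2 : 1 / t ^ 2 ≤ k ^ 2 / n ^ 2 := by
        rw [div_le_div_iff₀ (by positivity) (by positivity)]; linarith
      calc _ = 2 * (k ^ 2 / n ^ 2) + 1 / t ^ 2 + 1 / 4 * (k ^ 2 / n ^ 2) := by field_simp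
        _ ≤ _ := by
          have : 0 < k ^ 2 / n ^ 2 := by positivity
          linarith
    have hfin : (n * k ^ 5 * N) ^ 2 ≤ (280000 * X) ^ 2 := by
      calc _ = n ^ 2 / k ^ 2 * (k ^ 12 * N ^ 2) := by field_simp
        _ ≤ n ^ 2 / k ^ 2 * (k ^ 12 * (((n ^ 2 * t ^ 2 / k ^ 2) ^ 2 * j ^ 2 + Y ^ 2) *
            (4 * (k ^ 2 / n ^ 2)))) := by
              gcongr
              exact hL.trans (by gcongr)
        _ = 4 * (k ^ 12 * ((n ^ 2 * t ^ 2 / k ^ 2) ^ 2 * j ^ 2 + Y ^ 2)) := by field_simp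
        _ ≤ 4 * (10 * (40000 * X) ^ 2) := by gcongr
        _ ≤ _ := by nlinarith
    exact le_of_pow_le_pow_left₀ (n := 2) (by norm_num) (by positivity) hfin

lemma intC {g : ℝ → ℝ} (hg : ContinuousOn g (Set.Icc 0 1)) :
    IntegrableOn g (Set.Ioo 0 1) :=
  (hg.integrableOn_Icc).mono_set Set.Ioo_subset_Icc_self

lemma intB {g : ℝ → ℝ} (hg : ContinuousOn g (Set.Ioo 0 1)) {M : ℝ}
    (hM : ∀ r ∈ Set.Ioo (0:ℝ) 1, ‖g r‖ ≤ M) : IntegrableOn g (Set.Ioo 0 1) :=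
  IntegrableOn.of_bound (by simp) (hg.aestronglyMeasurable measurableSet_Ioo) M
    ((ae_restrict_iff' measurableSet_Ioo).2 (Filter.Eventually.of_forall hM))

lemma ftc0 {f g : ℝ → ℝ} (hf : ContinuousOn f (Set.Icc 0 1)) (hg : ContinuousOn g (Set.Icc 0 1))
    (hd : ∀ r ∈ Set.Ioo (0:ℝ) 1, HasDerivAt f (g r) r) :
    ∫ r in Set.Ioo (0:ℝ) 1, g r = f 1 - f 0 := by
  rw [← integral_Ioc_eq_integral_Ioo, ← intervalIntegral.integral_of_le zero_le_one]
  apply intervalIntegral.integral_eq_sub_of_hasDerivAt_of_le zero_le_one hf hd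
  exact ContinuousOn.intervalIntegrable (by rwa [Set.uIcc_of_le zero_le_one])

lemma cs {f g : ℝ → ℝ} {S : Set ℝ} (hf : IntegrableOn (fun r => f r ^ 2) S)
    (hg : IntegrableOn (fun r => g r ^ 2) S) (hfg : IntegrableOn (fun r => f r * g r) S) :
    (∫ r in S, f r * g r) ^ 2 ≤ (∫ r in S, f r ^ 2) * ∫ r in S, g r ^ 2 := by
  have h : ∀ t : ℝ, 0 ≤ (∫ r in S, f r ^ 2) * (t * t) + (2 * ∫ r in S, f r * g r) * t
      + ∫ r in S, g r ^ 2 := by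
    intro t
    have : 0 ≤ ∫ r in S, (f r * t + g r) ^ 2 := integral_nonneg fun r => sq_nonneg _
    have e : (fun r => (f r * t + g r) ^ 2) =
      fun r => f r ^ 2 * (t * t) + (f r * g r) * (2 * t) + g r ^ 2 := by
      funext r; ring
    rw [e, integral_add, integral_add, integral_mul_const, integral_mul_const] at this
    · linarith
    · exact hf.mul_const _
    · exact hfg.mul_const _
    · exact (hf.mul_const _).add (hfg.mul_const _)
    · exact hg
  have := discrim_le_zero h
  unfold discrim at this
  linarith

/-- weighted Cauchy-Schwarz. -/
lemma csw {f g : ℝ → ℝ} (hf : IntegrableOn (fun r => f r ^ 2 * r) (Set.Ioo 0 1))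
    (hg : IntegrableOn (fun r => g r ^ 2 * r) (Set.Ioo 0 1))
    (hfg : IntegrableOn (fun r => f r * g r * r) (Set.Ioo 0 1)) :
    ∫ r in Set.Ioo (0:ℝ) 1, f r * g r * r ≤ Real.sqrt (∫ r in Set.Ioo (0:ℝ) 1, f r ^ 2 * r)
      * Real.sqrt (∫ r in Set.Ioo (0:ℝ) 1, g r ^ 2 * r) := by
  have e : ∀ f : ℝ → ℝ, Set.EqOn (fun r => f r ^ 2 * r) (fun r => (f r * Real.sqrt r) ^ 2)
      (Set.Ioo (0:ℝ) 1) := by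
    intro f r hr
    simp only [mul_pow]; rw [Real.sq_sqrt hr.1.le]
  have e2 : Set.EqOn (fun r => f r * g r * r) (fun r => (f r * Real.sqrt r) * (g r * Real.sqrt r))
      (Set.Ioo (0:ℝ) 1) := by
    intro r hr
    have := Real.mul_self_sqrt hr.1.le
    simp only
    calc _ = f r * g r * (Real.sqrt r * Real.sqrt r) := by rw [this]
      _ = _ := by ring
  rw [← Real.sqrt_mul (setIntegral_nonneg measurableSet_Ioo fun r hr => 
    mul_nonneg (sq_nonneg _) hr.1.le)]
  apply Real.le_sqrt_of_sq_le
  rw [setIntegral_congr_fun measurableSet_Ioo (e f), setIntegral_congr_fun measurableSet_Ioo (e g),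
    setIntegral_congr_fun measurableSet_Ioo e2]
  exact cs (hf.congr_fun (e f) measurableSet_Ioo) (hg.congr_fun (e g) measurableSet_Ioo)
    (hfg.congr_fun e2 measurableSet_Ioo)

section
variable {J J1 J2 : ℝ → ℂ}

lemma dW {r : ℝ} (d0 : HasDerivAt J (J1 r) r) (d1 : HasDerivAt J1 (J2 r) r) :
    HasDerivAt (fun r : ℝ => (r : ℂ) * J1 r * star (J r))
      ((J1 r + r * J2 r) * star (J r) + r * J1 r * star (J1 r)) r := by
  have h : HasDerivAt (fun r : ℝ => (r : ℂ) * J1 r * star (J r)) _ r :=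
    ((HasDerivAt.ofReal_comp (hasDerivAt_id r)).mul d1).mul d0.star
  exact h.congr_deriv (by simp)

lemma dP {r : ℝ} (d0 : HasDerivAt J (J1 r) r) (d1 : HasDerivAt J1 (J2 r) r) :
    HasDerivAt (fun r : ℝ => ((r : ℂ) * J1 r * star (J r)).re)
      (((J1 r + r * J2 r) * star (J r)).re + r * ‖J1 r‖ ^ 2) r := by
  have h := Complex.reCLM.hasFDerivAt.comp_hasDerivAt r (dW d0 d1)
  refine h.congr_deriv ?_
  simp only [Complex.reCLM_apply, Complex.add_re]
  congr 1
  rw [← Complex.normSq_eq_norm_sq, Complex.normSq_apply]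
  simp; ring

lemma dQ {r : ℝ} (d0 : HasDerivAt J (J1 r) r) (d1 : HasDerivAt J1 (J2 r) r) :
    HasDerivAt (fun r : ℝ => ((r : ℂ) * J1 r * star (J r)).im)
      (((J1 r + r * J2 r) * star (J r)).im) r := by
  have h := Complex.imCLM.hasFDerivAt.comp_hasDerivAt r (dW d0 d1)
  refine h.congr_deriv ?_
  simp only [Complex.imCLM_apply, Complex.add_im]
  simp; ring

lemma dN {r : ℝ} (d0 : HasDerivAt J (J1 r) r) :
    HasDerivAt (fun r : ℝ => ‖J r‖ ^ 2) (2 * (J1 r * star (J r)).re) r := by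
  have h := d0.norm_sq
  refine h.congr_deriv ?_
  rw [Complex.inner]; rfl

lemma re_le (z w : ℂ) : |(z * star w).re| ≤ ‖z‖ * ‖w‖ := by
  simpa using Complex.abs_re_le_norm (z * star w)
lemma im_le (z w : ℂ) : |(z * star w).im| ≤ ‖z‖ * ‖w‖ := by
  simpa using Complex.abs_im_le_norm (z * star w)

/-- pointwise identity -/
lemma ptw {ν r : ℝ} {l : ℤ} {lam a0 a1 a2 f : ℂ} (hr : 0 < r)
    (h : -(ν : ℂ) * (a2 + a1 / (r : ℂ)
    - ((1 + (r : ℂ) ^ 2 * (l : ℂ) ^ 2) / (r : ℂ) ^ 2) * a0)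
              + Complex.I * (l : ℂ) * (lam - (r : ℂ) ^ 2) * a0 = f) :
    (f * star a0).re * r = - ν * ((a1 + r * a2) * star a0).re + ν * (1 / r + r * l ^ 2) * ‖a0‖ ^ 2
      - l * lam.im * (‖a0‖ ^ 2 * r) ∧
    (f * star a0).im * r = - ν * ((a1 + r * a2) * star a0).im
      + l * (lam.re - r ^ 2) * (‖a0‖ ^ 2 * r) := by
  have hr' : (r : ℂ) ≠ 0 := by exact_mod_cast hr.ne'
  have hn : a0 * star a0 = ((‖a0‖ ^ 2 : ℝ) : ℂ) := by
    have := Complex.mul_conj' a0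
    push_cast; exact this
  have key : (f * star a0) * r = ((-ν : ℝ) : ℂ) * ((a1 + r * a2) * star a0)
      + ((ν * (1 / r + r * l ^ 2) * ‖a0‖ ^ 2 : ℝ) : ℂ)
      + Complex.I * (lam - ((r ^ 2 : ℝ) : ℂ)) * ((l * (‖a0‖ ^ 2 * r) : ℝ) : ℂ) := by
    rw [← h]
    have e1 : ((ν * (1 / r + r * l ^ 2) * ‖a0‖ ^ 2 : ℝ) : ℂ)
      = ν * (1 / r + r * l ^ 2) * (a0 * star a0) := by rw [hn]; push_cast; ring
    have e2 : ((l * (‖a0‖ ^ 2 * r) : ℝ) : ℂ) = l * (a0 * star a0) * r := by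
      rw [hn]; push_cast; ring
    rw [e1, e2]
    push_cast
    field_simp
    ring
  constructor
  · have := congrArg Complex.re key
    rw [Complex.re_mul_ofReal, Complex.add_re, Complex.add_re, Complex.re_ofReal_mul,
      Complex.ofReal_re, Complex.re_mul_ofReal] at this
    rw [this]; simp [-Complex.ofReal_pow]; ring
  · have := congrArg Complex.im key
    rw [Complex.im_mul_ofReal, Complex.add_im, Complex.add_im, Complex.im_ofReal_mul,
      Complex.ofReal_im, Complex.im_mul_ofReal] at this
    rw [this]; simp [-Complex.ofReal_pow]; ring

end

/-- weighted norm -/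
noncomputable def nrm (g : ℝ → ℝ) : ℝ := Real.sqrt (∫ r in Set.Ioo (0:ℝ) 1, g r ^ 2 * r)

lemma nrm_nonneg (g : ℝ → ℝ) : 0 ≤ nrm g := Real.sqrt_nonneg _
lemma nrm_sq (g : ℝ → ℝ) : nrm g ^ 2 = ∫ r in Set.Ioo (0:ℝ) 1, g r ^ 2 * r :=
  Real.sq_sqrt (setIntegral_nonneg measurableSet_Ioo fun r hr => 
    mul_nonneg (sq_nonneg _) hr.1.le)

/-- bundled hypotheses -/
structure Sys (ν : ℝ) (l : ℤ) (lam : ℂ) (F J J1 J2 : ℝ → ℂ) (M : ℝ) : Prop where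
  hν : 0 < ν
  c0 : ContinuousOn J (Set.Icc 0 1)
  c1 : ContinuousOn J1 (Set.Icc 0 1)
  c2 : ContinuousOn J2 (Set.Icc 0 1)
  d0 : ∀ r ∈ Set.Ioo (0:ℝ) 1, HasDerivAt J (J1 r) r
  d1 : ∀ r ∈ Set.Ioo (0:ℝ) 1, HasDerivAt J1 (J2 r) r
  z0 : J 0 = 0
  z1 : J 1 = 0
  eq : ∀ r ∈ Set.Ioo (0:ℝ) 1, -(ν : ℂ) * (J2 r + J1 r / (r : ℂ)
    - ((1 + (r : ℂ) ^ 2 * (l : ℂ) ^ 2) / (r : ℂ) ^ 2) * J r)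
              + Complex.I * (l : ℂ) * (lam - (r : ℂ) ^ 2) * J r = F r
  cF : ContinuousOn F (Set.Ioo 0 1)
  bF : ∀ r ∈ Set.Ioo (0:ℝ) 1, ‖F r‖ ≤ M

namespace Sys
variable {ν : ℝ} {l : ℤ} {lam : ℂ} {F J J1 J2 : ℝ → ℂ} {M : ℝ}

lemma iF (S : Sys ν l lam F J J1 J2 M) {g : ℝ → ℝ} (hg : ContinuousOn g (Set.Icc 0 1)) :
    IntegrableOn (fun r => ‖F r‖ * g r) (Set.Ioo 0 1) := by
  obtain ⟨B, hB⟩ := isCompact_Icc.exists_bound_of_continuousOn hg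
  refine intB (M := M * B) (S.cF.norm.mul (hg.mono Set.Ioo_subset_Icc_self)) fun r hr => ?_
  rw [norm_mul, norm_norm]
  have := S.bF r hr
  have h2 := hB r (Set.Ioo_subset_Icc_self hr)
  exact mul_le_mul this h2 (norm_nonneg _) ((norm_nonneg _).trans this)

lemma iF2 (S : Sys ν l lam F J J1 J2 M) :
    IntegrableOn (fun r => ‖F r‖ ^ 2 * r) (Set.Ioo 0 1) := by
  refine intB (M := M ^ 2) ((S.cF.norm.pow 2).mul continuousOn_id) fun r hr => ?_
  have := S.bF r hr
  rw [norm_mul, norm_pow, norm_norm, Real.norm_of_nonneg hr.1.le]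
  calc _ ≤ M ^ 2 * 1 := by exact mul_le_mul (pow_le_pow_left₀ (norm_nonneg _) this 2) hr.2.le hr.1.le (sq_nonneg M)
    _ = _ := by ring

lemma csF (S : Sys ν l lam F J J1 J2 M) {g : ℝ → ℝ} (hg : ContinuousOn g (Set.Icc 0 1)) :
    ∫ r in Set.Ioo (0:ℝ) 1, ‖F r‖ * (g r * r) ≤ nrm (fun r => ‖F r‖) * nrm g := by
  have := csw (f := fun r => ‖F r‖) (g := g) S.iF2 (intC (by fun_prop))
    (by simpa only [mul_assoc] using S.iF (g := fun r => g r * r) (by fun_prop))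
  simpa only [mul_assoc, nrm] using this

lemma E1 (S : Sys ν l lam F J J1 J2 M) :
    ν * nrm (fun r => ‖J1 r‖) ^ 2 ≤ nrm (fun r => ‖F r‖) * nrm (fun r => ‖J r‖)
      + (l * lam.im) * nrm (fun r => ‖J r‖) ^ 2 := by
  have c0 := S.c0; have c1 := S.c1; have c2 := S.c2
  have h := S.csF c0.norm
  have hP := ftc0 (f := fun r : ℝ => ((r : ℂ) * J1 r * star (J r)).re)
    (g := fun r => ((J1 r + r * J2 r) * star (J r)).re + r * ‖J1 r‖ ^ 2)
    (Complex.continuous_re.comp_continuousOn (by fun_prop))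
    ((Complex.continuous_re.comp_continuousOn (by fun_prop)).add (by fun_prop))
    (fun r hr => dP (S.d0 r hr) (S.d1 r hr))
  simp only [S.z0, S.z1, star_zero, mul_zero, Complex.zero_re, sub_zero] at hP
  have i1 : IntegrableOn (fun r => ν * (‖J1 r‖ ^ 2 * r)) (Set.Ioo 0 1) := intC (by fun_prop)
  have i2 : IntegrableOn (fun r => ‖F r‖ * (‖J r‖ * r)) (Set.Ioo 0 1) := S.iF (by fun_prop)
  have i3 : IntegrableOn (fun r => l * lam.im * (‖J r‖ ^ 2 * r)) (Set.Ioo 0 1) :=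
    intC (by fun_prop)
  have i4 : IntegrableOn (fun r => ν * (((J1 r + r * J2 r) * star (J r)).re + r * ‖J1 r‖ ^ 2))
    (Set.Ioo 0 1) := intC (continuousOn_const.mul
      ((Complex.continuous_re.comp_continuousOn (by fun_prop)).add (by fun_prop)))
  have hm := setIntegral_mono_on i1 ((i2.add i3).add i4) measurableSet_Ioo (fun r hr => by
    have hp := (ptw hr.1 (S.eq r hr)).1
    have h1 := (abs_le.1 (re_le (F r) (J r))).2
    have h2 : (F r * star (J r)).re * r ≤ ‖F r‖ * ‖J r‖ * r := by
      have := hr.1.le; gcongr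
    have h3 : 0 ≤ ν * (1 / r + r * l ^ 2) * ‖J r‖ ^ 2 := by
      have := hr.1; have := S.hν; positivity
    simp only [Pi.add_apply]
    linarith)
  rw [integral_add' (i2.add i3) i4, integral_add' i2 i3, integral_const_mul, integral_const_mul,
    integral_const_mul, hP, ← nrm_sq (fun r => ‖J r‖), ← nrm_sq (fun r => ‖J1 r‖)] at hm
  linarith

lemma cQ (S : Sys ν l lam F J J1 J2 M) :
    ContinuousOn (fun r : ℝ => ((r : ℂ) * J1 r * star (J r)).im) (Set.Icc 0 1) := by
  have c0 := S.c0; have c1 := S.c1; have c2 := S.c2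
  exact (Complex.continuous_im.comp_continuousOn (by fun_prop))

lemma cQ' (S : Sys ν l lam F J J1 J2 M) :
    ContinuousOn (fun r : ℝ => ((J1 r + r * J2 r) * star (J r)).im) (Set.Icc 0 1) := by
  have c0 := S.c0; have c1 := S.c1; have c2 := S.c2
  exact (Complex.continuous_im.comp_continuousOn (by fun_prop))

lemma csJ (S : Sys ν l lam F J J1 J2 M) {g : ℝ → ℝ} (hg : ContinuousOn g (Set.Icc 0 1)) :
    ∫ r in Set.Ioo (0:ℝ) 1, ‖J1 r‖ * g r * r ≤ nrm (fun r => ‖J1 r‖) * nrm g := by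
  have c1 := S.c1
  exact csw (f := fun r => ‖J1 r‖) (g := g) (intC (by fun_prop)) (intC (by fun_prop))
    (intC (by fun_prop))

lemma E2 (S : Sys ν l lam F J J1 J2 M) :
    |(l:ℝ)| * (nrm (fun r => r * ‖J r‖) ^ 2 - lam.re * nrm (fun r => ‖J r‖) ^ 2)
      ≤ nrm (fun r => ‖F r‖) * nrm (fun r => ‖J r‖) := by
  have c0 := S.c0; have c1 := S.c1; have c2 := S.c2
  have cQ' := S.cQ'
  have h := S.csF c0.norm
  have hQ := ftc0 S.cQ S.cQ' (fun r hr => dQ (S.d0 r hr) (S.d1 r hr))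
  simp only [S.z0, S.z1, star_zero, mul_zero, Complex.zero_im, sub_zero] at hQ
  obtain ⟨σ, hσ, hσl⟩ : ∃ σ : ℝ, |σ| = 1 ∧ |(l:ℝ)| = σ * l := by
    rcases le_total 0 (l:ℝ) with h | h
    · exact ⟨1, by simp, by rw [abs_of_nonneg h]; ring⟩
    · exact ⟨-1, by simp, by rw [abs_of_nonpos h]; ring⟩
  have i1 : IntegrableOn (fun r => |(l:ℝ)| * ((r * ‖J r‖) ^ 2 * r)) (Set.Ioo 0 1) :=
    intC (by fun_prop)
  have i2 : IntegrableOn (fun r => ‖F r‖ * (‖J r‖ * r)) (Set.Ioo 0 1) := S.iF (by fun_prop)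
  have i3 : IntegrableOn (fun r => |(l:ℝ)| * lam.re * (‖J r‖ ^ 2 * r)) (Set.Ioo 0 1) :=
    intC (by fun_prop)
  have i4 : IntegrableOn (fun r => - σ * ν * (((J1 r + r * J2 r) * star (J r)).im))
    (Set.Ioo 0 1) := intC (continuousOn_const.mul S.cQ')
  have hm := setIntegral_mono_on i1 ((i2.add i3).add i4) measurableSet_Ioo (fun r hr => by
    have hp := (ptw hr.1 (S.eq r hr)).2
    have h2 : - σ * (F r * star (J r)).im * r ≤ ‖F r‖ * ‖J r‖ * r := by
      refine mul_le_mul_of_nonneg_right ?_ hr.1.le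
      calc _ ≤ |- σ * (F r * star (J r)).im| := le_abs_self _
        _ = |(F r * star (J r)).im| := by rw [abs_mul, abs_neg, hσ, one_mul]
        _ ≤ _ := im_le _ _
    simp only [Pi.add_apply]
    rw [hσl]
    have h5 := congrArg (fun x => σ * x) hp
    linarith)
  rw [integral_add' (i2.add i3) i4, integral_add' i2 i3, integral_const_mul, integral_const_mul,
    integral_const_mul, hQ, ← nrm_sq (fun r => ‖J r‖), ← nrm_sq (fun r => r * ‖J r‖)] at hm
  linarith

lemma E3 (S : Sys ν l lam F J J1 J2 M) :
    |(l:ℝ)| * nrm (fun r => |lam.re - r ^ 2| * ‖J r‖) ^ 2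
      ≤ nrm (fun r => ‖F r‖) * nrm (fun r => |lam.re - r ^ 2| * ‖J r‖)
      + 2 * ν * (nrm (fun r => ‖J1 r‖) * nrm (fun r => r * ‖J r‖)) := by
  have c0 := S.c0; have c1 := S.c1; have c2 := S.c2
  have h := S.csF (g := fun r => |lam.re - r ^ 2| * ‖J r‖) (by fun_prop)
  have hJ := S.csJ (g := fun r => r * ‖J r‖) (by fun_prop)
  have cG : ContinuousOn (fun r : ℝ => (-2 * r) * ((r : ℂ) * J1 r * star (J r)).im +
      (lam.re - r ^ 2) * ((J1 r + r * J2 r) * star (J r)).im) (Set.Icc 0 1) :=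
    (ContinuousOn.mul (by fun_prop) S.cQ).add (ContinuousOn.mul (by fun_prop) S.cQ')
  have hQ := ftc0 (f := fun r => (lam.re - r ^ 2) * ((r : ℂ) * J1 r * star (J r)).im)
    (ContinuousOn.mul (by fun_prop) S.cQ) cG (fun r hr => by
      have hh : HasDerivAt (fun r : ℝ => lam.re - r ^ 2) (-2 * r) r :=
        ((hasDerivAt_pow 2 r).const_sub lam.re).congr_deriv (by simp)
      exact hh.mul (dQ (S.d0 r hr) (S.d1 r hr)))
  simp only [S.z0, S.z1, star_zero, mul_zero, Complex.zero_im, sub_zero] at hQ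
  obtain ⟨σ, hσ, hσl⟩ : ∃ σ : ℝ, |σ| = 1 ∧ |(l:ℝ)| = σ * l := by
    rcases le_total 0 (l:ℝ) with h | h
    · exact ⟨1, by simp, by rw [abs_of_nonneg h]; ring⟩
    · exact ⟨-1, by simp, by rw [abs_of_nonpos h]; ring⟩
  have i1 : IntegrableOn (fun r => |(l:ℝ)| * ((|lam.re - r ^ 2| * ‖J r‖) ^ 2 * r)) (Set.Ioo 0 1) :=
    intC (by fun_prop)
  have i2 : IntegrableOn (fun r => ‖F r‖ * (|lam.re - r ^ 2| * ‖J r‖ * r)) (Set.Ioo 0 1) :=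
    S.iF (by fun_prop)
  have i3 : IntegrableOn (fun r => 2 * ν * (‖J1 r‖ * (r * ‖J r‖) * r)) (Set.Ioo 0 1) :=
    intC (by fun_prop)
  have i4 := (intC cG).const_mul (σ * ν)
  have hm := setIntegral_mono_on i1 ((i2.add i3).add i4) measurableSet_Ioo (fun r hr => by
    have hp := (ptw hr.1 (S.eq r hr)).2
    have hr0 := hr.1.le
    have hν := S.hν.le
    have h2 : σ * (lam.re - r ^ 2) * (F r * star (J r)).im * r
        ≤ ‖F r‖ * (|lam.re - r ^ 2| * ‖J r‖) * r := by
      refine mul_le_mul_of_nonneg_right ?_ hr0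
      calc _ ≤ |σ * (lam.re - r ^ 2) * (F r * star (J r)).im| := le_abs_self _
        _ = |lam.re - r ^ 2| * |(F r * star (J r)).im| := by rw [abs_mul, abs_mul, hσ, one_mul]
        _ ≤ |lam.re - r ^ 2| * (‖F r‖ * ‖J r‖) := by gcongr; exact im_le _ _
        _ = _ := by ring
    have h6 : 2 * ν * (σ * ((r : ℂ) * J1 r * star (J r)).im * r) ≤
        2 * ν * ((r * ‖J1 r‖) * ‖J r‖ * r) := by
      refine mul_le_mul_of_nonneg_left (mul_le_mul_of_nonneg_right ?_ hr0) (by positivity)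
      calc _ ≤ |σ * ((r : ℂ) * J1 r * star (J r)).im| := le_abs_self _
        _ = |((r : ℂ) * J1 r * star (J r)).im| := by rw [abs_mul, hσ, one_mul]
        _ ≤ ‖(r : ℂ) * J1 r‖ * ‖J r‖ := im_le _ _
        _ = _ := by rw [norm_mul, Complex.norm_real, Real.norm_of_nonneg hr0]
    simp only [Pi.add_apply]
    rw [hσl, mul_pow, sq_abs]
    have h5 := congrArg (fun x => σ * (lam.re - r ^ 2) * x) hp
    linarith)
  rw [integral_add' (i2.add i3) i4, integral_add' i2 i3, integral_const_mul, integral_const_mul,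
    integral_const_mul, hQ, ← nrm_sq (fun r => |lam.re - r ^ 2| * ‖J r‖)] at hm
  have : 2 * ν * ∫ r in Set.Ioo (0:ℝ) 1, ‖J1 r‖ * (r * ‖J r‖) * r ≤
    2 * ν * (nrm (fun r => ‖J1 r‖) * nrm (fun r => r * ‖J r‖)) := by
    have := S.hν.le
    gcongr
  linarith

lemma U1 (S : Sys ν l lam F J J1 J2 M) :
    nrm (fun r => ‖J r‖) ^ 2 ≤ nrm (fun r => ‖J1 r‖) * nrm (fun r => r * ‖J r‖) := by
  have c0 := S.c0; have c1 := S.c1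
  have hJ := S.csJ (g := fun r => r * ‖J r‖) (by fun_prop)
  have cre : ContinuousOn (fun r => (J1 r * star (J r)).re) (Set.Icc 0 1) :=
    Complex.continuous_re.comp_continuousOn (by fun_prop)
  have cG : ContinuousOn (fun r : ℝ => (2 * r) * ‖J r‖ ^ 2 + r ^ 2 * (2 * (J1 r * star (J r)).re))
    (Set.Icc 0 1) := ContinuousOn.add (by fun_prop)
      (ContinuousOn.mul (by fun_prop) (continuousOn_const.mul cre))
  have hQ := ftc0 (f := fun r => r ^ 2 * ‖J r‖ ^ 2) (by fun_prop) cG (fun r hr => by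
      have hh : HasDerivAt (fun r : ℝ => r ^ 2) (2 * r) r :=
        (hasDerivAt_pow 2 r).congr_deriv (by simp)
      exact hh.mul (dN (S.d0 r hr)))
  simp only [S.z0, S.z1, norm_zero] at hQ
  have i1 : IntegrableOn (fun r => ‖J r‖ ^ 2 * r) (Set.Ioo 0 1) := intC (by fun_prop)
  have i3 : IntegrableOn (fun r => (‖J1 r‖ * (r * ‖J r‖) * r)) (Set.Ioo 0 1) :=
    intC (by fun_prop)
  have i4 := (intC cG).const_mul (1 / 2)
  have hm := setIntegral_mono_on i1 (i3.add i4) measurableSet_Ioo (fun r hr => by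
    have h1 := (abs_le.1 (re_le (J1 r) (J r))).1
    have h2 : r ^ 2 * (-(‖J1 r‖ * ‖J r‖)) ≤ r ^ 2 * (J1 r * star (J r)).re := by gcongr
    simp only [Pi.add_apply]
    linarith)
  rw [integral_add' i3 i4, integral_const_mul, hQ, ← nrm_sq (fun r => ‖J r‖)] at hm
  linarith

end Sys

namespace Sys
variable {ν : ℝ} {l : ℤ} {lam : ℂ} {F J J1 J2 : ℝ → ℂ} {M : ℝ}

lemma U2 (S : Sys ν l lam F J J1 J2 M) {q : ℝ} (hq : 0 < q) (ha : lam.re = q ^ 2) :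
    nrm (fun r => ‖J r‖) ^ 2 / 4 ≤
      nrm (fun r => ‖J1 r‖) * nrm (fun r => |lam.re - r ^ 2| * ‖J r‖) / (2 * q)
      + 2 * nrm (fun r => |lam.re - r ^ 2| * ‖J r‖) ^ 2 / lam.re ^ 2 := by
  have c0 := S.c0; have c1 := S.c1
  have hJ := S.csJ (g := fun r => |lam.re - r ^ 2| * ‖J r‖) (by fun_prop)
  have a0 : 0 < lam.re := by rw [ha]; positivity
  have hpos : ∀ r : ℝ, 0 < r ^ 2 + lam.re := fun r => by positivity
  have cre : ContinuousOn (fun r => (J1 r * star (J r)).re) (Set.Icc 0 1) :=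
    Complex.continuous_re.comp_continuousOn (by fun_prop)
  have cH : ContinuousOn (fun r : ℝ => (r ^ 2 - lam.re) * r ^ 2 / (r ^ 2 + lam.re)) (Set.Icc 0 1) :=
    ContinuousOn.div (by fun_prop) (by fun_prop) (fun r _ => (hpos r).ne')
  have cH' : ContinuousOn (fun r : ℝ =>
      2 * r * (r ^ 4 + 2 * lam.re * r ^ 2 - lam.re ^ 2) / (r ^ 2 + lam.re) ^ 2) (Set.Icc 0 1) :=
    ContinuousOn.div (by fun_prop) (by fun_prop) (fun r _ => (pow_pos (hpos r) 2).ne')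
  have cG : ContinuousOn (fun r : ℝ =>
      (2 * r * (r ^ 4 + 2 * lam.re * r ^ 2 - lam.re ^ 2) / (r ^ 2 + lam.re) ^ 2) * ‖J r‖ ^ 2
      + (r ^ 2 - lam.re) * r ^ 2 / (r ^ 2 + lam.re) * (2 * (J1 r * star (J r)).re))
    (Set.Icc 0 1) := (cH'.mul (by fun_prop)).add (cH.mul (continuousOn_const.mul cre))
  have hQ := ftc0 (f := fun r => (r ^ 2 - lam.re) * r ^ 2 / (r ^ 2 + lam.re) * ‖J r‖ ^ 2)
    (cH.mul (by fun_prop)) cG (fun r hr => by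
      have hs : HasDerivAt (fun r : ℝ => r ^ 2) (2 * r) r :=
        (hasDerivAt_pow 2 r).congr_deriv (by simp)
      have hh := ((hs.sub_const lam.re).mul hs).div (hs.add_const lam.re) (hpos r).ne'
      refine HasDerivAt.mul (hh.congr_deriv ?_) (dN (S.d0 r hr))
      congr 1
      simp only [Pi.mul_apply]
      ring)
  simp only [S.z0, S.z1, norm_zero] at hQ
  have i1 : IntegrableOn (fun r => 1 / 4 * (‖J r‖ ^ 2 * r)) (Set.Ioo 0 1) := intC (by fun_prop)
  have i2 : IntegrableOn (fun r => 1 / (2 * q) * (‖J1 r‖ * (|lam.re - r ^ 2| * ‖J r‖) * r))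
    (Set.Ioo 0 1) := intC (by fun_prop)
  have i3 : IntegrableOn (fun r => 2 / lam.re ^ 2 * ((|lam.re - r ^ 2| * ‖J r‖) ^ 2 * r))
    (Set.Ioo 0 1) := intC (by fun_prop)
  have i4 := (intC cG).const_mul (1 / 2)
  have hm := setIntegral_mono_on i1 ((i2.add i3).add i4) measurableSet_Ioo (fun r hr => by
    simp only [Pi.add_apply]
    have hr0 := hr.1.le
    have hp := hpos r
    obtain ⟨a, haa⟩ : ∃ a, a = lam.re := ⟨_, rfl⟩
    rw [← haa] at hp a0 ha ⊢
    have k1 : 1 / 4 ≤ 2 / a ^ 2 * (a - r ^ 2) ^ 2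
        + (r ^ 4 + 2 * a * r ^ 2 - a ^ 2) / (r ^ 2 + a) ^ 2 := by
      have : 2 * (a - r ^ 2) ^ 2 / (r ^ 2 + a) ^ 2 ≤ 2 / a ^ 2 * (a - r ^ 2) ^ 2 := by
        rw [div_mul_eq_mul_div]
        gcongr
        nlinarith [sq_nonneg r]
      refine le_trans ?_ (add_le_add_left this _)
      rw [← add_div, le_div_iff₀ (by positivity)]
      nlinarith [sq_nonneg (r ^ 2 - a / 2), sq_nonneg a, sq_nonneg (r ^ 2)]
    have k2 : -(1 / (2 * q) * (‖J1 r‖ * (|a - r ^ 2| * ‖J r‖) * r)) ≤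
        (r ^ 2 - a) * r ^ 2 / (r ^ 2 + a) * (J1 r * star (J r)).re := by
      refine neg_le_of_abs_le ?_
      rw [abs_mul, abs_div, abs_mul, abs_of_pos hp, abs_of_nonneg (sq_nonneg r), abs_sub_comm]
      have h1 : r ^ 2 / (r ^ 2 + a) ≤ r / (2 * q) := by
        rw [div_le_div_iff₀ hp (by positivity), ha]
        nlinarith [mul_nonneg hr0 (sq_nonneg (r - q))]
      calc |a - r ^ 2| * r ^ 2 / (r ^ 2 + a) * |(J1 r * star (J r)).re|
          = |a - r ^ 2| * (r ^ 2 / (r ^ 2 + a)) * |(J1 r * star (J r)).re| := by ring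
        _ ≤ |a - r ^ 2| * (r / (2 * q)) * (‖J1 r‖ * ‖J r‖) := by
            gcongr
            exact re_le _ _
        _ = _ := by field_simp
    have k3 : 1 / 4 * (‖J r‖ ^ 2 * r) ≤ (2 / a ^ 2 * (a - r ^ 2) ^ 2
        + (r ^ 4 + 2 * a * r ^ 2 - a ^ 2) / (r ^ 2 + a) ^ 2) * (‖J r‖ ^ 2 * r) := by
      gcongr
    rw [mul_pow |a - r ^ 2|, sq_abs]
    have e : 2 * r * (r ^ 4 + 2 * a * r ^ 2 - a ^ 2) / (r ^ 2 + a) ^ 2 * ‖J r‖ ^ 2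
      = 2 * ((r ^ 4 + 2 * a * r ^ 2 - a ^ 2) / (r ^ 2 + a) ^ 2 * (‖J r‖ ^ 2 * r)) := by ring
    rw [e]
    linarith)
  rw [integral_add' (i2.add i3) i4, integral_add' i2 i3, integral_const_mul, integral_const_mul,
    integral_const_mul, integral_const_mul, hQ, ← nrm_sq (fun r => ‖J r‖),
    ← nrm_sq (fun r => |lam.re - r ^ 2| * ‖J r‖)] at hm
  have h5 := mul_le_mul_of_nonneg_left hJ (by positivity : 0 ≤ 1 / (2 * q))
  have e1 : nrm (fun r => ‖J1 r‖) * nrm (fun r => |lam.re - r ^ 2| * ‖J r‖) / (2 * q)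
    = 1 / (2 * q) * (nrm (fun r => ‖J1 r‖) * nrm (fun r => |lam.re - r ^ 2| * ‖J r‖)) := by ring
  have e2 : 2 * nrm (fun r => |lam.re - r ^ 2| * ‖J r‖) ^ 2 / lam.re ^ 2
    = 2 / lam.re ^ 2 * nrm (fun r => |lam.re - r ^ 2| * ‖J r‖) ^ 2 := by ring
  rw [e1, e2]
  linarith

lemma L1 (S : Sys ν l lam F J J1 J2 M) {y κ a' : ℝ} (hy : 0 < y) (hκ : 0 < κ) (ha' : 0 ≤ a')
    (hs : ∀ s, 0 ≤ s → s ≤ 1 → s ≤ a' + |s - lam.re|) :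
    (∫ r in Set.Ioo (0:ℝ) 1, r * ‖J r‖ * r) ^ 2 ≤
      (y ^ 2 * nrm (fun r => ‖J r‖) ^ 2 + nrm (fun r => |lam.re - r ^ 2| * ‖J r‖) ^ 2)
      * ((a' + κ / 2) * (2 / y) + 1 / (4 * κ)) := by
  have c0 := S.c0
  have hw : ∀ r : ℝ, 0 < y ^ 2 + (lam.re - r ^ 2) ^ 2 := fun r => by positivity
  have hw' : ∀ r : ℝ, Real.sqrt (y ^ 2 + (lam.re - r ^ 2) ^ 2) ≠ 0 :=
    fun r => (Real.sqrt_pos.2 (hw r)).ne'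
  have cw : Continuous (fun r : ℝ => Real.sqrt (y ^ 2 + (lam.re - r ^ 2) ^ 2)) := by fun_prop
  have cg : Continuous (fun r : ℝ => r / Real.sqrt (y ^ 2 + (lam.re - r ^ 2) ^ 2)) :=
    continuous_id.div cw hw'
  have h := csw (f := fun r => Real.sqrt (y ^ 2 + (lam.re - r ^ 2) ^ 2) * ‖J r‖)
    (g := fun r => r / Real.sqrt (y ^ 2 + (lam.re - r ^ 2) ^ 2))
    (intC (by fun_prop)) (intC ((cg.continuousOn.pow 2).mul continuousOn_id))
    (intC (((cw.continuousOn.mul c0.norm).mul cg.continuousOn).mul continuousOn_id))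
  have e : (fun r => Real.sqrt (y ^ 2 + (lam.re - r ^ 2) ^ 2) * ‖J r‖ *
      (r / Real.sqrt (y ^ 2 + (lam.re - r ^ 2) ^ 2)) * r) = fun r => r * ‖J r‖ * r := by
    funext r
    have := hw' r
    field_simp
  rw [e] at h
  have h0 : 0 ≤ ∫ r in Set.Ioo (0:ℝ) 1, r * ‖J r‖ * r :=
    setIntegral_nonneg measurableSet_Ioo fun r hr => by have := hr.1.le; positivity
  have h2 := pow_le_pow_left₀ h0 h 2
  rw [mul_pow] at h2
  change _ ≤ nrm _ ^ 2 * nrm _ ^ 2 at h2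
  have hf : nrm (fun r => Real.sqrt (y ^ 2 + (lam.re - r ^ 2) ^ 2) * ‖J r‖) ^ 2 =
      y ^ 2 * nrm (fun r => ‖J r‖) ^ 2 + nrm (fun r => |lam.re - r ^ 2| * ‖J r‖) ^ 2 := by
    rw [nrm_sq, nrm_sq, nrm_sq, ← integral_const_mul, ← integral_add (intC (by fun_prop))
      (intC (by fun_prop))]
    congr 1
    funext r
    rw [mul_pow, mul_pow, Real.sq_sqrt (hw r).le, sq_abs]
    ring
  have cq : Continuous (fun r : ℝ => r / (y ^ 2 + (lam.re - r ^ 2) ^ 2)) :=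
    continuous_id.div (by fun_prop) (fun r => (hw r).ne')
  have hI : ∫ r in Set.Ioo (0:ℝ) 1, r / (y ^ 2 + (lam.re - r ^ 2) ^ 2) ≤ 2 / y := by
    rw [ftc0 (f := fun r => Real.arctan ((r ^ 2 - lam.re) / y) / (2 * y)) (Continuous.continuousOn
      (Continuous.div_const (Real.continuous_arctan.comp (by fun_prop)) _)) cq.continuousOn ?_]
    · have h1 := Real.arctan_lt_pi_div_two ((1 ^ 2 - lam.re) / y)
      have h2 := Real.neg_pi_div_two_lt_arctan ((0 ^ 2 - lam.re) / y)
      have h3 := Real.pi_lt_four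
      rw [← sub_div, div_le_div_iff₀ (by positivity) hy]
      nlinarith
    · intro r hr
      have hs : HasDerivAt (fun r : ℝ => (r ^ 2 - lam.re) / y) (2 * r / y) r :=
        (((hasDerivAt_pow 2 r).sub_const lam.re).div_const y).congr_deriv (by simp)
      refine (hs.arctan.div_const (2 * y)).congr_deriv ?_
      have := (hw r).ne'
      have h3 : 1 + ((r ^ 2 - lam.re) / y) ^ 2 = (y ^ 2 + (lam.re - r ^ 2) ^ 2) / y ^ 2 := by
        field_simp; ring
      rw [h3]
      field_simp
  have hr1 : ∫ r in Set.Ioo (0:ℝ) 1, r = 1 / 2 := by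
    rw [ftc0 (f := fun r => r ^ 2 / 2) (by fun_prop) (by fun_prop)]
    · norm_num
    · intro r hr
      exact ((hasDerivAt_pow 2 r).div_const 2).congr_deriv (by simp)
  have hg : nrm (fun r => r / Real.sqrt (y ^ 2 + (lam.re - r ^ 2) ^ 2)) ^ 2 ≤
      (a' + κ / 2) * (2 / y) + 1 / (4 * κ) := by
    rw [nrm_sq]
    have i1 : IntegrableOn (fun r => (a' + κ / 2) * (r / (y ^ 2 + (lam.re - r ^ 2) ^ 2)))
      (Set.Ioo 0 1) := intC (continuousOn_const.mul cq.continuousOn)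
    have i2 : IntegrableOn (fun r => 1 / (2 * κ) * r) (Set.Ioo (0:ℝ) 1) := intC (by fun_prop)
    have hm := setIntegral_mono_on (f := fun r : ℝ =>
      (r / Real.sqrt (y ^ 2 + (lam.re - r ^ 2) ^ 2)) ^ 2 * r)
      (intC ((cg.continuousOn.pow 2).mul continuousOn_id)) (i1.add i2) measurableSet_Ioo (fun r hr => by
        simp only [Pi.add_apply]
        rw [div_pow, Real.sq_sqrt (hw r).le]
        have hr0 := hr.1.le
        have h1 := hs (r ^ 2) (by positivity) (pow_le_one₀ hr0 hr.2.le)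
        have h2 : |r ^ 2 - lam.re| ≤ κ / 2 + (lam.re - r ^ 2) ^ 2 / (2 * κ) := by
          rw [← sq_abs (lam.re - r ^ 2), abs_sub_comm lam.re]
          have : κ / 2 + |r ^ 2 - lam.re| ^ 2 / (2 * κ) - |r ^ 2 - lam.re|
            = (|r ^ 2 - lam.re| - κ) ^ 2 / (2 * κ) := by field_simp; ring
          have h3 : 0 ≤ (|r ^ 2 - lam.re| - κ) ^ 2 / (2 * κ) := by positivity
          linarith
        have h4 : (lam.re - r ^ 2) ^ 2 / (2 * κ) ≤ (y ^ 2 + (lam.re - r ^ 2) ^ 2) / (2 * κ) := by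
          gcongr; nlinarith
        have hW := hw r
        obtain ⟨W, hWe⟩ : ∃ W, W = y ^ 2 + (lam.re - r ^ 2) ^ 2 := ⟨_, rfl⟩
        rw [← hWe] at h4 hW ⊢
        calc r ^ 2 / W * r ≤ (a' + κ / 2 + W / (2 * κ)) / W * r := by
              gcongr; linarith
          _ = _ := by field_simp)
    rw [integral_add' i1 i2, integral_const_mul, integral_const_mul, hr1] at hm
    have := mul_le_mul_of_nonneg_left hI (by positivity : 0 ≤ a' + κ / 2)
    have e : 1 / (2 * κ) * (1 / 2) = 1 / (4 * κ) := by field_simp; norm_num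
    linarith
  rw [hf] at h2
  exact h2.trans (mul_le_mul_of_nonneg_left hg (by positivity))

lemma L0 (S : Sys ν l lam F J J1 J2 M) :
    (∫ r in Set.Ioo (0:ℝ) 1, r * ‖J r‖ * r) ≤ nrm (fun r => ‖J r‖) := by
  have c0 := S.c0
  have h := csw (f := fun r => r) (g := fun r => ‖J r‖)
    (intC (by fun_prop)) (intC (by fun_prop)) (intC (by fun_prop))
  refine h.trans ?_
  change _ ≤ nrm _
  have : Real.sqrt (∫ r in Set.Ioo (0:ℝ) 1, r ^ 2 * r) ≤ 1 := by
    rw [ftc0 (f := fun r => r ^ 4 / 4) (by fun_prop) (by fun_prop)]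
    · exact Real.sqrt_le_iff.2 ⟨by norm_num, by norm_num⟩
    · intro r hr
      exact ((hasDerivAt_pow 4 r).div_const 4).congr_deriv (by simp; ring)
  calc _ ≤ 1 * nrm (fun r => ‖J r‖) := mul_le_mul_of_nonneg_right this (nrm_nonneg _)
    _ = _ := one_mul _

end Sys

lemma Sys.exists {l : ℤ} {ν : ℝ} (hν : 0 < ν) {lam : ℂ} {F J : ℝ → ℂ}
    (hJ : ContDiffOn ℝ (⊤ : ℕ∞) J (Set.Icc 0 1))
    (heq : ∀ r ∈ Set.Ioo (0:ℝ) 1, -(ν : ℂ) * hatDone l J r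
              + Complex.I * (l : ℂ) * (lam - (r : ℂ) ^ 2) * J r = F r)
    (z0 : J 0 = 0) (z1 : J 1 = 0) : ∃ J1 J2 M, Sys ν l lam F J J1 J2 M := by
  have hu : UniqueDiffOn ℝ (Set.Icc (0:ℝ) 1) := uniqueDiffOn_Icc zero_lt_one
  have hJ2 : ContDiffOn ℝ 2 J (Set.Icc 0 1) := hJ.of_le (WithTop.coe_le_coe.2 (le_top : (2 : ℕ∞) ≤ ⊤))
  obtain ⟨J1, hJ1e⟩ : ∃ J1, J1 = derivWithin J (Set.Icc 0 1) := ⟨_, rfl⟩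
  have hJ1 : ContDiffOn ℝ 1 J1 (Set.Icc 0 1) := by
    rw [hJ1e]; exact hJ2.derivWithin hu (by norm_num)
  obtain ⟨J2, hJ2e⟩ : ∃ J2, J2 = derivWithin J1 (Set.Icc 0 1) := ⟨_, rfl⟩
  have c2 : ContinuousOn J2 (Set.Icc 0 1) := by
    rw [hJ2e]; exact hJ1.continuousOn_derivWithin hu (by norm_num)
  have c0 := hJ2.continuousOn
  have c1 := hJ1.continuousOn
  have w0 : ∀ r ∈ Set.Icc (0:ℝ) 1, HasDerivWithinAt J (J1 r) (Set.Icc 0 1) r := fun r hr => by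
    rw [hJ1e]; exact ((hJ2.differentiableOn (by norm_num)) r hr).hasDerivWithinAt
  have w1 : ∀ r ∈ Set.Icc (0:ℝ) 1, HasDerivWithinAt J1 (J2 r) (Set.Icc 0 1) r := fun r hr => by
    rw [hJ2e]; exact ((hJ1.differentiableOn (by norm_num)) r hr).hasDerivWithinAt
  have d0 : ∀ r ∈ Set.Ioo (0:ℝ) 1, HasDerivAt J (J1 r) r := fun r hr =>
    (w0 r (Set.Ioo_subset_Icc_self hr)).hasDerivAt (Icc_mem_nhds hr.1 hr.2)
  have d1 : ∀ r ∈ Set.Ioo (0:ℝ) 1, HasDerivAt J1 (J2 r) r := fun r hr =>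
    (w1 r (Set.Ioo_subset_Icc_self hr)).hasDerivAt (Icc_mem_nhds hr.1 hr.2)
  have hdd : ∀ r ∈ Set.Ioo (0:ℝ) 1, deriv (deriv J) r = J2 r := fun r hr => by
    have : deriv J =ᶠ[nhds r] J1 := by
      filter_upwards [Ioo_mem_nhds hr.1 hr.2] with x hx using (d0 x hx).deriv
    rw [this.deriv_eq, (d1 r hr).deriv]
  have heq' : ∀ r ∈ Set.Ioo (0:ℝ) 1, -(ν : ℂ) * (J2 r + J1 r / (r : ℂ)
    - ((1 + (r : ℂ) ^ 2 * (l : ℂ) ^ 2) / (r : ℂ) ^ 2) * J r)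
              + Complex.I * (l : ℂ) * (lam - (r : ℂ) ^ 2) * J r = F r := fun r hr => by
    rw [← heq r hr, hatDone, hdd r hr, (d0 r hr).deriv]
  obtain ⟨B2, hB2⟩ := isCompact_Icc.exists_bound_of_continuousOn c2
  have hG : ∀ r ∈ Set.Ioo (0:ℝ) 1, ‖(r : ℂ) * J1 r - J r‖ ≤ B2 * r ^ 2 := by
    intro r hr
    have hsub : Set.Icc 0 r ⊆ Set.Icc (0:ℝ) 1 := Set.Icc_subset_Icc_right hr.2.le
    have := norm_image_sub_le_of_norm_deriv_le_segment' (a := 0) (b := r) (C := B2 * r)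
      (f := fun r : ℝ => (r : ℂ) * J1 r - J r) (f' := fun r => (r : ℂ) * J2 r) (fun x hx => by
        have h1 : HasDerivWithinAt (fun x : ℝ => (x : ℂ)) 1 (Set.Icc 0 r) x := by
          simpa using (HasDerivAt.ofReal_comp (hasDerivAt_id x)).hasDerivWithinAt
        have h2 := (h1.mul ((w1 x (hsub hx)).mono hsub)).sub ((w0 x (hsub hx)).mono hsub)
        exact h2.congr_deriv (by ring)) (fun x hx => by
        have h3 := hB2 x (hsub (Set.Ico_subset_Icc_self hx))
        rw [norm_mul, Complex.norm_real, Real.norm_of_nonneg hx.1, mul_comm B2]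
        exact mul_le_mul hx.2.le h3 (norm_nonneg _) hr.1.le) r ⟨hr.1.le, le_rfl⟩
    simp only [z0, Complex.ofReal_zero, zero_mul, sub_zero] at this
    linarith
  obtain ⟨B, hB⟩ := isCompact_Icc.exists_bound_of_continuousOn
    (f := fun r : ℝ => -(ν : ℂ) * (J2 r - (l:ℂ) ^ 2 * J r)
      + Complex.I * (l : ℂ) * (lam - (r : ℂ) ^ 2) * J r) (s := Set.Icc 0 1) (by fun_prop)
  refine ⟨J1, J2, B + ν * B2, hν, c0, c1, c2, d0, d1, z0, z1, heq', ?_, ?_⟩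
  · have c0' := c0.mono Set.Ioo_subset_Icc_self
    have c1' := c1.mono Set.Ioo_subset_Icc_self
    have c2' := c2.mono Set.Ioo_subset_Icc_self
    have hne : ∀ r ∈ Set.Ioo (0:ℝ) 1, (r : ℂ) ≠ 0 := fun r hr => by exact_mod_cast hr.1.ne'
    have hne2 : ∀ r ∈ Set.Ioo (0:ℝ) 1, (r : ℂ) ^ 2 ≠ 0 := fun r hr => pow_ne_zero 2 (hne r hr)
    refine ContinuousOn.congr ?_ (fun r hr => (heq' r hr).symm)
    have e1 : ContinuousOn (fun r : ℝ => J1 r / (r : ℂ)) (Set.Ioo 0 1) :=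
      c1'.div (by fun_prop) hne
    have e2 : ContinuousOn (fun r : ℝ => (1 + (r : ℂ) ^ 2 * (l : ℂ) ^ 2) / (r : ℂ) ^ 2)
      (Set.Ioo 0 1) := ContinuousOn.div (by fun_prop) (by fun_prop) hne2
    fun_prop
  · intro r hr
    have hne : (r : ℂ) ≠ 0 := by exact_mod_cast hr.1.ne'
    have e : F r = (-(ν : ℂ) * (J2 r - (l:ℂ) ^ 2 * J r)
      + Complex.I * (l : ℂ) * (lam - (r : ℂ) ^ 2) * J r)
        - (ν : ℂ) * (((r : ℂ) * J1 r - J r) / (r : ℂ) ^ 2) := by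
      rw [← heq' r hr]; field_simp; ring
    rw [e]
    refine (norm_sub_le _ _).trans (add_le_add (hB r (Set.Ioo_subset_Icc_self hr)) ?_)
    rw [norm_mul, norm_div, norm_pow, Complex.norm_real, Complex.norm_real,
      Real.norm_of_nonneg hν.le, Real.norm_of_nonneg hr.1.le]
    refine mul_le_mul_of_nonneg_left ?_ hν.le
    rw [div_le_iff₀ (pow_pos hr.1 2)]
    exact hG r hr


/-- Resolvent estimate for the axisymmetric equation for `J₁` (Proposition 7.1). -/
theorem axisymmetric_J1_estimate :
    ∃ c₇ C : ℝ, c₇ ∈ Set.Ioc (0:ℝ) 1 ∧ 0 < C ∧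
      ∀ (l : ℤ), l ≠ 0 → ∀ ν : ℝ, 0 < ν → ∀ lam : ℂ,
        (l : ℝ) * lam.im ≤ c₇ * |ν * (l : ℝ)| ^ ((1:ℝ)/2) →
        ∀ F J₁ : ℝ → ℂ,
          ContDiffOn ℝ (⊤ : ℕ∞) J₁ (Set.Icc 0 1) →
          (∀ r ∈ Set.Ioo (0:ℝ) 1,
            -(ν : ℂ) * hatDone l J₁ r
              + Complex.I * (l : ℂ) * (lam - (r : ℂ) ^ 2) * J₁ r = F r) →
          J₁ 0 = 0 → J₁ 1 = 0 →
          ((|ν * (l : ℝ)| ^ ((1:ℝ)/2)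
                + ‖(ν : ℂ) * lam * (l : ℂ) ^ 2‖ ^ ((1:ℝ)/3))
              * Real.sqrt (∫ r in Set.Ioo (0:ℝ) 1, ‖J₁ r‖ ^ 2 * r)
            + ν ^ ((1:ℝ)/6) * |(l : ℝ)| ^ ((5:ℝ)/6)
                * (∫ r in Set.Ioo (0:ℝ) 1, r * ‖J₁ r‖ * r)
            ≤ C * Real.sqrt (∫ r in Set.Ioo (0:ℝ) 1, ‖F r‖ ^ 2 * r)) ∧
          ((∀ r ∈ Set.Ioo (0:ℝ) 1, F r = 0) → ∀ r ∈ Set.Icc (0:ℝ) 1, J₁ r = 0) := by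
  refine ⟨1 / 40000, 400000, ⟨by norm_num, by norm_num⟩, by norm_num, ?_⟩
  intro l hl ν hν lam hlam F J hJ heq z0 z1
  obtain ⟨J1, J2, M, S⟩ := Sys.exists hν hJ heq z0 z1
  obtain ⟨n, hne⟩ : ∃ n, n = ν ^ ((1:ℝ)/6) := ⟨_, rfl⟩
  obtain ⟨k, hke⟩ : ∃ k, k = |(l:ℝ)| ^ ((1:ℝ)/6) := ⟨_, rfl⟩
  have hl0 : 0 < |(l:ℝ)| := abs_pos.2 (by exact_mod_cast hl)
  have hn : 0 < n := by rw [hne]; positivity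
  have hk : 0 < k := by rw [hke]; positivity
  have hn6 : ν = n ^ 6 := by
    rw [hne, ← Real.rpow_natCast, ← Real.rpow_mul hν.le]; norm_num
  have hk6 : |(l:ℝ)| = k ^ 6 := by
    rw [hke, ← Real.rpow_natCast, ← Real.rpow_mul hl0.le]; norm_num
  have hk5 : |(l:ℝ)| ^ ((5:ℝ)/6) = k ^ 5 := by
    rw [hke, ← Real.rpow_natCast, ← Real.rpow_mul hl0.le]; norm_num
  have hq : |ν * (l:ℝ)| ^ ((1:ℝ)/2) = n ^ 3 * k ^ 3 := by
    rw [abs_mul, hk6, abs_of_pos hν, hn6, ← Real.sqrt_eq_rpow,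
      show n ^ 6 * k ^ 6 = (n ^ 3 * k ^ 3) ^ 2 by ring]
    exact Real.sqrt_sq (by positivity)
  have hX := nrm_nonneg (fun r => ‖F r‖)
  have hj := nrm_nonneg (fun r => ‖J r‖)
  have E1 := S.E1
  have E2 := S.E2
  have E3 := S.E3
  rw [hn6] at E1 E3
  rw [hk6] at E2 E3
  rw [hq] at hlam
  have h0 : 0 ≤ ∫ r in Set.Ioo (0:ℝ) 1, r * ‖J r‖ * r :=
    setIntegral_nonneg measurableSet_Ioo fun r hr => by have := hr.1.le; positivity
  obtain ⟨R1, R2, R3, R4⟩ := alg_main hn hk hj hX (nrm_nonneg _) (nrm_nonneg _) (nrm_nonneg _) h0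
    hlam E1 E2 E3 S.U1 (fun q hq ha => S.U2 hq ha)
    (fun y κ a' hy hκ ha' hs => S.L1 hy hκ ha' hs) S.L0
  constructor
  · change _ * nrm (fun r => ‖J r‖) + _ ≤ 400000 * nrm (fun r => ‖F r‖)
    rw [hq, hk5, ← hne]
    have h3 : ‖(ν : ℂ) * lam * (l : ℂ) ^ 2‖ ^ ((1:ℝ)/3) * nrm (fun r => ‖J r‖)
        ≤ 80000 * nrm (fun r => ‖F r‖) := by
      refine le_of_pow_le_pow_left₀ (n := 3) (by norm_num) (by positivity) ?_
      have hc : (‖(ν : ℂ) * lam * (l : ℂ) ^ 2‖ ^ ((1:ℝ)/3)) ^ 3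
          = ‖(ν : ℂ) * lam * (l : ℂ) ^ 2‖ := by
        rw [← Real.rpow_natCast, ← Real.rpow_mul (norm_nonneg _)]; norm_num
      have hle : ‖(ν : ℂ) * lam * (l : ℂ) ^ 2‖ ≤ n ^ 6 * k ^ 12 * |lam.re|
          + n ^ 6 * k ^ 6 * |(l:ℝ) * lam.im| := by
        rw [norm_mul, norm_mul, norm_pow, Complex.norm_real, Complex.norm_intCast, hk6,
          Real.norm_of_nonneg hν.le, abs_mul, hk6, hn6]
        have h4 := Complex.norm_le_abs_re_add_abs_im lam
        calc n ^ 6 * ‖lam‖ * (k ^ 6) ^ 2 ≤ n ^ 6 * (|lam.re| + |lam.im|) * (k ^ 6) ^ 2 := by gcongr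
          _ = _ := by ring
      rw [mul_pow, hc]
      have h5 := mul_le_mul_of_nonneg_right hle (pow_nonneg hj 3)
      have h6 := pow_nonneg hX 3
      linarith
    linarith
  · intro hF
    have hX0 : nrm (fun r => ‖F r‖) = 0 := by
      have : nrm (fun r => ‖F r‖) ^ 2 = 0 := by
        rw [nrm_sq, setIntegral_congr_fun (g := fun _ => (0:ℝ)) measurableSet_Ioo
          (fun r hr => by simp [hF r hr])]
        simp
      exact pow_eq_zero_iff (two_ne_zero) |>.1 this
    rw [hX0, mul_zero] at R1
    have hj0 : nrm (fun r => ‖J r‖) = 0 := by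
      have hp : 0 < n ^ 3 * k ^ 3 := by positivity
      exact le_antisymm (by by_contra h; push Not at h; nlinarith) hj
    have hint : ∫ r in Set.Ioo (0:ℝ) 1, ‖J r‖ ^ 2 * r = 0 := by
      rw [← nrm_sq (fun r => ‖J r‖), hj0]; norm_num
    intro r hr
    by_contra hne0
    have hr0 : r ≠ 0 := fun h => hne0 (by rw [h, z0])
    have hrp : 0 < r := lt_of_le_of_ne hr.1 (Ne.symm hr0)
    have c0 := S.c0
    have := intervalIntegral.integral_pos (f := fun r => ‖J r‖ ^ 2 * r) zero_lt_one (by fun_prop)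
      (fun x hx => by have := hx.1.le; positivity) ⟨r, hr, by positivity⟩
    rw [intervalIntegral.integral_of_le zero_le_one, integral_Ioc_eq_integral_Ioo, hint] at this
    exact lt_irrefl _ this
end

section
/- There is a universal constant C > 0 such that for all nonzero integers n, l, all real λ ≥ 1, and every smooth function f : [0,1] → ℂ with f(0) = f(1) = 0, one has ‖f‖_{L²} ≤ C·λ^{−1/3}·‖f‖₁^{1/3}·‖(λ−r²)^{1/2}f‖_{L²}^{2/3}. -/
open MeasureTheory

/-- Squared weighted L² norm `‖f‖² = ∫₀¹ |f(r)|² r dr`. -/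
noncomputable def wL2sq (f : ℝ → ℂ) : ℝ :=
  ∫ r in Set.Ioo (0:ℝ) 1, ‖f r‖ ^ 2 * r

lemma aux_ptwise (f g : ℝ → ℂ) (hf : ContinuousOn f (Set.Icc 0 1))
    (hg : ContinuousOn g (Set.Icc 0 1)) (hd : ∀ x ∈ Set.Ioo (0:ℝ) 1, HasDerivAt f (g x) x)
    (h1 : f 1 = 0) (r : ℝ) (hr : r ∈ Set.Ioo (0:ℝ) 1) :
    ‖f r‖ ^ 2 * r ≤ (1 - r) * wL2sq g := by
  obtain ⟨hr0, hr1⟩ := hr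
  have hsub : Set.Icc r 1 ⊆ Set.Icc 0 1 := Set.Icc_subset_Icc hr0.le le_rfl
  have hgr : ContinuousOn g (Set.Icc r 1) := hg.mono hsub
  have hu : Set.uIcc r 1 = Set.Icc r 1 := Set.uIcc_of_le hr1.le
  have hgi : IntervalIntegrable g volume r 1 :=
    ContinuousOn.intervalIntegrable (by rwa [hu])
  have hni : IntervalIntegrable (fun x => ‖g x‖) volume r 1 := hgi.norm
  have hsi : IntervalIntegrable (fun x => ‖g x‖ ^ 2) volume r 1 :=
    ContinuousOn.intervalIntegrable (by rw [hu]; exact hgr.norm.pow 2)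
  have hwi : IntervalIntegrable (fun x => ‖g x‖ ^ 2 * x) volume r 1 :=
    ContinuousOn.intervalIntegrable (by rw [hu]; exact (hgr.norm.pow 2).mul continuousOn_id)
  have hftc := intervalIntegral.integral_eq_sub_of_hasDerivAt_of_le hr1.le (hf.mono hsub)
    (fun x hx => hd x ⟨hr0.trans hx.1, hx.2⟩) hgi
  have hb : ‖f r‖ ≤ ∫ x in r..1, ‖g x‖ := by
    have := intervalIntegral.norm_integral_le_integral_norm (f := g) (μ := volume) hr1.le
    rw [hftc, h1] at this
    simpa using this
  set I := ∫ x in r..1, ‖g x‖ with hI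
  set H := ∫ x in r..1, ‖g x‖ ^ 2 with hH
  have hpos : 0 < 1 - r := by linarith
  have hCS : I ^ 2 ≤ (1 - r) * H := by
    set m := I / (1 - r) with hm
    have h2 : ∫ x in r..1, 2 * m * ‖g x‖ ≤ ∫ x in r..1, (‖g x‖ ^ 2 + m ^ 2) := by
      apply intervalIntegral.integral_mono_on hr1.le (hni.const_mul _) (hsi.add (by simp))
      intro x _
      nlinarith [sq_nonneg (‖g x‖ - m)]
    rw [intervalIntegral.integral_const_mul, intervalIntegral.integral_add hsi (by simp),
      intervalIntegral.integral_const, smul_eq_mul, ← hI, ← hH] at h2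
    have hmI : I = m * (1 - r) := by rw [hm]; field_simp
    rw [hmI] at h2 ⊢
    nlinarith
  have hW : r * H ≤ ∫ x in r..1, ‖g x‖ ^ 2 * x := by
    rw [hH, ← intervalIntegral.integral_const_mul]
    apply intervalIntegral.integral_mono_on hr1.le (hsi.const_mul _) hwi
    intro x hx
    nlinarith [sq_nonneg ‖g x‖, hx.1]
  have hG : ∫ x in r..1, ‖g x‖ ^ 2 * x ≤ wL2sq g := by
    rw [intervalIntegral.integral_of_le hr1.le, integral_Ioc_eq_integral_Ioo]
    unfold wL2sq
    apply setIntegral_mono_set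
    · exact (((hg.norm.pow 2).mul continuousOn_id).integrableOn_Icc).mono_set
        Set.Ioo_subset_Icc_self
    · filter_upwards [ae_restrict_mem measurableSet_Ioo] with x hx
      exact mul_nonneg (sq_nonneg _) hx.1.le
    · exact (Set.Ioo_subset_Ioo hr0.le le_rfl).eventuallyLE
  have hsq : ‖f r‖ ^ 2 ≤ I ^ 2 := pow_le_pow_left₀ (norm_nonneg _) hb 2
  calc ‖f r‖ ^ 2 * r ≤ ((1 - r) * H) * r := by gcongr; exact hsq.trans hCS
    _ = (1 - r) * (r * H) := by ring
    _ ≤ _ := by gcongr; exact hW.trans hG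

lemma aux_alg (A B D : ℝ) (hA : 0 ≤ A) (hD : 0 ≤ D) (hAB : A ≤ B)
    (h : ∀ δ : ℝ, 0 < δ → A ≤ D / δ + δ ^ 2 * B) : A ^ 3 ≤ 8 * (B * D ^ 2) := by
  rcases (hA.trans hAB).eq_or_lt with hB | hB
  · have : A = 0 := by linarith
    subst this; rw [← hB]; simp
  rcases hD.eq_or_lt with hD0 | hD0
  · have hA0 : A ≤ 0 := by
      by_contra hc
      push Not at hc
      have := h (1/2) (by norm_num)
      rw [← hD0] at h
      have h2 := h (Real.sqrt (A / (2 * B))) (Real.sqrt_pos.2 (by positivity))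
      rw [Real.sq_sqrt (by positivity)] at h2
      have : A / (2 * B) * B = A / 2 := by field_simp
      rw [this] at h2
      simp at h2
      linarith
    have : A = 0 := le_antisymm hA0 hA
    subst this; rw [← hD0]; simp
  · set δ := (D / B) ^ ((1:ℝ)/3) with hδ
    have hq : 0 < D / B := by positivity
    have hδp : 0 < δ := Real.rpow_pos_of_pos hq _
    have h3 : δ ^ 3 = D / B := by
      rw [hδ, ← Real.rpow_natCast, ← Real.rpow_mul hq.le]; norm_num
    have hDe : D = δ ^ 3 * B := by rw [h3]; field_simp
    have h4 := h δ hδp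
    have h5 : D / δ = δ ^ 2 * B := by rw [hDe]; field_simp
    rw [h5] at h4
    calc A ^ 3 ≤ (δ ^ 2 * B + δ ^ 2 * B) ^ 3 := pow_le_pow_left₀ hA h4 3
      _ = 8 * (B * D ^ 2) := by rw [hDe]; ring

lemma aux_root (A B D lam : ℝ) (hA : 0 ≤ A) (hB : 0 ≤ B) (hD : 0 ≤ D) (hl : 1 ≤ lam)
    (h : A ^ 3 * lam ^ 2 ≤ 64 * (B * D ^ 2)) :
    Real.sqrt A ≤ 2 * lam ^ (-(1:ℝ)/3) * Real.sqrt B ^ ((1:ℝ)/3) * Real.sqrt D ^ ((2:ℝ)/3) := by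
  have hl0 : 0 < lam := by linarith
  apply le_of_pow_le_pow_left₀ (n := 6) (by norm_num) (by positivity)
  have e1 : (lam ^ (-(1:ℝ)/3)) ^ 6 = (lam ^ 2)⁻¹ := by
    rw [← Real.rpow_natCast, ← Real.rpow_mul hl0.le, ← Real.rpow_natCast, ← Real.rpow_neg hl0.le]
    norm_num
  have e2 : (Real.sqrt B ^ ((1:ℝ)/3)) ^ 6 = B := by
    rw [← Real.rpow_natCast, ← Real.rpow_mul (Real.sqrt_nonneg _)]
    norm_num
    exact Real.sq_sqrt hB
  have e3 : (Real.sqrt D ^ ((2:ℝ)/3)) ^ 6 = D ^ 2 := by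
    rw [← Real.rpow_natCast, ← Real.rpow_mul (Real.sqrt_nonneg _)]
    norm_num
    rw [show Real.sqrt D ^ 4 = (Real.sqrt D ^ 2) ^ 2 by ring, Real.sq_sqrt hD]
  have e4 : Real.sqrt A ^ 6 = A ^ 3 := by
    rw [show Real.sqrt A ^ 6 = (Real.sqrt A ^ 2) ^ 3 by ring, Real.sq_sqrt hA]
  rw [mul_pow, mul_pow, mul_pow, e1, e2, e3, e4]
  rw [show (2:ℝ) ^ 6 * (lam ^ 2)⁻¹ * B * D ^ 2 = (64 * (B * D ^ 2)) / lam ^ 2 by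
    rw [div_eq_mul_inv]; ring]
  rwa [le_div_iff₀ (by positivity)]

lemma wL2sq_nonneg (f : ℝ → ℂ) : 0 ≤ wL2sq f := by
  apply setIntegral_nonneg measurableSet_Ioo
  intro x hx
  exact mul_nonneg (sq_nonneg _) hx.1.le

/-- Hardy-type interpolation inequality (Lemma 9.1):
`‖f‖_{L²} ≤ C λ^{-1/3} ‖f‖₁^{1/3} ‖(λ−r²)^{1/2} f‖_{L²}^{2/3}`. -/
theorem hardy_interpolation :
    ∃ C : ℝ, 0 < C ∧
      ∀ (n l : ℤ), n ≠ 0 → l ≠ 0 → ∀ lam : ℝ, 1 ≤ lam →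
        ∀ f : ℝ → ℂ,
          ContDiffOn ℝ (⊤ : ℕ∞) f (Set.Icc 0 1) → f 0 = 0 → f 1 = 0 →
          Real.sqrt (wL2sq f)
            ≤ C * lam ^ (-(1:ℝ)/3)
                * Real.sqrt (wL2sq (deriv f) + (n : ℝ) ^ 2 * wL2sq (fun r : ℝ => f r / (r : ℂ))
                    + (l : ℝ) ^ 2 * wL2sq f) ^ ((1:ℝ)/3)
                * Real.sqrt (wL2sq (fun r : ℝ => (Real.sqrt (lam - r ^ 2) : ℂ) * f r))
                    ^ ((2:ℝ)/3) := by
  refine ⟨2, by norm_num, ?_⟩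
  intro n l _ hl lam hlam f hf _ h1
  have hfc : ContinuousOn f (Set.Icc 0 1) := hf.continuousOn
  set g := derivWithin f (Set.Icc 0 1) with hgdef
  have hgc : ContinuousOn g (Set.Icc 0 1) :=
    hf.continuousOn_derivWithin (uniqueDiffOn_Icc one_pos) (by norm_cast)
  have hd : ∀ x ∈ Set.Ioo (0:ℝ) 1, HasDerivAt f (g x) x := by
    intro x hx
    have hdx : DifferentiableWithinAt ℝ f (Set.Icc 0 1) x :=
      (hf.differentiableOn (by simp)) x (Set.Ioo_subset_Icc_self hx)
    exact hdx.hasDerivWithinAt.hasDerivAt (Icc_mem_nhds hx.1 hx.2)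
  have hgd : wL2sq (deriv f) = wL2sq g := by
    apply setIntegral_congr_fun measurableSet_Ioo
    intro x hx
    simp only [(hd x hx).deriv]
  set D := wL2sq (fun r : ℝ => (Real.sqrt (lam - r ^ 2) : ℂ) * f r) with hDdef
  have hDe : D = ∫ r in Set.Ioo (0:ℝ) 1, (lam - r ^ 2) * (‖f r‖ ^ 2 * r) := by
    apply setIntegral_congr_fun measurableSet_Ioo
    intro x hx
    have : 0 ≤ lam - x ^ 2 := by nlinarith [hx.1, hx.2]
    simp only [norm_mul, mul_pow, Complex.norm_real, Real.norm_eq_abs, sq_abs, Real.sq_sqrt this]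
    ring
  have hφc : ContinuousOn (fun r : ℝ => ‖f r‖ ^ 2 * r) (Set.Icc 0 1) :=
    (hfc.norm.pow 2).mul continuousOn_id
  have hφi : IntegrableOn (fun r : ℝ => ‖f r‖ ^ 2 * r) (Set.Ioo 0 1) :=
    hφc.integrableOn_Icc.mono_set Set.Ioo_subset_Icc_self
  have hDi : IntegrableOn (fun r : ℝ => (lam - r ^ 2) * (‖f r‖ ^ 2 * r)) (Set.Ioo 0 1) :=
    (ContinuousOn.mul (by fun_prop) hφc).integrableOn_Icc.mono_set Set.Ioo_subset_Icc_self
  have hA := wL2sq_nonneg f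
  have hD : 0 ≤ D := wL2sq_nonneg _
  have hG := wL2sq_nonneg g
  have hl2 : (1:ℝ) ≤ (l:ℝ) ^ 2 := by
    have : (1:ℤ) ≤ l ^ 2 := by have := sq_pos_of_ne_zero hl; omega
    exact_mod_cast this
  have hN : 0 ≤ (n : ℝ) ^ 2 * wL2sq (fun r : ℝ => f r / (r : ℂ)) :=
    mul_nonneg (sq_nonneg _) (wL2sq_nonneg _)
  rw [hgd]
  set B := wL2sq g + (n : ℝ) ^ 2 * wL2sq (fun r : ℝ => f r / (r : ℂ))
                    + (l : ℝ) ^ 2 * wL2sq f with hB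
  have hAB : wL2sq f ≤ B := by nlinarith
  have hGB : wL2sq g ≤ B := by nlinarith
  have hB0 : 0 ≤ B := hG.trans hGB
  apply aux_root _ _ _ _ hA hB0 hD hlam
  rcases le_total lam 2 with h2 | h2
  · have key := aux_alg (wL2sq f) B D hA hD hAB (by
      intro δ hδ
      have hii : IntegrableOn ((Set.Ioi (1 - δ)).indicator (fun _ => δ * B)) (Set.Ioo (0:ℝ) 1) :=
        Integrable.indicator (integrable_const _) measurableSet_Ioi
      have hm : wL2sq f ≤ ∫ r in Set.Ioo (0:ℝ) 1, ((lam - r ^ 2) * (‖f r‖ ^ 2 * r) / δ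
          + (Set.Ioi (1 - δ)).indicator (fun _ => δ * B) r) := by
        apply setIntegral_mono_on hφi ((hDi.div_const δ).add hii) measurableSet_Ioo
        intro r hr
        rw [Pi.add_apply]
        have hp := aux_ptwise f g hfc hgc hd h1 r hr
        have hφ : 0 ≤ ‖f r‖ ^ 2 * r := mul_nonneg (sq_nonneg _) hr.1.le
        have hlr : 1 - r ≤ lam - r ^ 2 := by nlinarith [hr.1, hr.2]
        by_cases hrd : r ∈ Set.Ioi (1 - δ)
        · rw [Set.indicator_of_mem hrd]
          have hrd' : 1 - δ < r := hrd
          have a1 : (1 - r) * wL2sq g ≤ δ * B :=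
            mul_le_mul (by linarith) hGB hG hδ.le
          have a2 : 0 ≤ (lam - r ^ 2) * (‖f r‖ ^ 2 * r) / δ :=
            div_nonneg (mul_nonneg (by linarith [hr.2]) hφ) hδ.le
          linarith
        · rw [Set.indicator_of_notMem hrd, add_zero, le_div_iff₀ hδ]
          have hrd' : r ≤ 1 - δ := not_lt.1 hrd
          nlinarith
      rw [integral_add (hDi.div_const δ) hii, integral_div, ← hDe] at hm
      have hI : ∫ r in Set.Ioo (0:ℝ) 1, (Set.Ioi (1 - δ)).indicator (fun _ => δ * B) r
          ≤ δ ^ 2 * B := by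
        rw [setIntegral_indicator measurableSet_Ioi, setIntegral_const, smul_eq_mul]
        have : volume.real (Set.Ioo (0:ℝ) 1 ∩ Set.Ioi (1 - δ)) ≤ δ := by
          calc _ ≤ volume.real (Set.Ioo (1 - δ) 1) := by
                apply measureReal_mono
                · intro x hx
                  exact ⟨hx.2, hx.1.2⟩
                · simp
            _ = δ := by
              rw [Real.volume_real_Ioo_of_le (by linarith)]; ring
        have := mul_le_mul_of_nonneg_right this (mul_nonneg hδ.le hB0)
        linarith
      linarith)
    have : lam ^ 2 ≤ 4 := by nlinarith
    have hX : 0 ≤ B * D ^ 2 := by positivity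
    have h3 : 0 ≤ wL2sq f ^ 3 := by positivity
    nlinarith
  · have hm : (lam / 2) * wL2sq f ≤ D := by
      rw [hDe]
      unfold wL2sq
      rw [← integral_const_mul]
      apply setIntegral_mono_on (hφi.const_mul _) hDi measurableSet_Ioo
      intro r hr
      have hφ : 0 ≤ ‖f r‖ ^ 2 * r := mul_nonneg (sq_nonneg _) hr.1.le
      exact mul_le_mul_of_nonneg_right (by nlinarith [hr.1, hr.2]) hφ
    have h5 : ((lam / 2) * wL2sq f) ^ 2 ≤ D ^ 2 := pow_le_pow_left₀ (by positivity) hm 2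
    have h6 := mul_le_mul hAB h5 (by positivity) hB0
    have hX : 0 ≤ B * D ^ 2 := by positivity
    nlinarith
end
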